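/- For every ε > 0 one has ∫₁^T |ζ(1/2+it)|² S²(t) dt ≪_ε T log T (log log T)^{3+ε}. -/

import Mathlib

open Complex Real MeasureTheory Set Filter

noncomputable section

/-- The multiplicity of `ρ` as a zero of the Riemann zeta function
(the order of vanishing, i.e. the least `n` with `ζ⁽ⁿ⁾(ρ) ≠ 0`). -/
def zetaMult (ρ : ℂ) : ℕ := sInf {n : ℕ | iteratedDeriv n riemannZeta ρ ≠ 0}

/-- `ρ` is a nontrivial zero of the Riemann zeta function. -/
def IsNontrivialZero (ρ : ℂ) : Prop := riemannZeta ρ = 0 ∧ 0 < ρ.re ∧ ρ.re < 1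

/-- `S` is the function `S(T) = (1/π) arg ζ(1/2 + iT)`, where the argument is obtained by
continuous variation along the straight segments joining `2`, `2 + iT`, `1/2 + iT`, starting
with the value `0` at `2`; if `T` is an ordinate of a zero then `S(T) = S(T+0)`
(right-continuity). -/
def IsS (S : ℝ → ℝ) : Prop :=
  (∀ T : ℝ, 0 < T →
    (∀ σ : ℝ, 1/2 ≤ σ → σ ≤ 2 → riemannZeta (σ + T * I) ≠ 0) →
    ∃ θ : ℝ → ℂ, ContinuousOn θ (Icc 0 2) ∧
      θ 0 = Complex.log (riemannZeta 2) ∧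
      (∀ u ∈ Icc (0:ℝ) 1, Complex.exp (θ u) = riemannZeta (2 + u * T * I)) ∧
      (∀ u ∈ Icc (1:ℝ) 2, Complex.exp (θ u) = riemannZeta (2 - 3/2 * (u - 1) + T * I)) ∧
      S T = (θ 2).im / π) ∧
  (∀ T : ℝ, 0 < T → Tendsto S (nhdsWithin T (Ioi T)) (nhds (S T)))

/-! ### Mean values of Dirichlet polynomials -/

lemma exp_neg_sq_log_le {T r : ℝ} (hT : 20 ≤ T) (hr : 0 < r) (hr1 : r ≠ 1) :
    Real.exp (-(T ^ 2 * Real.log r ^ 2 / 4)) ≤ 16 / (T ^ 2 * (r - 1) ^ 2) := by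
  have hT0 : 0 < T := by linarith
  have hr1' : 0 < (r - 1) ^ 2 := by
    have : r - 1 ≠ 0 := sub_ne_zero.mpr hr1
    positivity
  rcases le_or_gt r 2 with h2 | h2
  · have hlog : (r - 1) ^ 2 / 4 ≤ Real.log r ^ 2 := by
      rcases le_or_gt 1 r with h1 | h1
      · have h := Real.one_sub_inv_le_log_of_pos hr
        have h' : (r - 1) / 2 ≤ Real.log r := by
          refine le_trans ?_ h
          rw [show 1 - r⁻¹ = (r - 1) / r by field_simp]
          gcongr
        have : 0 ≤ (r - 1) / 2 := by linarith
        nlinarith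
      · have h := Real.log_le_sub_one_of_pos hr
        nlinarith
    set x := T ^ 2 * Real.log r ^ 2 / 4 with hx
    have hx' : T ^ 2 * (r - 1) ^ 2 / 16 ≤ x := by
      rw [hx]; nlinarith [sq_nonneg T]
    have hpos : 0 < T ^ 2 * (r - 1) ^ 2 / 16 := by positivity
    have he : x ≤ Real.exp x := by linarith [Real.add_one_le_exp x]
    rw [Real.exp_neg, show 16 / (T ^ 2 * (r - 1) ^ 2) = (T ^ 2 * (r - 1) ^ 2 / 16)⁻¹ by
      rw [inv_div]]
    exact inv_anti₀ hpos (hx'.trans he)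
  · have hl2 : 0.69 < Real.log r := by
      have := Real.log_le_log (by norm_num) h2.le
      linarith [Real.log_two_gt_d9]
    have hlT : Real.log T ≤ T := by linarith [Real.log_le_sub_one_of_pos hT0]
    have key : 2 * Real.log r + 2 * Real.log T ≤ T ^ 2 * Real.log r ^ 2 / 4 := by
      have h1 : 0.69 * Real.log r ≤ Real.log r ^ 2 := by nlinarith
      have h2 : T * 20 ≤ T ^ 2 := by nlinarith
      nlinarith
    have : Real.exp (-(T ^ 2 * Real.log r ^ 2 / 4)) ≤ 1 / (T ^ 2 * r ^ 2) := by
      rw [Real.exp_neg, ← one_div]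
      apply one_div_le_one_div_of_le (by positivity)
      calc T ^ 2 * r ^ 2 = Real.exp (2 * Real.log r + 2 * Real.log T) := by
            rw [Real.exp_add, mul_comm 2, mul_comm 2, Real.exp_mul, Real.exp_mul,
              Real.exp_log hr, Real.exp_log hT0]
            norm_cast
            ring
        _ ≤ _ := Real.exp_le_exp.mpr key
    refine this.trans ?_
    rw [div_le_div_iff₀ (by positivity) (by positivity)]
    have : (r - 1) ^ 2 ≤ r ^ 2 := by nlinarith
    nlinarith [sq_nonneg T, mul_le_mul_of_nonneg_left this (sq_nonneg T)]

lemma sum_sq_div_add_sq_le {a : ℝ} (ha : 0 < a) (D : ℕ) :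
    ∑ d ∈ Finset.range D, 4 * a ^ 2 / (a + (d + 1)) ^ 2 ≤ 4 * a := by
  suffices h : ∑ d ∈ Finset.range D, 4 * a ^ 2 / (a + (d + 1)) ^ 2 ≤
      4 * a - 4 * a ^ 2 / (a + D) by
    have : 0 ≤ 4 * a ^ 2 / (a + D) := by positivity
    linarith
  induction D with
  | zero => simp; field_simp; linarith
  | succ D ih =>
    rw [Finset.sum_range_succ]
    have : 4 * a ^ 2 / (a + (D + 1)) ^ 2 ≤ 4 * a ^ 2 / (a + D) - 4 * a ^ 2 / (a + (D + 1)) := by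
      rw [div_sub_div _ _ (by positivity) (by positivity),
        div_le_div_iff₀ (by positivity) (by positivity)]
      have hD : (0:ℝ) ≤ D := by positivity
      have : 0 ≤ 4 * a ^ 2 * (a + (D + 1)) := by positivity
      nlinarith [mul_nonneg this (by positivity : (0:ℝ) ≤ 1)]
    push_cast
    linarith

lemma sum_exp_neg_sq_log_le {T y : ℝ} (hT : 20 ≤ T) (hy : 0 ≤ y) (hy1 : y ≤ 1) {n : ℕ}
    (hn : 1 ≤ n) (s : Finset ℕ) (hs : ∀ m ∈ s, 1 ≤ m) :
    ∑ m ∈ s, Real.exp (-(T ^ 2 * (Real.log (m + y) - Real.log (n + y)) ^ 2 / 4)) ≤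
      1 + 64 * n / T := by
  have hT0 : 0 < T := by linarith
  have hn' : (1:ℝ) ≤ n := by exact_mod_cast hn
  set a : ℝ := 4 * (n + y) / T with ha
  have hapos : 0 < a := by positivity
  set F : ℕ → ℝ := fun m => if m = 0 then 0 else
    Real.exp (-(T ^ 2 * (Real.log (m + y) - Real.log (n + y)) ^ 2 / 4)) with hF
  have hF0 : ∀ m, 0 ≤ F m := fun m => by simp only [hF]; split_ifs <;> positivity
  have hF1 : ∀ m, F m ≤ 1 := fun m => by
    simp only [hF]; split_ifs
    · norm_num
    · exact Real.exp_le_one_iff.mpr (by rw [neg_nonpos]; positivity)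
  have hFle : ∀ m : ℕ, m ≠ n → F m ≤ 4 * a ^ 2 / (a + |(m:ℝ) - n|) ^ 2 := by
    intro m hm
    have hd : 0 < |(m:ℝ) - n| := abs_pos.mpr (sub_ne_zero.mpr (by exact_mod_cast hm))
    rcases le_or_gt (|(m:ℝ) - n|) a with h | h
    · refine (hF1 m).trans ?_
      rw [le_div_iff₀ (by positivity)]
      nlinarith
    · simp only [hF]
      split_ifs with h0
      · positivity
      have hm0 : (0:ℝ) < m := by positivity
      have hr : (m + y) / (n + y) ≠ 1 := by
        rw [ne_eq, div_eq_one_iff_eq (by positivity)]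
        intro h; exact hm (by exact_mod_cast (add_right_cancel h))
      have := exp_neg_sq_log_le hT (r := (m + y) / (n + y)) (by positivity) hr
      rw [Real.log_div (by positivity) (by positivity)] at this
      refine this.trans ?_
      have e1 : 16 / (T ^ 2 * ((m + y) / (n + y) - 1) ^ 2) = a ^ 2 / |(m:ℝ) - n| ^ 2 := by
        rw [sq_abs, ha, show (m + y) / (n + y) - 1 = ((m:ℝ) - n) / (n + y) by field_simp; ring]
        have : (m:ℝ) - n ≠ 0 := abs_pos.mp hd
        field_simp
        ring
      rw [e1, div_le_div_iff₀ (by positivity) (by positivity)]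
      have : (a + |(m:ℝ) - n|) ^ 2 ≤ 4 * |(m:ℝ) - n| ^ 2 := by nlinarith
      nlinarith [sq_nonneg a]
  obtain ⟨D, hD⟩ : ∃ D, s ⊆ Finset.range (n + 1 + D) := by
    refine ⟨s.sup id, fun m hm => ?_⟩
    have : m ≤ s.sup id := Finset.le_sup (f := id) hm
    simp; omega
  calc _ = ∑ m ∈ s, F m := Finset.sum_congr rfl fun m hm => by
          simp only [hF]; rw [if_neg]; have := hs m hm; omega
    _ ≤ ∑ m ∈ Finset.range (n + 1 + D), F m :=
        Finset.sum_le_sum_of_subset_of_nonneg hD fun m _ _ => hF0 m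
    _ = ∑ m ∈ Finset.range n, F m + F n + ∑ j ∈ Finset.range D, F (n + 1 + j) := by
        rw [Finset.sum_range_add, Finset.sum_range_succ]
    _ ≤ 4 * a + 1 + 4 * a := by
        gcongr
        · rw [← Finset.sum_range_reflect]
          refine le_trans (Finset.sum_le_sum fun j hj => ?_) (sum_sq_div_add_sq_le hapos n)
          rw [Finset.mem_range] at hj
          refine (hFle _ (by omega)).trans (le_of_eq ?_)
          rw [show ((n - 1 - j : ℕ) : ℝ) = n - (j + 1) by
            rw [Nat.sub_sub, Nat.cast_sub (by omega)]; push_cast; ring]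
          congr 3
          rw [show (n:ℝ) - (j + 1) - n = -(j + 1) by ring, abs_neg, abs_of_pos (by positivity)]
        · exact hF1 n
        · refine le_trans (Finset.sum_le_sum fun j _ => ?_) (sum_sq_div_add_sq_le hapos D)
          refine (hFle _ (by omega)).trans (le_of_eq ?_)
          push_cast
          congr 3
          rw [show (n:ℝ) + 1 + j - n = j + 1 by ring, abs_of_pos (by positivity)]
    _ ≤ 1 + 64 * n / T := by
        have : a ≤ 8 * n / T := by
          rw [ha, div_le_div_iff_of_pos_right hT0]; linarith
        have e : 64 * n / T = 8 * (8 * n / T) := by ring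
        linarith

lemma integrable_gaussian_mul_cexp {T : ℝ} (hT : 0 < T) (x : ℝ) :
    Integrable fun u : ℝ => cexp (I * x * u) * cexp (-(1 / T ^ 2 : ℝ) * u ^ 2) := by
  have h := integrable_cexp_quadratic (b := ((1 / T ^ 2 : ℝ) : ℂ))
    (by rw [ofReal_re]; positivity) (I * x) 0
  refine h.congr (Eventually.of_forall fun u => ?_)
  simp only []
  rw [← Complex.exp_add]
  congr 1
  push_cast; ring

lemma integral_gaussian_mul_cexp {T : ℝ} (hT : 0 < T) (x : ℝ) :
    ∫ u : ℝ, cexp (I * x * u) * cexp (-(1 / T ^ 2 : ℝ) * u ^ 2) =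
      ((√π * T * Real.exp (-(T ^ 2 * x ^ 2 / 4)) : ℝ) : ℂ) := by
  have h := fourierIntegral_gaussian (b := ((1 / T ^ 2 : ℝ) : ℂ))
    (by rw [ofReal_re]; positivity) (x : ℂ)
  rw [h]
  have e1 : ((π : ℂ) / ((1 / T ^ 2 : ℝ) : ℂ)) ^ (1 / 2 : ℂ) = ((√π * T : ℝ) : ℂ) := by
    rw [← ofReal_div, show (1 / 2 : ℂ) = ((1 / 2 : ℝ) : ℂ) by norm_num,
      ← ofReal_cpow (by positivity), ← Real.sqrt_eq_rpow]
    congr 1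
    rw [show π / (1 / T ^ 2) = π * T ^ 2 by field_simp, Real.sqrt_mul (by positivity),
      Real.sqrt_sq hT.le]
  rw [e1]
  push_cast
  congr 2
  field_simp

lemma integrable_and_integral_gaussian_mul_norm_sq_le {T : ℝ} (hT : 0 < T) (s : Finset ℕ)
    (l : ℕ → ℝ) (b : ℕ → ℂ) :
    (Integrable fun u : ℝ =>
      Real.exp (-(u ^ 2 / T ^ 2)) * ‖∑ n ∈ s, b n * cexp (-(I * l n * u))‖ ^ 2) ∧
    ∫ u : ℝ, Real.exp (-(u ^ 2 / T ^ 2)) * ‖∑ n ∈ s, b n * cexp (-(I * l n * u))‖ ^ 2 ≤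
      √π * T * ∑ n ∈ s, ‖b n‖ ^ 2 * ∑ m ∈ s, Real.exp (-(T ^ 2 * (l m - l n) ^ 2 / 4)) := by
  have expand : ∀ u : ℝ,
      ((Real.exp (-(u ^ 2 / T ^ 2)) * ‖∑ n ∈ s, b n * cexp (-(I * l n * u))‖ ^ 2 : ℝ) : ℂ) =
      ∑ m ∈ s, ∑ n ∈ s, b m * (starRingEnd ℂ) (b n) *
        (cexp (I * ((l n - l m : ℝ) : ℂ) * u) * cexp (-(1 / T ^ 2 : ℝ) * u ^ 2)) := by
    intro u
    rw [ofReal_mul, ofReal_pow, ← Complex.mul_conj', map_sum, Finset.sum_mul_sum, Finset.mul_sum]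
    refine Finset.sum_congr rfl fun m _ => ?_
    rw [Finset.mul_sum]
    refine Finset.sum_congr rfl fun n _ => ?_
    rw [map_mul, ← Complex.exp_conj]
    push_cast
    simp only [map_neg, map_mul, conj_I, conj_ofReal]
    rw [show I * ((l n : ℂ) - l m) * u = -(I * l m * u) + -(-I * l n * u) by ring, Complex.exp_add,
      show -(1 / (T:ℂ) ^ 2) * (u:ℂ) ^ 2 = -((u:ℂ) ^ 2 / T ^ 2) by ring]
    ring
  have hint_le : ∀ m n : ℕ, Integrable fun u : ℝ => b m * (starRingEnd ℂ) (b n) *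
        (cexp (I * ((l n - l m : ℝ) : ℂ) * u) * cexp (-(1 / T ^ 2 : ℝ) * u ^ 2)) :=
    fun m n => (integrable_gaussian_mul_cexp hT (l n - l m)).const_mul _
  have hintC : Integrable fun u : ℝ =>
      ((Real.exp (-(u ^ 2 / T ^ 2)) * ‖∑ n ∈ s, b n * cexp (-(I * l n * u))‖ ^ 2 : ℝ) : ℂ) := by
    simp_rw [expand]
    exact integrable_finsetSum _ fun m _ => integrable_finsetSum _ fun n _ => hint_le m n
  refine ⟨hintC.re, ?_⟩
  have hval : ((∫ u : ℝ,
      Real.exp (-(u ^ 2 / T ^ 2)) * ‖∑ n ∈ s, b n * cexp (-(I * l n * u))‖ ^ 2 : ℝ) : ℂ) =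
      ∑ m ∈ s, ∑ n ∈ s, b m * (starRingEnd ℂ) (b n) *
        ((√π * T * Real.exp (-(T ^ 2 * (l n - l m) ^ 2 / 4)) : ℝ) : ℂ) := by
    rw [← integral_complex_ofReal]
    simp_rw [expand]
    rw [integral_finsetSum _ fun m _ => integrable_finsetSum _ fun n _ => hint_le m n]
    refine Finset.sum_congr rfl fun m _ => ?_
    rw [integral_finsetSum _ fun n _ => hint_le m n]
    refine Finset.sum_congr rfl fun n _ => ?_
    rw [integral_const_mul, integral_gaussian_mul_cexp hT]
  generalize (∫ u : ℝ,
      Real.exp (-(u ^ 2 / T ^ 2)) * ‖∑ n ∈ s, b n * cexp (-(I * l n * u))‖ ^ 2 : ℝ) = J at hval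
  clear hintC hint_le expand
  set K : ℕ → ℕ → ℝ := fun m n => √π * T * Real.exp (-(T ^ 2 * (l m - l n) ^ 2 / 4)) with hK
  have hKsymm : ∀ m n, K m n = K n m := fun m n => by
    simp only [hK]; rw [← neg_sub, neg_sq]
  have hKpos : ∀ m n, 0 ≤ K m n := fun m n => by positivity
  have h1 : J ≤ ∑ m ∈ s, ∑ n ∈ s, ‖b m‖ * ‖b n‖ * K n m := by
    have := congrArg norm hval
    rw [norm_real, Real.norm_eq_abs] at this
    refine (le_abs_self _).trans (this.le.trans ?_)
    refine (norm_sum_le _ _).trans (Finset.sum_le_sum fun m _ => ?_)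
    refine (norm_sum_le _ _).trans (Finset.sum_le_sum fun n _ => ?_)
    rw [norm_mul, norm_mul, RCLike.norm_conj, norm_real, Real.norm_eq_abs,
      abs_of_nonneg (hKpos n m)]
  have h2 : ∑ m ∈ s, ∑ n ∈ s, ‖b m‖ * ‖b n‖ * K n m ≤
      ∑ m ∈ s, ∑ n ∈ s, (‖b m‖ ^ 2 * K n m / 2 + ‖b n‖ ^ 2 * K n m / 2) := by
    refine Finset.sum_le_sum fun m _ => Finset.sum_le_sum fun n _ => ?_
    nlinarith [mul_nonneg (hKpos n m) (sq_nonneg (‖b m‖ - ‖b n‖))]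
  refine h1.trans (h2.trans (le_of_eq ?_))
  simp_rw [Finset.sum_add_distrib]
  rw [Finset.sum_comm (f := fun m n => ‖b n‖ ^ 2 * K n m / 2),
    ← Finset.sum_add_distrib, Finset.mul_sum]
  refine Finset.sum_congr rfl fun m _ => ?_
  rw [← Finset.sum_add_distrib, Finset.mul_sum, Finset.mul_sum]
  refine Finset.sum_congr rfl fun n _ => ?_
  rw [hKsymm m n]; simp only [hK]; ring

/-- The large sieve inequality for Dirichlet polynomials over shifted integers. -/
lemma integral_norm_sq_finset_sum_le {T y : ℝ} (hT : 20 ≤ T) (hy : 0 ≤ y) (hy1 : y ≤ 1)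
    (s : Finset ℕ) (hs : ∀ m ∈ s, 1 ≤ m) (b : ℕ → ℂ) :
    ∫ u in (-T)..T, ‖∑ n ∈ s, b n * cexp (-(I * Real.log (n + y) * u))‖ ^ 2 ≤
      400 * ∑ n ∈ s, (T + n) * ‖b n‖ ^ 2 := by
  have hT0 : 0 < T := by linarith
  obtain ⟨hintR, bound⟩ := integrable_and_integral_gaussian_mul_norm_sq_le hT0 s
    (fun n => Real.log (n + y)) b
  have hsqrt : √π ≤ 2 := by
    rw [Real.sqrt_le_left (by norm_num)]
    linarith [Real.pi_lt_four]
  have bound2 : ∫ u : ℝ, Real.exp (-(u ^ 2 / T ^ 2)) *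
        ‖∑ n ∈ s, b n * cexp (-(I * Real.log (n + y) * u))‖ ^ 2 ≤
      128 * ∑ n ∈ s, (T + n) * ‖b n‖ ^ 2 := by
    refine bound.trans ?_
    rw [Finset.mul_sum, Finset.mul_sum]
    refine Finset.sum_le_sum fun n hn => ?_
    have hk := sum_exp_neg_sq_log_le hT hy hy1 (hs n hn) s hs
    calc _ ≤ 2 * T * (‖b n‖ ^ 2 * (1 + 64 * n / T)) := by gcongr
      _ = (2 * T + 128 * n) * ‖b n‖ ^ 2 := by field_simp; ring
      _ ≤ 128 * ((T + n) * ‖b n‖ ^ 2) := by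
          have : 0 ≤ T * ‖b n‖ ^ 2 := by positivity
          linarith
  have hlow : Real.exp (-1) *
        ∫ u in (-T)..T, ‖∑ n ∈ s, b n * cexp (-(I * Real.log (n + y) * u))‖ ^ 2 ≤
      ∫ u : ℝ, Real.exp (-(u ^ 2 / T ^ 2)) *
        ‖∑ n ∈ s, b n * cexp (-(I * Real.log (n + y) * u))‖ ^ 2 := by
    rw [← intervalIntegral.integral_const_mul, intervalIntegral.integral_of_le (by linarith)]
    refine le_trans (setIntegral_mono_on ?_ hintR.integrableOn measurableSet_Ioc ?_)
      (setIntegral_le_integral hintR (Eventually.of_forall fun u => by positivity))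
    · exact (Continuous.integrableOn_Icc (by fun_prop)).mono_set Ioc_subset_Icc_self
    · intro u hu
      gcongr
      rw [div_le_one (by positivity)]
      nlinarith [hu.1, hu.2]
  have he : (1:ℝ) / 3 ≤ Real.exp (-1) := by
    have := Real.exp_one_lt_d9
    rw [Real.exp_neg, ← one_div]
    exact one_div_le_one_div_of_le (Real.exp_pos _) (by linarith)
  have hnn : 0 ≤ ∫ u in (-T)..T, ‖∑ n ∈ s, b n * cexp (-(I * Real.log (n + y) * u))‖ ^ 2 :=
    intervalIntegral.integral_nonneg (by linarith) fun u _ => by positivity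
  have hsum : 0 ≤ ∑ n ∈ s, (T + n) * ‖b n‖ ^ 2 := Finset.sum_nonneg fun n _ => by positivity
  have := mul_le_mul_of_nonneg_right he hnn
  linarith

/-! ### Majorants on short intervals -/

lemma norm_sq_le_integral_of_hasDerivAt {g g' : ℝ → ℂ} (hg : ∀ u, HasDerivAt g (g' u) u)
    (hg' : Continuous g') (u : ℝ) :
    ‖g u‖ ^ 2 ≤ 2 * ∫ v in u..(u + 1), (‖g v‖ ^ 2 + ‖g' v‖ ^ 2) := by
  have hgc : Continuous g := continuous_iff_continuousAt.mpr fun v => (hg v).continuousAt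
  have hGc : Continuous fun v => ‖g v‖ ^ 2 + ‖g' v‖ ^ 2 := by fun_prop
  have hGi : ∀ a b, IntervalIntegrable (fun v => ‖g v‖ ^ 2 + ‖g' v‖ ^ 2) volume a b :=
    fun a b => hGc.intervalIntegrable a b
  set J := ∫ v in u..(u + 1), (‖g v‖ ^ 2 + ‖g' v‖ ^ 2) with hJ
  have hpt : ∀ v ∈ Icc u (u + 1), ‖g u‖ ^ 2 ≤ ‖g v‖ ^ 2 + J := by
    intro v hv
    have hd : ∀ x ∈ uIcc u v, HasDerivAt (fun x => ‖g x‖ ^ 2) (2 * inner ℝ (g x) (g' x)) x :=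
      fun x _ => (hg x).norm_sq
    have hc : Continuous fun x => 2 * inner ℝ (g x) (g' x) := by fun_prop
    have h1 := intervalIntegral.integral_eq_sub_of_hasDerivAt hd (hc.intervalIntegrable u v)
    have h2 : -∫ x in u..v, 2 * inner ℝ (g x) (g' x) ≤ ∫ x in u..v, (‖g x‖ ^ 2 + ‖g' x‖ ^ 2) := by
      rw [← intervalIntegral.integral_neg]
      refine intervalIntegral.integral_mono_on hv.1 (hc.neg.intervalIntegrable u v) (hGi u v) ?_
      intro x _
      have := abs_le.mp (abs_real_inner_le_norm (g x) (g' x))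
      nlinarith [sq_nonneg (‖g x‖ - ‖g' x‖)]
    have h3 : ∫ x in u..v, (‖g x‖ ^ 2 + ‖g' x‖ ^ 2) ≤ J := by
      rw [hJ]
      refine intervalIntegral.integral_mono_interval le_rfl hv.1 hv.2
        (Eventually.of_forall fun x => ?_) (hGi _ _)
      simp only [Pi.zero_apply]; positivity
    linarith
  have h4 : ∫ _v in u..(u + 1), ‖g u‖ ^ 2 ≤ ∫ v in u..(u + 1), (‖g v‖ ^ 2 + J) :=
    intervalIntegral.integral_mono_on (by linarith) (by simp)
      ((by fun_prop : Continuous fun v => ‖g v‖ ^ 2 + J).intervalIntegrable _ _) hpt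
  rw [intervalIntegral.integral_add ((by fun_prop : Continuous fun v => ‖g v‖ ^ 2).intervalIntegrable _ _)
    (by simp)] at h4
  simp only [intervalIntegral.integral_const, add_sub_cancel_left, smul_eq_mul, one_mul] at h4
  have h5 : ∫ v in u..(u + 1), ‖g v‖ ^ 2 ≤ J :=
    intervalIntegral.integral_mono_on (by linarith)
      ((by fun_prop : Continuous fun v => ‖g v‖ ^ 2).intervalIntegrable _ _) (hGi _ _)
      fun v _ => by nlinarith [sq_nonneg (‖g' v‖)]
  linarith

lemma exists_majorant {T H : ℝ} (hT : 20 ≤ T) (hH : 0 ≤ H) (hHT : H + 1 ≤ T) (s : Finset ℕ)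
    {X : ℝ} (hs : ∀ m ∈ s, 1 ≤ m ∧ (m : ℝ) ≤ X) (b : ℕ → ℂ) :
    ∃ Z : ℝ → ℝ, Continuous Z ∧ (∀ t, 0 ≤ Z t) ∧
      (∀ t u : ℝ, |u - t| ≤ H → ‖∑ n ∈ s, b n * cexp (-(I * Real.log n * u))‖ ^ 2 ≤ Z t) ∧
      ∫ t in (0:ℝ)..T, Z t ≤
        1600 * (2 * H + 1) * (1 + Real.log X) ^ 2 * ∑ n ∈ s, (T + n) * ‖b n‖ ^ 2 := by
  set g : ℝ → ℂ := fun u => ∑ n ∈ s, b n * cexp (-(I * Real.log n * u)) with hg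
  set g' : ℝ → ℂ := fun u => ∑ n ∈ s, (b n * -(I * Real.log n)) * cexp (-(I * Real.log n * u))
    with hg'
  have hgc : Continuous g := by simp only [hg]; fun_prop
  have hgc' : Continuous g' := by simp only [hg']; fun_prop
  have hd : ∀ u, HasDerivAt g (g' u) u := by
    intro u
    simp only [hg, hg']
    refine HasDerivAt.fun_sum fun n _ => ?_
    have h1 : HasDerivAt (fun u : ℝ => -(I * Real.log n * (u:ℂ))) (-(I * Real.log n * 1)) u :=
      ((Complex.ofRealCLM.hasDerivAt (x := u)).const_mul _).neg
    have h2 := (h1.cexp).const_mul (b n)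
    rw [mul_one] at h2
    rw [mul_assoc, mul_comm (-(I * (Real.log n : ℂ)))]
    exact h2
  have hGc : Continuous fun v => ‖g v‖ ^ 2 + ‖g' v‖ ^ 2 := by fun_prop
  have hG0 : ∀ v, 0 ≤ ‖g v‖ ^ 2 + ‖g' v‖ ^ 2 := fun v => by positivity
  have hmean : ∫ v in (-(2 * T))..(2 * T), (‖g v‖ ^ 2 + ‖g' v‖ ^ 2) ≤
      800 * (1 + Real.log X) ^ 2 * ∑ n ∈ s, (T + n) * ‖b n‖ ^ 2 := by
    rw [intervalIntegral.integral_add ((by fun_prop : Continuous _).intervalIntegrable _ _)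
      ((by fun_prop : Continuous _).intervalIntegrable _ _)]
    have h1 := integral_norm_sq_finset_sum_le (T := 2 * T) (y := 0) (by linarith) le_rfl (by simp) s
      (fun m hm => (hs m hm).1) b
    have h2 := integral_norm_sq_finset_sum_le (T := 2 * T) (y := 0) (by linarith) le_rfl (by simp) s
      (fun m hm => (hs m hm).1) (fun n => b n * -(I * Real.log n))
    simp only [add_zero] at h1 h2
    refine (add_le_add h1 h2).trans ?_
    rw [← mul_add, ← Finset.sum_add_distrib, Finset.mul_sum, Finset.mul_sum]
    refine Finset.sum_le_sum fun n hn => ?_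
    obtain ⟨hn1, hnX⟩ := hs n hn
    have hn1' : (1:ℝ) ≤ n := by exact_mod_cast hn1
    have hl0 : 0 ≤ Real.log n := Real.log_nonneg hn1'
    have hlX : Real.log n ≤ Real.log X := Real.log_le_log (by linarith) hnX
    rw [norm_mul, norm_neg, norm_mul, norm_I, one_mul, norm_real, Real.norm_eq_abs,
      abs_of_nonneg hl0, mul_pow]
    have e : 1 + Real.log n ^ 2 ≤ (1 + Real.log X) ^ 2 := by nlinarith
    have e2 : 2 * T + n ≤ 2 * (T + n) := by linarith
    calc _ = 400 * ((2 * T + n) * ((1 + Real.log n ^ 2) * ‖b n‖ ^ 2)) := by ring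
      _ ≤ 400 * ((2 * (T + n)) * ((1 + Real.log X) ^ 2 * ‖b n‖ ^ 2)) := by gcongr
      _ = _ := by ring
  set G : ℝ → ℝ := fun v => ‖g v‖ ^ 2 + ‖g' v‖ ^ 2 with hG
  have hGi : ∀ a b, IntervalIntegrable G volume a b := fun a b => hGc.intervalIntegrable a b
  have hZc : Continuous fun t => ∫ v in (-H)..(H + 1), G (t + v) :=
    intervalIntegral.continuous_parametric_intervalIntegral_of_continuous' (by fun_prop) _ _
  refine ⟨fun t => 2 * ∫ v in (-H)..(H + 1), G (t + v), by fun_prop, fun t => ?_, ?_, ?_⟩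
  · have := intervalIntegral.integral_nonneg (μ := volume) (by linarith : -H ≤ H + 1)
      fun v _ => hG0 (t + v)
    simp only [hG]; positivity
  · intro t u htu
    refine (norm_sq_le_integral_of_hasDerivAt hd hgc' u).trans ?_
    simp only [intervalIntegral.integral_comp_add_left]
    gcongr 2 * ?_
    have := abs_le.mp htu
    exact intervalIntegral.integral_mono_interval (by linarith) (by linarith) (by linarith)
      (Eventually.of_forall hG0) (hGi _ _)
  · rw [intervalIntegral.integral_const_mul]
    rw [show ∫ t in (0:ℝ)..T, ∫ v in (-H)..(H + 1), G (t + v) =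
      ∫ v in (-H)..(H + 1), ∫ t in (0:ℝ)..T, G (t + v) from ?_]
    · have : ∫ v in (-H)..(H + 1), ∫ t in (0:ℝ)..T, G (t + v) ≤
          ∫ _v in (-H)..(H + 1), 800 * (1 + Real.log X) ^ 2 * ∑ n ∈ s, (T + n) * ‖b n‖ ^ 2 := by
        refine intervalIntegral.integral_mono_on (by linarith) ?_ (by simp) fun v hv => ?_
        · exact (intervalIntegral.continuous_parametric_intervalIntegral_of_continuous'
            (f := fun v t => G (t + v)) (by fun_prop) _ _).intervalIntegrable _ _
        · rw [intervalIntegral.integral_comp_add_right]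
          refine le_trans ?_ hmean
          exact intervalIntegral.integral_mono_interval (by linarith [hv.1]) (by linarith)
            (by linarith [hv.2]) (Eventually.of_forall hG0) (hGi _ _)
      rw [intervalIntegral.integral_const, smul_eq_mul] at this
      linarith
    · refine intervalIntegral_intervalIntegral_swap (F := fun t v => G (t + v)) ?_
      exact ((by fun_prop : Continuous fun p : ℝ × ℝ => G (p.1 + p.2)).continuousOn.integrableOn_compact
        (isCompact_uIcc.prod isCompact_uIcc)).mono_set
        (Set.prod_mono uIoc_subset_uIcc uIoc_subset_uIcc)

/-! ### The zeta function to the right of the imaginary axis -/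

/-- The `n`-th Euler–Maclaurin remainder `n^{-s} - ∫_n^{n+1} x^{-s} dx`. -/
def zetaRem (n : ℕ) (s : ℂ) : ℂ :=
  (n : ℂ) ^ (-s) - ((n : ℂ) ^ (1 - s) - ((n : ℂ) + 1) ^ (1 - s)) / (s - 1)

lemma hasDerivAt_nat_add_cpow {n : ℕ} (hn : 1 ≤ n) (w : ℂ) {z : ℝ} (hz : 0 ≤ z) :
    HasDerivAt (fun z : ℝ => ((n : ℂ) + z) ^ w) (w * ((n : ℂ) + z) ^ (w - 1)) z := by
  have h1 : HasDerivAt (fun z : ℂ => (n : ℂ) + z) 1 (z : ℂ) := (hasDerivAt_id (z : ℂ)).const_add _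
  have h0 : (n : ℂ) + z ∈ slitPlane := by
    left
    have : (1:ℝ) ≤ n := by exact_mod_cast hn
    simp; linarith
  exact ((h1.cpow_const (c := w) h0).comp_ofReal).congr_deriv (mul_one _)

lemma nat_add_pos {n : ℕ} (hn : 1 ≤ n) {z : ℝ} (hz : 0 ≤ z) : 0 < (n : ℝ) + z := by
  have : (1:ℝ) ≤ n := by exact_mod_cast hn
  linarith

lemma norm_nat_add_cpow {n : ℕ} (hn : 1 ≤ n) (w : ℂ) {z : ℝ} (hz : 0 ≤ z) :
    ‖((n : ℂ) + z) ^ w‖ = ((n : ℝ) + z) ^ w.re := by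
  rw [show ((n : ℂ) + z) = (((n : ℝ) + z : ℝ) : ℂ) by push_cast; rfl,
    norm_cpow_eq_rpow_re_of_pos (nat_add_pos hn hz)]

lemma continuousOn_nat_add_cpow {n : ℕ} (hn : 1 ≤ n) (w : ℂ) :
    ContinuousOn (fun z : ℝ => ((n : ℂ) + z) ^ w) (uIcc 0 1) := fun z hz => by
  rw [uIcc_of_le zero_le_one] at hz
  exact (hasDerivAt_nat_add_cpow hn w hz.1).continuousAt.continuousWithinAt

lemma zetaRem_eq_integral {n : ℕ} (hn : 1 ≤ n) {s : ℂ} (hs : s ≠ 1) :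
    zetaRem n s = s * ∫ z in (0:ℝ)..1, (1 - z : ℂ) * ((n : ℂ) + z) ^ (-s - 1) := by
  have hs' : s - 1 ≠ 0 := sub_ne_zero.mpr hs
  have hI : ∫ z in (0:ℝ)..1, ((n : ℂ) + z) ^ (-s) =
      ((n : ℂ) ^ (1 - s) - ((n : ℂ) + 1) ^ (1 - s)) / (s - 1) := by
    have hd : ∀ z ∈ uIcc (0:ℝ) 1, HasDerivAt (fun z : ℝ => ((n : ℂ) + z) ^ (1 - s) / (1 - s))
        (((n : ℂ) + z) ^ (-s)) z := by
      intro z hz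
      rw [uIcc_of_le zero_le_one] at hz
      have h := (hasDerivAt_nat_add_cpow hn (1 - s) hz.1).div_const (1 - s)
      refine h.congr_deriv ?_
      have : (1 - s) ≠ 0 := by rw [← neg_sub]; exact neg_ne_zero.mpr hs'
      rw [show 1 - s - 1 = -s by ring, mul_div_cancel_left₀ _ this]
    rw [intervalIntegral.integral_eq_sub_of_hasDerivAt hd
      (continuousOn_nat_add_cpow hn _).intervalIntegrable]
    rw [← neg_sub s 1, div_neg, div_neg]
    push_cast
    rw [add_zero]
    ring
  have hd : ∀ z ∈ uIcc (0:ℝ) 1, HasDerivAt (fun z : ℝ => (1 - z : ℂ) * ((n : ℂ) + z) ^ (-s))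
      (-(((n : ℂ) + z) ^ (-s)) + -s * ((1 - z : ℂ) * ((n : ℂ) + z) ^ (-s - 1))) z := by
    intro z hz
    rw [uIcc_of_le zero_le_one] at hz
    have h1 : HasDerivAt (fun z : ℝ => (1 - z : ℂ)) (-1) z :=
      (Complex.ofRealCLM.hasDerivAt (x := z)).const_sub _
    have h := h1.mul (hasDerivAt_nat_add_cpow hn (-s) hz.1)
    exact h.congr_deriv (by ring)
  have hc1 := (continuousOn_nat_add_cpow hn (-s)).intervalIntegrable (μ := volume)
  have hc2 : IntervalIntegrable (fun z : ℝ => (1 - z : ℂ) * ((n : ℂ) + z) ^ (-s - 1)) volume 0 1 :=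
    ((by fun_prop : Continuous fun z : ℝ => (1 - z : ℂ)).continuousOn.mul
      (continuousOn_nat_add_cpow hn (-s - 1))).intervalIntegrable
  have h := intervalIntegral.integral_eq_sub_of_hasDerivAt hd (hc1.neg.add (hc2.const_mul _))
  rw [intervalIntegral.integral_add (f := fun z : ℝ => -((n : ℂ) + z) ^ (-s)) hc1.neg
      (hc2.const_mul _), intervalIntegral.integral_neg,
    intervalIntegral.integral_const_mul, hI] at h
  push_cast at h
  simp only [sub_self, zero_mul, sub_zero, add_zero, one_mul, zero_sub] at h
  rw [zetaRem]
  linear_combination h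

lemma norm_zetaRem_le {n : ℕ} (hn : 1 ≤ n) {s : ℂ} (hs : s ≠ 1) (hs0 : 0 ≤ s.re) :
    ‖zetaRem n s‖ ≤ ‖s‖ * (n : ℝ) ^ (-s.re - 1) := by
  rw [zetaRem_eq_integral hn hs, norm_mul]
  gcongr
  have := intervalIntegral.norm_integral_le_of_norm_le_const (a := 0) (b := 1)
    (f := fun z : ℝ => (1 - z : ℂ) * ((n : ℂ) + z) ^ (-s - 1)) (C := (n : ℝ) ^ (-s.re - 1)) ?_
  · simpa using this
  intro z hz
  rw [uIoc_of_le zero_le_one] at hz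
  rw [norm_mul, norm_nat_add_cpow hn _ hz.1.le]
  have h1 : ‖(1 - z : ℂ)‖ ≤ 1 := by
    rw [← ofReal_one, ← ofReal_sub, norm_real, Real.norm_eq_abs, abs_le]
    constructor <;> linarith [hz.1, hz.2]
  have h2 : ((n : ℝ) + z) ^ (-s - 1).re ≤ (n : ℝ) ^ (-s.re - 1) := by
    simp only [sub_re, neg_re, one_re]
    have : (1:ℝ) ≤ n := by exact_mod_cast hn
    exact Real.rpow_le_rpow_of_nonpos (by linarith) (by linarith [hz.1]) (by linarith)
  have h3 : 0 ≤ ((n : ℝ) + z) ^ (-s - 1).re := Real.rpow_nonneg (nat_add_pos hn hz.1.le).le _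
  calc _ ≤ 1 * (n : ℝ) ^ (-s.re - 1) := by gcongr
    _ = _ := one_mul _

lemma summable_nat_rpow_neg_sub_one {a : ℝ} (ha : 0 < a) :
    Summable fun n : ℕ => ((n + 1 : ℕ) : ℝ) ^ (-a - 1) :=
  (summable_nat_add_iff 1).mpr (Real.summable_nat_rpow.mpr (by linarith))

lemma summable_zetaRem {s : ℂ} (hs : s ≠ 1) (hs0 : 0 < s.re) :
    Summable fun n : ℕ => zetaRem (n + 1) s :=
  Summable.of_norm_bounded ((summable_nat_rpow_neg_sub_one hs0).mul_left ‖s‖)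
    fun n => norm_zetaRem_le (by omega) hs hs0.le

lemma sum_range_zetaRem (N : ℕ) (s : ℂ) :
    ∑ n ∈ Finset.range N, zetaRem (n + 1) s =
      ∑ n ∈ Finset.range N, ((n + 1 : ℕ) : ℂ) ^ (-s) - (1 - ((N + 1 : ℕ) : ℂ) ^ (1 - s)) / (s - 1) := by
  induction N with
  | zero => simp
  | succ N ih =>
    rw [Finset.sum_range_succ, Finset.sum_range_succ, ih, zetaRem]
    push_cast
    ring

lemma tsum_zetaRem_of_one_lt_re {s : ℂ} (hs : 1 < s.re) :
    riemannZeta s = 1 / (s - 1) + ∑' n : ℕ, zetaRem (n + 1) s := by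
  have hs1 : s ≠ 1 := fun h => by simp [h] at hs
  have h1 := (summable_zetaRem hs1 (by linarith)).hasSum.tendsto_sum_nat
  simp_rw [sum_range_zetaRem] at h1
  have hsum : Summable fun n : ℕ => ((n + 1 : ℕ) : ℂ) ^ (-s) := by
    have := (summable_nat_add_iff 1).mpr (Complex.summable_one_div_nat_cpow.mpr hs)
    refine this.congr fun n => ?_
    rw [cpow_neg, one_div]
  have h2 := hsum.hasSum.tendsto_sum_nat
  have h3 : Tendsto (fun N : ℕ => ((N + 1 : ℕ) : ℂ) ^ (1 - s)) atTop (nhds 0) := by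
    rw [tendsto_zero_iff_norm_tendsto_zero]
    have : Tendsto (fun N : ℕ => ((N + 1 : ℕ) : ℝ) ^ (-(s.re - 1))) atTop (nhds 0) :=
      ((tendsto_rpow_neg_atTop (by linarith)).comp tendsto_natCast_atTop_atTop).comp
        (tendsto_add_atTop_nat 1)
    refine this.congr fun N => ?_
    rw [norm_natCast_cpow_of_pos (by omega)]
    simp
  have h4 := h2.sub ((h3.const_sub 1).div_const (s - 1))
  have h5 := tendsto_nhds_unique h1 h4
  rw [h5, zeta_eq_tsum_one_div_nat_add_one_cpow hs]
  have : ∀ n : ℕ, 1 / ((n : ℂ) + 1) ^ s = ((n + 1 : ℕ) : ℂ) ^ (-s) := fun n => by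
    rw [cpow_neg, one_div]; push_cast; rfl
  simp_rw [this]
  ring

lemma differentiableAt_zetaRem {n : ℕ} (hn : 1 ≤ n) {s : ℂ} (hs : s ≠ 1) :
    DifferentiableAt ℂ (zetaRem n) s := by
  unfold zetaRem
  have h0 : (n : ℂ) ≠ 0 := by exact_mod_cast (by omega : n ≠ 0)
  have h1 : (n : ℂ) + 1 ≠ 0 := by exact_mod_cast (by omega : n + 1 ≠ 0)
  have h2 : s - 1 ≠ 0 := sub_ne_zero.mpr hs
  refine DifferentiableAt.sub ?_ (DifferentiableAt.div (DifferentiableAt.sub ?_ ?_) ?_ h2)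
  · exact (differentiableAt_id.neg).const_cpow (Or.inl h0)
  · exact ((differentiableAt_const _).sub differentiableAt_id).const_cpow (Or.inl h0)
  · exact ((differentiableAt_const _).sub differentiableAt_id).const_cpow (Or.inl h1)
  · exact differentiableAt_id.sub_const 1

lemma ne_one_of_im_pos {s : ℂ} (h : 0 < s.im) : s ≠ 1 := fun h' => by simp [h'] at h

lemma riemannZeta_eq_tsum_zetaRem {s : ℂ} (hs : 0 < s.re) (hi : 0 < s.im) :
    riemannZeta s = 1 / (s - 1) + ∑' n : ℕ, zetaRem (n + 1) s := by
  set U : Set ℂ := {z | 0 < z.re} ∩ {z | 0 < z.im} with hU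
  have hUo : IsOpen U := (isOpen_lt continuous_const continuous_re).inter
    (isOpen_lt continuous_const continuous_im)
  have hUc : Convex ℝ U := (convex_halfSpace_re_gt 0).inter (convex_halfSpace_im_gt 0)
  have hd1 : DifferentiableOn ℂ riemannZeta U := fun z hz =>
    (differentiableAt_riemannZeta (ne_one_of_im_pos hz.2)).differentiableWithinAt
  have hd2 : DifferentiableOn ℂ (fun s : ℂ => 1 / (s - 1) + ∑' n : ℕ, zetaRem (n + 1) s) U := by
    refine DifferentiableOn.add (fun z hz => ?_) (fun z hz => ?_)
    · have h0 : z - 1 ≠ 0 := sub_ne_zero.mpr (ne_one_of_im_pos hz.2)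
      have h1 : DifferentiableAt ℂ (fun z : ℂ => z - 1) z := differentiableAt_id.sub_const 1
      exact ((differentiableAt_const (1:ℂ)).div h1 h0).differentiableWithinAt
    · set V : Set ℂ := ({w | z.re / 2 < w.re} ∩ {w | 0 < w.im}) ∩ Metric.ball 0 (‖z‖ + 1) with hV
      have hVo : IsOpen V := ((isOpen_lt continuous_const continuous_re).inter
        (isOpen_lt continuous_const continuous_im)).inter Metric.isOpen_ball
      have hzV : z ∈ V := ⟨⟨by have := hz.1; simp only [mem_setOf_eq] at *; linarith, hz.2⟩, by simp⟩
      have hzr : 0 < z.re / 2 := half_pos hz.1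
      have : DifferentiableOn ℂ (fun s : ℂ => ∑' n : ℕ, zetaRem (n + 1) s) V := by
        refine differentiableOn_tsum_of_summable_norm
          ((summable_nat_rpow_neg_sub_one hzr).mul_left (‖z‖ + 1)) (fun n w hw => ?_) hVo
          (fun n w hw => ?_)
        · exact (differentiableAt_zetaRem (by omega)
            (ne_one_of_im_pos hw.1.2)).differentiableWithinAt
        · have hw1 : z.re / 2 < w.re := hw.1.1
          have hw2 : ‖w‖ < ‖z‖ + 1 := by simpa using hw.2
          refine (norm_zetaRem_le (by omega) (ne_one_of_im_pos hw.1.2) (by linarith)).trans ?_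
          gcongr
          exact_mod_cast (by omega : 1 ≤ n + 1)
      exact (this.differentiableAt (hVo.mem_nhds hzV)).differentiableWithinAt
  have hp : (2 + I : ℂ) ∈ U := by constructor <;> simp
  have hev : riemannZeta =ᶠ[nhds (2 + I)] fun s : ℂ => 1 / (s - 1) + ∑' n : ℕ, zetaRem (n + 1) s := by
    have : {z : ℂ | 1 < z.re} ∈ nhds (2 + I : ℂ) :=
      (isOpen_lt continuous_const continuous_re).mem_nhds (by simp)
    filter_upwards [this] with z hz using tsum_zetaRem_of_one_lt_re hz
  exact (hd1.analyticOnNhd hUo).eqOn_of_preconnected_of_eventuallyEq (hd2.analyticOnNhd hUo)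
    hUc.isPreconnected hp hev ⟨hs, hi⟩

/-- Approximation of zeta by its partial sums with explicit remainder. -/
lemma riemannZeta_eq_sum_add {s : ℂ} (hs : 0 < s.re) (hi : 0 < s.im) (N : ℕ) :
    riemannZeta s = ∑ n ∈ Finset.range N, ((n + 1 : ℕ) : ℂ) ^ (-s) +
      ((N + 1 : ℕ) : ℂ) ^ (1 - s) / (s - 1) + ∑' n : ℕ, zetaRem (n + N + 1) s := by
  rw [riemannZeta_eq_tsum_zetaRem hs hi,
    ← (summable_zetaRem (ne_one_of_im_pos hi) hs).sum_add_tsum_nat_add N, sum_range_zetaRem]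
  ring

/-! ### Second moment of zeta -/

lemma ofReal_cpow_neg_add_mul_I {x : ℝ} (hx : 0 < x) (σ u : ℝ) :
    (x : ℂ) ^ (-(σ + u * I : ℂ)) = ((x ^ (-σ) : ℝ) : ℂ) * cexp (-(I * Real.log x * u)) := by
  have hx' : (x : ℂ) ≠ 0 := by exact_mod_cast hx.ne'
  rw [neg_add, cpow_add _ _ hx', ofReal_cpow hx.le, cpow_def_of_ne_zero hx' (-(u * I)),
    ← ofReal_log hx.le]
  push_cast
  congr 2
  ring

lemma exists_norm_riemannZeta_le :
    ∃ C : ℝ, 1 ≤ C ∧ ∀ s : ℂ, 1 / 4 ≤ s.re → 1 ≤ s.im → ‖riemannZeta s‖ ≤ C * ‖s‖ := by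
  have hS := summable_nat_rpow_neg_sub_one (a := 1 / 4) (by norm_num)
  set K : ℝ := ∑' n : ℕ, ((n + 1 : ℕ) : ℝ) ^ (-(1 / 4 : ℝ) - 1) with hK
  have hK0 : 0 ≤ K := tsum_nonneg fun n => by positivity
  refine ⟨1 + K, by linarith, fun s hs hi => ?_⟩
  have hs1 : s ≠ 1 := ne_one_of_im_pos (by linarith)
  have hsn : 1 ≤ ‖s‖ := hi.trans ((le_abs_self _).trans (abs_im_le_norm s))
  have hsn1 : 1 ≤ ‖s - 1‖ := by
    have := (le_abs_self _).trans (abs_im_le_norm (s - 1))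
    simp at this; linarith
  rw [riemannZeta_eq_tsum_zetaRem (by linarith) (by linarith)]
  have h1 : ‖∑' n : ℕ, zetaRem (n + 1) s‖ ≤ ‖s‖ * K := by
    rw [hK, ← tsum_mul_left]
    refine tsum_of_norm_bounded (hS.mul_left ‖s‖).hasSum fun n => ?_
    refine (norm_zetaRem_le (by omega) hs1 (by linarith)).trans ?_
    gcongr
    exact_mod_cast (by omega : 1 ≤ n + 1)
  have h2 : ‖1 / (s - 1)‖ ≤ 1 := by
    rw [norm_div, norm_one]; exact div_le_one_of_le₀ hsn1 (norm_nonneg _)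
  calc _ ≤ ‖1 / (s - 1)‖ + ‖∑' n : ℕ, zetaRem (n + 1) s‖ := norm_add_le _ _
    _ ≤ ‖s‖ + ‖s‖ * K := by linarith
    _ = _ := by ring

lemma norm_sq_integral_le {f : ℝ → ℂ} (hf : ContinuousOn f (Icc 0 1)) :
    ‖∫ z in (0:ℝ)..1, f z‖ ^ 2 ≤ ∫ z in (0:ℝ)..1, ‖f z‖ ^ 2 := by
  have hf' : ContinuousOn f (uIcc 0 1) := by rwa [uIcc_of_le zero_le_one]
  have h1 : ‖∫ z in (0:ℝ)..1, f z‖ ≤ ∫ z in (0:ℝ)..1, ‖f z‖ :=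
    intervalIntegral.norm_integral_le_integral_norm zero_le_one
  set c := ∫ z in (0:ℝ)..1, ‖f z‖ with hc
  have h2 : ∫ z in (0:ℝ)..1, (2 * c * ‖f z‖ - c ^ 2) ≤ ∫ z in (0:ℝ)..1, ‖f z‖ ^ 2 := by
    refine intervalIntegral.integral_mono_on zero_le_one ?_ ?_ fun z _ => ?_
    · exact (hf'.norm.const_mul _ |>.sub continuousOn_const).intervalIntegrable
    · exact (hf'.norm.pow 2).intervalIntegrable
    · nlinarith [sq_nonneg (‖f z‖ - c)]
  rw [intervalIntegral.integral_sub (hf'.norm.const_mul _).intervalIntegrable (by simp),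
    intervalIntegral.integral_const_mul, ← hc] at h2
  simp only [intervalIntegral.integral_const, sub_zero, smul_eq_mul, one_mul] at h2
  have : ‖∫ z in (0:ℝ)..1, f z‖ ^ 2 ≤ c ^ 2 := by gcongr
  nlinarith

lemma sum_range_inv_sq_le (N M : ℕ) :
    ∑ n ∈ Finset.range M, 1 / ((n + N + 1 + 1 : ℕ) : ℝ) ^ 2 ≤ 1 / ((N : ℝ) + 1) := by
  suffices h : ∑ n ∈ Finset.range M, 1 / ((n + N + 1 + 1 : ℕ) : ℝ) ^ 2 ≤
      1 / ((N : ℝ) + 1) - 1 / (N + 1 + M) by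
    have : (0:ℝ) ≤ 1 / (N + 1 + M) := by positivity
    linarith
  induction M with
  | zero => simp
  | succ M ih =>
    rw [Finset.sum_range_succ]
    have : 1 / ((M + N + 1 + 1 : ℕ) : ℝ) ^ 2 ≤ 1 / ((N:ℝ) + 1 + M) - 1 / (N + 1 + (M + 1 : ℕ)) := by
      push_cast
      rw [div_sub_div _ _ (by positivity) (by positivity),
        div_le_div_iff₀ (by positivity) (by positivity)]
      have : (0:ℝ) ≤ M := by positivity
      have : (0:ℝ) ≤ N := by positivity
      nlinarith
    linarith

lemma continuousAt_sum_zetaRem (N M : ℕ) {t : ℝ} (ht : 0 < t) :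
    ContinuousAt (fun t : ℝ =>
      ∑ n ∈ Finset.range M, zetaRem (n + N + 1 + 1) (1 / 2 + t * I)) t := by
  have h : ∀ n : ℕ, ContinuousAt (fun t : ℝ => zetaRem (n + N + 1 + 1) (1 / 2 + t * I)) t := by
    intro n
    have h1 : Continuous (fun t : ℝ => (1 / 2 + t * I : ℂ)) := by fun_prop
    have h2 : ContinuousAt (zetaRem (n + N + 1 + 1)) (1 / 2 + t * I) :=
      (differentiableAt_zetaRem (by omega) (ne_one_of_im_pos (by simpa using ht))).continuousAt
    exact ContinuousAt.comp (f := fun t : ℝ => (1 / 2 + t * I : ℂ)) h2 h1.continuousAt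
  exact tendsto_finsetSum _ fun n _ => h n

/-- Mean square of a block of Euler–Maclaurin remainders on the critical line. -/
lemma integral_norm_sq_sum_zetaRem_le {T : ℝ} (hT : 20 ≤ T) {N : ℕ} (hN : T ≤ N) (M : ℕ) :
    ∫ t in (1:ℝ)..T, ‖∑ n ∈ Finset.range M, zetaRem (n + N + 1 + 1) (1 / 2 + t * I)‖ ^ 2 ≤
      3200 * T := by
  set G : ℝ → ℝ → ℂ := fun t z => ∑ n ∈ Finset.range M,
    (((n + N + 1 + 1 : ℕ) : ℂ) + z) ^ (-(1 / 2 + t * I) - 1 : ℂ) with hG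
  have hGc : ContinuousOn (fun p : ℝ × ℝ => G p.1 p.2) (univ ×ˢ Icc 0 1) := by
    simp only [hG]
    refine continuousOn_finsetSum _ fun n _ => ?_
    refine ContinuousOn.cpow (by fun_prop) (by fun_prop) fun p hp => ?_
    left
    have : (0:ℝ) ≤ p.2 := hp.2.1
    simp only [add_re, natCast_re, ofReal_re]
    positivity
  have hGcz : ∀ t, ContinuousOn (G t) (Icc 0 1) := fun t =>
    hGc.comp (f := fun z => (t, z)) (by fun_prop) fun z hz => ⟨mem_univ _, hz⟩
  have hGct : ∀ z ∈ Icc (0:ℝ) 1, Continuous fun t => G t z := fun z hz =>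
    continuousOn_univ.mp (hGc.comp (f := fun t => (t, z)) (by fun_prop) fun t _ => ⟨mem_univ _, hz⟩)
  have hpt : ∀ t ∈ Icc 1 T, ‖∑ n ∈ Finset.range M, zetaRem (n + N + 1 + 1) (1 / 2 + t * I)‖ ^ 2 ≤
      4 * T ^ 2 * ∫ z in (0:ℝ)..1, ‖G t z‖ ^ 2 := by
    intro t ht
    have hs1 : (1 / 2 + t * I : ℂ) ≠ 1 := ne_one_of_im_pos (by simp; linarith [ht.1])
    have e : ∑ n ∈ Finset.range M, zetaRem (n + N + 1 + 1) (1 / 2 + t * I) =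
        (1 / 2 + t * I) * ∫ z in (0:ℝ)..1, (1 - z : ℂ) * G t z := by
      simp only [hG, Finset.mul_sum]
      rw [intervalIntegral.integral_finsetSum, Finset.mul_sum]
      · exact Finset.sum_congr rfl fun n _ => zetaRem_eq_integral (by omega) hs1
      · intro n _
        exact ((by fun_prop : Continuous fun z : ℝ => (1 - z : ℂ)).continuousOn.mul
          (continuousOn_nat_add_cpow (by omega) _)).intervalIntegrable
    rw [e, norm_mul, mul_pow]
    have hn : ‖(1 / 2 + t * I : ℂ)‖ ≤ 2 * T := by
      refine (norm_add_le _ _).trans ?_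
      rw [norm_mul, norm_I, norm_real, Real.norm_eq_abs, abs_of_nonneg (by linarith [ht.1])]
      norm_num
      linarith [ht.2]
    have h2 := norm_sq_integral_le (f := fun z => (1 - z : ℂ) * G t z)
      ((by fun_prop : Continuous fun z : ℝ => (1 - z : ℂ)).continuousOn.mul (hGcz t))
    have h3 : ∫ z in (0:ℝ)..1, ‖(1 - z : ℂ) * G t z‖ ^ 2 ≤ ∫ z in (0:ℝ)..1, ‖G t z‖ ^ 2 := by
      have hc := hGcz t
      rw [← uIcc_of_le zero_le_one] at hc
      refine intervalIntegral.integral_mono_on zero_le_one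
        (ContinuousOn.intervalIntegrable ((((by fun_prop : Continuous
          fun z : ℝ => (1 - z : ℂ)).continuousOn.mul hc).norm.pow 2)))
        (ContinuousOn.intervalIntegrable (hc.norm.pow 2)) fun z hz => ?_
      have h1 : ‖(1 - z : ℂ)‖ ≤ 1 := by
        rw [← ofReal_one, ← ofReal_sub, norm_real, Real.norm_eq_abs, abs_le]
        constructor <;> linarith [hz.1, hz.2]
      rw [norm_mul]
      gcongr
      exact mul_le_of_le_one_left (norm_nonneg _) h1
    calc _ ≤ (2 * T) ^ 2 * ∫ z in (0:ℝ)..1, ‖G t z‖ ^ 2 := by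
          gcongr
          exact h2.trans h3
      _ = _ := by ring
  have hmv : ∀ z ∈ Icc (0:ℝ) 1, ∫ t in (1:ℝ)..T, ‖G t z‖ ^ 2 ≤ 800 / T := by
    intro z hz
    set s : Finset ℕ := Finset.Ico (N + 2) (N + 2 + M) with hs
    have hsum : ∀ {R : Type} [AddCommMonoid R] (f : ℕ → R),
        ∑ n ∈ s, f n = ∑ n ∈ Finset.range M, f (n + N + 1 + 1) := fun f => by
      rw [hs, Finset.sum_Ico_eq_sum_range, Nat.add_sub_cancel_left]
      exact Finset.sum_congr rfl fun n _ => by congr 1; omega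
    have hL := integral_norm_sq_finset_sum_le hT hz.1 hz.2 s
      (fun m hm => by rw [hs, Finset.mem_Ico] at hm; omega) (fun n => (((n + z) ^ (-(3 / 2) : ℝ) : ℝ) : ℂ))
    have e : ∀ t : ℝ, G t z = ∑ n ∈ s, (((n + z) ^ (-(3 / 2) : ℝ) : ℝ) : ℂ) *
        cexp (-(I * Real.log (n + z) * t)) := by
      intro t
      rw [hsum]
      simp only [hG]
      refine Finset.sum_congr rfl fun n _ => ?_
      have := ofReal_cpow_neg_add_mul_I (nat_add_pos (n := n + N + 1 + 1) (by omega) hz.1) (3 / 2) t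
      rw [← this]
      push_cast
      congr 1
      ring
    simp_rw [← e] at hL
    refine le_trans ?_ (hL.trans ?_)
    · exact intervalIntegral.integral_mono_interval (by linarith) (by linarith) le_rfl
        (Eventually.of_forall fun t => by simp only [Pi.zero_apply]; positivity)
        (((hGct z hz).norm.pow 2).intervalIntegrable _ _)
    · have h1 : ∑ n ∈ s, (T + n) * ‖(((n + z) ^ (-(3 / 2) : ℝ) : ℝ) : ℂ)‖ ^ 2 ≤
          2 * (1 / (N + 1)) := by
        refine le_trans ?_ (mul_le_mul_of_nonneg_left (sum_range_inv_sq_le N M) (by norm_num))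
        rw [hsum, Finset.mul_sum]
        refine Finset.sum_le_sum fun n _ => ?_
        set m := n + N + 1 + 1 with hm
        have hm1 : (1:ℝ) ≤ m := by exact_mod_cast (by omega : 1 ≤ m)
        have hmT : T ≤ m := hN.trans (by exact_mod_cast (by omega : N ≤ m))
        rw [norm_real, Real.norm_eq_abs, sq_abs, ← Real.rpow_natCast, ← Real.rpow_mul
          (by linarith [hz.1])]
        have h3 : ((m:ℝ) + z) ^ (-(3 / 2) * (2:ℕ) : ℝ) ≤ (m:ℝ) ^ (-3 : ℝ) := by
          rw [show (-(3 / 2) * (2:ℕ) : ℝ) = -3 by norm_num]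
          exact Real.rpow_le_rpow_of_nonpos (by linarith) (by linarith [hz.1]) (by norm_num)
        have h4 : (m:ℝ) ^ (-3 : ℝ) = 1 / (m:ℝ) ^ 3 := by
          rw [Real.rpow_neg (by linarith), one_div]; norm_cast
        calc _ ≤ (2 * (m:ℝ)) * (1 / (m:ℝ) ^ 3) := by
              rw [← h4]
              exact mul_le_mul (by linarith) h3 (Real.rpow_nonneg (by linarith [hz.1]) _)
                (by linarith)
          _ = 2 * (1 / (m:ℝ) ^ 2) := by field_simp
      have h2 : 1 / ((N:ℝ) + 1) ≤ 1 / T := one_div_le_one_div_of_le (by linarith) (by linarith)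
      have h3 : 800 / T = 800 * (1 / T) := by ring
      linarith
  have hprod : Integrable (Function.uncurry fun t z => ‖G t z‖ ^ 2)
      ((volume.restrict (Ioc 1 T)).prod (volume.restrict (Ioc 0 1))) := by
    rw [Measure.prod_restrict]
    exact ((hGc.mono (prod_mono (subset_univ (Icc 1 T)) subset_rfl)).norm.pow
      2).integrableOn_compact (isCompact_Icc.prod isCompact_Icc) |>.mono_set
      (Set.prod_mono Ioc_subset_Icc_self Ioc_subset_Icc_self)
  have hswap : ∫ t in (1:ℝ)..T, ∫ z in (0:ℝ)..1, ‖G t z‖ ^ 2 =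
      ∫ z in (0:ℝ)..1, ∫ t in (1:ℝ)..T, ‖G t z‖ ^ 2 := by
    simp_rw [intervalIntegral.integral_of_le zero_le_one,
      intervalIntegral.integral_of_le (by linarith : 1 ≤ T)]
    exact integral_integral_swap hprod
  have hcont1 : IntervalIntegrable (fun t => ∫ z in (0:ℝ)..1, ‖G t z‖ ^ 2) volume 1 T := by
    simp_rw [intervalIntegral.integral_of_le zero_le_one]
    rw [intervalIntegrable_iff_integrableOn_Ioc_of_le (by linarith)]
    exact hprod.integral_prod_left
  have hcont2 : IntervalIntegrable (fun z => ∫ t in (1:ℝ)..T, ‖G t z‖ ^ 2) volume 0 1 := by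
    simp_rw [intervalIntegral.integral_of_le (by linarith : 1 ≤ T)]
    rw [intervalIntegrable_iff_integrableOn_Ioc_of_le zero_le_one]
    exact hprod.integral_prod_right
  have hT0 : 0 < T := by linarith
  calc _ ≤ ∫ t in (1:ℝ)..T, 4 * T ^ 2 * ∫ z in (0:ℝ)..1, ‖G t z‖ ^ 2 := by
        refine intervalIntegral.integral_mono_on_of_le_Ioo (by linarith) ?_ (hcont1.const_mul _)
          fun t ht => hpt t ⟨ht.1.le, ht.2.le⟩
        refine ContinuousOn.intervalIntegrable fun t ht => ?_
        rw [uIcc_of_le (by linarith)] at ht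
        refine ContinuousAt.continuousWithinAt ?_
        exact (continuousAt_sum_zetaRem N M (by linarith [ht.1])).norm.pow 2
    _ = 4 * T ^ 2 * ∫ z in (0:ℝ)..1, ∫ t in (1:ℝ)..T, ‖G t z‖ ^ 2 := by
        rw [intervalIntegral.integral_const_mul, hswap]
    _ ≤ 4 * T ^ 2 * ∫ _z in (0:ℝ)..1, 800 / T := by
        gcongr
        exact intervalIntegral.integral_mono_on zero_le_one hcont2 (by simp) hmv
    _ = 3200 * T := by
        simp only [intervalIntegral.integral_const, sub_zero, smul_eq_mul, one_mul]
        field_simp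
        norm_num

lemma sum_Icc_one_div_le (N : ℕ) : ∑ n ∈ Finset.Icc 1 N, 1 / (n : ℝ) ≤ 1 + Real.log N := by
  have h := harmonic_le_one_add_log N
  rw [harmonic_eq_sum_Icc] at h
  push_cast at h
  simpa using h

lemma integral_one_div_sq_le {T : ℝ} (hT : 1 ≤ T) : ∫ t in (1:ℝ)..T, 1 / t ^ 2 ≤ 1 := by
  have hd : ∀ t ∈ uIcc 1 T, HasDerivAt (fun t : ℝ => -t⁻¹) (1 / t ^ 2) t := by
    intro t ht
    rw [uIcc_of_le hT] at ht
    exact ((hasDerivAt_inv (by linarith [ht.1] : t ≠ 0)).neg).congr_deriv (by simp)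
  rw [intervalIntegral.integral_eq_sub_of_hasDerivAt hd]
  · have : 0 ≤ T⁻¹ := by positivity
    simp; linarith
  · refine ContinuousOn.intervalIntegrable (ContinuousOn.div continuousOn_const (by fun_prop) ?_)
    intro t ht
    rw [uIcc_of_le hT] at ht
    have := ht.1
    positivity

lemma continuousAt_zeta_vertical (σ : ℝ) {t : ℝ} (ht : 0 < t) :
    ContinuousAt (fun t : ℝ => riemannZeta (σ + t * I)) t := by
  have h1 : ContinuousAt (fun t : ℝ => (σ + t * I : ℂ)) t := by fun_prop
  exact ContinuousAt.comp (f := fun t : ℝ => (σ + t * I : ℂ))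
    (differentiableAt_riemannZeta (ne_one_of_im_pos (by simpa using ht))).continuousAt h1

set_option maxHeartbeats 1000000 in
lemma exists_integral_norm_sq_zeta_le :
    ∃ C : ℝ, 0 < C ∧ ∀ T : ℝ, 20 ≤ T →
      ∫ t in (1:ℝ)..T, ‖riemannZeta (1 / 2 + t * I)‖ ^ 2 ≤ C * T * Real.log T := by
  refine ⟨20000, by norm_num, fun T hT => ?_⟩
  have hT0 : 0 < T := by linarith
  set N := ⌈T⌉₊ with hN
  have hNT : T ≤ N := Nat.le_ceil T
  have hNT' : (N:ℝ) < T + 1 := Nat.ceil_lt_add_one hT0.le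
  obtain ⟨M, hM⟩ : ∃ M : ℕ, 2 * T * ∑' n : ℕ, ((n + M + 1 : ℕ) : ℝ) ^ (-(1 / 2 : ℝ) - 1) ≤ 1 := by
    have h := (tendsto_sum_nat_add
      (fun n : ℕ => ((n + 1 : ℕ) : ℝ) ^ (-(1 / 2 : ℝ) - 1))).const_mul (2 * T)
    rw [mul_zero] at h
    obtain ⟨M, hM⟩ := (h.eventually (ge_mem_nhds (zero_lt_one))).exists
    exact ⟨M, hM⟩
  set A : ℝ → ℂ := fun t => ∑ n ∈ Finset.Icc 1 (N + 1), (((n:ℝ) ^ (-(1 / 2) : ℝ) : ℝ) : ℂ) *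
    cexp (-(I * Real.log n * t)) with hA
  set D : ℝ → ℂ := fun t => ∑ n ∈ Finset.range M, zetaRem (n + N + 1 + 1) (1 / 2 + t * I) with hD
  have hpt : ∀ t ∈ Icc 1 T, ‖riemannZeta (1 / 2 + t * I)‖ ^ 2 ≤
      4 * (‖A t‖ ^ 2 + (N + 2) * (1 / t ^ 2) + ‖D t‖ ^ 2 + 1) := by
    intro t ht
    have ht0 : 0 < t := by linarith [ht.1]
    set s : ℂ := 1 / 2 + t * I with hs
    have hre : s.re = 1 / 2 := by simp [hs]
    have him : s.im = t := by simp [hs]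
    have hs1 : s ≠ 1 := ne_one_of_im_pos (by rw [him]; exact ht0)
    have h := riemannZeta_eq_sum_add (s := s) (by rw [hre]; norm_num) (by rw [him]; exact ht0) (N + 1)
    have hsm : Summable fun n : ℕ => zetaRem (n + (N + 1) + 1) s :=
      (summable_nat_add_iff (f := fun n : ℕ => zetaRem (n + 1) s) (N + 1)).mpr
        (summable_zetaRem hs1 (by rw [hre]; norm_num))
    rw [← hsm.sum_add_tsum_nat_add M] at h
    have e1 : ∑ n ∈ Finset.range (N + 1), ((n + 1 : ℕ) : ℂ) ^ (-s) = A t := by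
      simp only [hA]
      rw [Finset.range_eq_Ico, Finset.sum_Ico_add' (fun n : ℕ => (n : ℂ) ^ (-s)) 0 (N + 1) 1]
      rw [zero_add]
      refine Finset.sum_congr (by ext; simp) fun n hn => ?_
      have hn1 : (0:ℝ) < n := by exact_mod_cast (Finset.mem_Icc.mp hn).1
      rw [← ofReal_cpow_neg_add_mul_I hn1, hs]
      norm_num
    have e2 : ‖((N + 1 + 1 : ℕ) : ℂ) ^ (1 - s) / (s - 1)‖ ^ 2 ≤ (N + 2) * (1 / t ^ 2) := by
      rw [norm_div, norm_natCast_cpow_of_pos (by omega), div_pow, mul_one_div]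
      have h1 : (((N + 1 + 1 : ℕ) : ℝ) ^ (1 - s).re) ^ 2 = N + 2 := by
        rw [sub_re, one_re, hre, ← Real.rpow_natCast, ← Real.rpow_mul (by positivity)]
        norm_num
        ring
      have h2 : t ≤ ‖s - 1‖ := by
        have := (le_abs_self _).trans (abs_im_le_norm (s - 1))
        simpa [him] using this
      rw [h1]
      gcongr
    have e3 : ‖∑' n : ℕ, zetaRem (n + M + (N + 1) + 1) s‖ ≤ 1 := by
      refine le_trans ?_ hM
      rw [← tsum_mul_left]
      refine tsum_of_norm_bounded (Summable.hasSum (Summable.mul_left _ ?_)) fun n => ?_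
      · exact (summable_nat_add_iff M).mpr (summable_nat_rpow_neg_sub_one (a := 1 / 2) (by norm_num))
      · refine (norm_zetaRem_le (by omega) hs1 (by rw [hre]; norm_num)).trans ?_
        rw [hre]
        have hn : ‖s‖ ≤ 2 * T := by
          refine (norm_add_le _ _).trans ?_
          rw [norm_mul, norm_I, norm_real, Real.norm_eq_abs, abs_of_nonneg ht0.le]
          norm_num
          linarith [ht.2]
        have : ((n + M + (N + 1) + 1 : ℕ) : ℝ) ^ (-(1 / 2 : ℝ) - 1) ≤
            ((n + M + 1 : ℕ) : ℝ) ^ (-(1 / 2 : ℝ) - 1) :=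
          Real.rpow_le_rpow_of_nonpos (by positivity) (by exact_mod_cast (by omega)) (by norm_num)
        gcongr
    rw [e1] at h
    have e4 : ∑ n ∈ Finset.range M, zetaRem (n + (N + 1) + 1) s = D t := rfl
    rw [e4] at h
    rw [h]
    set b := ((N + 1 + 1 : ℕ) : ℂ) ^ (1 - s) / (s - 1)
    set e := ∑' n : ℕ, zetaRem (n + M + (N + 1) + 1) s
    have hn : ‖A t + b + (D t + e)‖ ≤ ‖A t‖ + ‖b‖ + (‖D t‖ + 1) := by
      refine (norm_add_le _ _).trans (add_le_add (norm_add_le _ _) ?_)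
      exact (norm_add_le _ _).trans (by linarith)
    calc _ ≤ (‖A t‖ + ‖b‖ + (‖D t‖ + 1)) ^ 2 := by gcongr
      _ ≤ 4 * (‖A t‖ ^ 2 + ‖b‖ ^ 2 + ‖D t‖ ^ 2 + 1) := by
          nlinarith [sq_nonneg (‖A t‖ - ‖b‖), sq_nonneg (‖A t‖ - ‖D t‖), sq_nonneg (‖A t‖ - 1),
            sq_nonneg (‖b‖ - ‖D t‖), sq_nonneg (‖b‖ - 1), sq_nonneg (‖D t‖ - 1)]
      _ ≤ _ := by linarith
  have hAc : Continuous A := by simp only [hA]; fun_prop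
  have hAi : IntervalIntegrable (fun t => ‖A t‖ ^ 2) volume 1 T :=
    (by fun_prop : Continuous fun t => ‖A t‖ ^ 2).intervalIntegrable _ _
  have hBi : IntervalIntegrable (fun t : ℝ => ((N:ℝ) + 2) * (1 / t ^ 2)) volume 1 T := by
    refine ContinuousOn.intervalIntegrable (ContinuousOn.const_mul (ContinuousOn.div
      continuousOn_const (by fun_prop) fun t ht => ?_) _)
    rw [uIcc_of_le (by linarith)] at ht
    have := ht.1
    positivity
  have hDi : IntervalIntegrable (fun t => ‖D t‖ ^ 2) volume 1 T := by
    refine ContinuousOn.intervalIntegrable fun t ht => ?_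
    rw [uIcc_of_le (by linarith)] at ht
    have h : ContinuousAt D t := continuousAt_sum_zetaRem N M (by linarith [ht.1])
    exact (h.norm.pow 2).continuousWithinAt
  have hZi : IntervalIntegrable (fun t : ℝ => ‖riemannZeta (1 / 2 + t * I)‖ ^ 2) volume 1 T := by
    refine ContinuousOn.intervalIntegrable fun t ht => ?_
    rw [uIcc_of_le (by linarith)] at ht
    have := continuousAt_zeta_vertical (1 / 2) (t := t) (by linarith [ht.1])
    push_cast at this
    exact (this.norm.pow 2).continuousWithinAt
  have hA2 : ∫ t in (1:ℝ)..T, ‖A t‖ ^ 2 ≤ 400 * (T * (1 + Real.log (N + 1)) + (N + 1)) := by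
    have hL := integral_norm_sq_finset_sum_le hT le_rfl zero_le_one (Finset.Icc 1 (N + 1))
      (fun m hm => (Finset.mem_Icc.mp hm).1) (fun n => (((n:ℝ) ^ (-(1 / 2) : ℝ) : ℝ) : ℂ))
    simp only [add_zero] at hL
    refine le_trans (intervalIntegral.integral_mono_interval (by linarith) (by linarith) le_rfl
        (Eventually.of_forall fun t => by simp only [Pi.zero_apply]; positivity)
        ((hAc.norm.pow 2).intervalIntegrable _ _)) (hL.trans ?_)
    gcongr
    calc _ = ∑ n ∈ Finset.Icc 1 (N + 1), (T * (1 / (n:ℝ)) + 1) := by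
          refine Finset.sum_congr rfl fun n hn => ?_
          have hn1 : (0:ℝ) < n := by exact_mod_cast (Finset.mem_Icc.mp hn).1
          rw [norm_real, Real.norm_eq_abs, sq_abs, ← Real.rpow_natCast, ← Real.rpow_mul hn1.le]
          rw [show (-(1 / 2) * (2:ℕ) : ℝ) = -1 by norm_num, Real.rpow_neg_one]
          field_simp
      _ = T * ∑ n ∈ Finset.Icc 1 (N + 1), 1 / (n:ℝ) + (N + 1) := by
          rw [Finset.sum_add_distrib, Finset.mul_sum]
          simp
      _ ≤ _ := by
          have := sum_Icc_one_div_le (N + 1)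
          push_cast at this
          gcongr
  have hB2 : ∫ t in (1:ℝ)..T, ((N:ℝ) + 2) * (1 / t ^ 2) ≤ (N:ℝ) + 2 := by
    rw [intervalIntegral.integral_const_mul]
    have := integral_one_div_sq_le (T := T) (by linarith)
    calc _ ≤ ((N:ℝ) + 2) * 1 := by gcongr
      _ = _ := mul_one _
  have hD2 := integral_norm_sq_sum_zetaRem_le hT hNT M
  have key := intervalIntegral.integral_mono_on (by linarith) hZi
    ((((hAi.add hBi).add hDi).add (intervalIntegrable_const (c := (1:ℝ)))).const_mul 4) hpt
  rw [intervalIntegral.integral_const_mul] at key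
  rw [intervalIntegral.integral_add (f := fun t => ‖A t‖ ^ 2 + ((N:ℝ) + 2) * (1 / t ^ 2) + ‖D t‖ ^ 2)
      ((hAi.add hBi).add hDi) (by simp),
    intervalIntegral.integral_add (f := fun t => ‖A t‖ ^ 2 + ((N:ℝ) + 2) * (1 / t ^ 2))
      (hAi.add hBi) hDi, intervalIntegral.integral_add hAi hBi] at key
  simp only [intervalIntegral.integral_const, smul_eq_mul, mul_one] at key
  have hl1 : 1 ≤ Real.log T := by
    rw [Real.le_log_iff_exp_le hT0]
    linarith [Real.exp_one_lt_d9]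
  have hl2 : Real.log (N + 1) ≤ 2 * Real.log T := by
    rw [show 2 * Real.log T = Real.log (T ^ 2) by rw [Real.log_pow]; norm_num]
    apply Real.log_le_log (by positivity)
    nlinarith
  have hT1 : T ≤ T * Real.log T := by nlinarith
  have hT2 : T * Real.log (N + 1) ≤ 2 * (T * Real.log T) := by nlinarith
  linarith

/-! ### A local three lines theorem -/

/-- Three lines theorem on a box: a Gaussian factor makes the horizontal sides negligible. -/
lemma norm_le_exp_of_box {f : ℂ → ℂ} {a b t H α β γ σ : ℝ} (hab : a < b) (hba : b - a ≤ 3)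
    (hH : 0 < H)
    (hf : ∀ z : ℂ, z.re ∈ Icc a b → |z.im - t| ≤ H → DifferentiableAt ℂ f z)
    (hl : ∀ u : ℝ, |u - t| ≤ H → ‖f (a + u * I)‖ ≤ Real.exp α)
    (hr : ∀ u : ℝ, |u - t| ≤ H → ‖f (b + u * I)‖ ≤ Real.exp β)
    (hG : ∀ z : ℂ, z.re ∈ Icc a b → |z.im - t| ≤ H → ‖f z‖ ≤ Real.exp γ)
    (hγα : γ - H ^ 2 ≤ α) (hγβ : γ - H ^ 2 ≤ β) (hσ : σ ∈ Icc a b) :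
    ‖f (σ + t * I)‖ ≤ Real.exp (9 + ((b - σ) * α + (σ - a) * β) / (b - a)) := by
  have hba0 : 0 < b - a := by linarith
  set z₀ : ℂ := σ + t * I with hz₀
  set F : ℂ → ℂ := fun z => f z * cexp ((z - z₀) ^ 2) *
    cexp (-(((b - z) * α + (z - a) * β) / (b - a))) with hF
  have hFn : ∀ z : ℂ, ‖F z‖ = ‖f z‖ * Real.exp ((z.re - σ) ^ 2 - (z.im - t) ^ 2) *
      Real.exp (-(((b - z.re) * α + (z.re - a) * β) / (b - a))) := by
    intro z
    simp only [hF]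
    rw [norm_mul, norm_mul, Complex.norm_exp, Complex.norm_exp]
    congr 3
    · rw [hz₀]; simp [pow_two]
    · have : (((b - z) * α + (z - a) * β) / (b - a) : ℂ) =
        ((b - z) * α + (z - a) * β) * (((b - a)⁻¹ : ℝ) : ℂ) := by push_cast; rw [div_eq_mul_inv]
      rw [this, neg_re, re_mul_ofReal]
      simp [div_eq_mul_inv]
  set U : Set ℂ := Ioo a b ×ℂ Ioo (t - H) (t + H) with hU
  have hcl : closure U = Icc a b ×ℂ Icc (t - H) (t + H) := by
    rw [hU, Complex.closure_reProdIm, closure_Ioo hab.ne, closure_Ioo (by linarith)]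
  have habs : ∀ x : ℝ, x ∈ Icc (t - H) (t + H) → |x - t| ≤ H := fun x hx => by
    rw [abs_le]; constructor <;> linarith [hx.1, hx.2]
  have hdF : DiffContOnCl ℂ F U := by
    refine DifferentiableOn.diffContOnCl fun z hz => ?_
    rw [hcl] at hz
    have h1 := hf z hz.1 (habs _ hz.2)
    refine DifferentiableAt.differentiableWithinAt ?_
    simp only [hF]
    fun_prop
  have hfr : ∀ z ∈ frontier U, ‖F z‖ ≤ Real.exp 9 := by
    intro z hz
    have hz1 : z ∈ closure U := frontier_subset_closure hz
    have hz2 : z ∉ U := fun h => by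
      have hUo : IsOpen U := isOpen_Ioo.reProdIm isOpen_Ioo
      rw [hUo.frontier_eq] at hz
      exact hz.2 h
    rw [hcl] at hz1
    obtain ⟨hre, him⟩ := hz1
    simp only [mem_preimage] at hre him
    have hsq : (z.re - σ) ^ 2 ≤ 9 := by
      have h1 : z.re - σ ≤ 3 := by linarith [hre.2, hσ.1]
      have h2 : -3 ≤ z.re - σ := by linarith [hre.1, hσ.2]
      nlinarith
    rw [hFn]
    by_cases ha : z.re = a
    · have h := hl z.im (habs _ him)
      rw [show (a + z.im * I : ℂ) = z by rw [← ha]; exact re_add_im z] at h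
      have e : ((b - z.re) * α + (z.re - a) * β) / (b - a) = α := by
        rw [ha]; field_simp; ring
      rw [e]
      calc _ ≤ Real.exp α * Real.exp 9 * Real.exp (-α) := by
            gcongr
            nlinarith [sq_nonneg (z.im - t)]
        _ = _ := by rw [← Real.exp_add, ← Real.exp_add]; ring_nf
    by_cases hb : z.re = b
    · have h := hr z.im (habs _ him)
      rw [show (b + z.im * I : ℂ) = z by rw [← hb]; exact re_add_im z] at h
      have e : ((b - z.re) * α + (z.re - a) * β) / (b - a) = β := by
        rw [hb]; field_simp; ring
      rw [e]
      calc _ ≤ Real.exp β * Real.exp 9 * Real.exp (-β) := by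
            gcongr
            nlinarith [sq_nonneg (z.im - t)]
        _ = _ := by rw [← Real.exp_add, ← Real.exp_add]; ring_nf
    have h := hG z hre (habs _ him)
    have hH2 : (z.im - t) ^ 2 = H ^ 2 := by
      by_contra hne
      apply hz2
      refine ⟨⟨lt_of_le_of_ne hre.1 (Ne.symm ha), lt_of_le_of_ne hre.2 hb⟩, ⟨?_, ?_⟩⟩
      · refine lt_of_le_of_ne him.1 fun h => hne ?_
        rw [← h]; ring
      · refine lt_of_le_of_ne him.2 fun h => hne ?_
        rw [h]; ring
    have hm : γ - H ^ 2 ≤ ((b - z.re) * α + (z.re - a) * β) / (b - a) := by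
      rw [le_div_iff₀ hba0]
      nlinarith [hre.1, hre.2]
    calc _ ≤ Real.exp γ * Real.exp (9 - H ^ 2) * Real.exp (-(γ - H ^ 2)) := by
          rw [hH2]
          gcongr
      _ = _ := by rw [← Real.exp_add, ← Real.exp_add]; ring_nf
  have hbd : Bornology.IsBounded U :=
    (Metric.isBounded_Ioo a b).reProdIm (Metric.isBounded_Ioo _ _)
  have hmem : z₀ ∈ closure U := by
    rw [hcl]
    exact ⟨by simpa [hz₀] using hσ, by simp only [mem_preimage, hz₀]; simp; linarith⟩
  have := Complex.norm_le_of_forall_mem_frontier_norm_le hbd hdF hfr hmem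
  rw [hFn] at this
  have e1 : z₀.re = σ := by simp [hz₀]
  have e2 : z₀.im = t := by simp [hz₀]
  rw [e1, e2, sub_self, sub_self] at this
  simp only [ne_eq, OfNat.ofNat_ne_zero, not_false_eq_true, zero_pow, sub_self, Real.exp_zero,
    mul_one] at this
  rw [Real.exp_neg, ← div_eq_mul_inv, div_le_iff₀ (Real.exp_pos _)] at this
  rw [Real.exp_add]
  exact this

/-- The factor in the functional equation `ζ(s) = χ(s) ζ(1 - s)`. -/
def zetaChi (s : ℂ) : ℂ :=
  2 * (2 * π) ^ (s - 1) * Complex.Gamma (1 - s) * Complex.cos (π * (1 - s) / 2)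

lemma riemannZeta_eq_zetaChi_mul {s : ℂ} (hs : 0 < s.im) :
    riemannZeta s = zetaChi s * riemannZeta (1 - s) := by
  have h := riemannZeta_one_sub (s := 1 - s) (fun n h => by
    have := congrArg Complex.im h
    simp at this; linarith) (fun h => by
    have := congrArg Complex.im h
    simp at this; linarith)
  rw [sub_sub_cancel, neg_sub] at h
  exact h

lemma differentiableAt_zetaChi {s : ℂ} (hs : 0 < s.im) : DifferentiableAt ℂ zetaChi s := by
  unfold zetaChi
  have h1 : DifferentiableAt ℂ (fun s : ℂ => Complex.Gamma (1 - s)) s := by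
    refine DifferentiableAt.comp s (Complex.differentiableAt_Gamma _ fun m h => ?_) (by fun_prop)
    have := congrArg Complex.im h
    simp at this; linarith
  have h2 : DifferentiableAt ℂ (fun s : ℂ => ((2 * π : ℂ)) ^ (s - 1)) s := by
    refine DifferentiableAt.const_cpow (by fun_prop) (Or.inl ?_)
    exact mul_ne_zero two_ne_zero (by exact_mod_cast Real.pi_ne_zero)
  exact ((h2.const_mul 2).mul h1).mul (by fun_prop)

lemma norm_Gamma_le {z : ℂ} (hz : 0 < z.re) : ‖Complex.Gamma z‖ ≤ Real.Gamma z.re := by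
  rw [Complex.Gamma_eq_integral hz, Real.Gamma_eq_integral hz, Complex.GammaIntegral]
  refine (norm_integral_le_integral_norm _).trans (le_of_eq ?_)
  refine setIntegral_congr_fun measurableSet_Ioi fun x hx => ?_
  have hx' : (0:ℝ) < x := hx
  simp only [norm_mul, Complex.norm_cpow_eq_rpow_re_of_pos hx', Complex.sub_re, Complex.one_re]
  rw [Complex.norm_real, Real.norm_of_nonneg (Real.exp_pos _).le]

lemma norm_cos_le_exp (w : ℂ) : ‖Complex.cos w‖ ≤ Real.exp |w.im| := by
  rw [Complex.cos, norm_div, Complex.norm_ofNat, div_le_iff₀ two_pos]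
  refine (norm_add_le _ _).trans ?_
  rw [Complex.norm_exp, Complex.norm_exp]
  have h1 : (w * I).re ≤ |w.im| := by simpa using neg_le_abs w.im
  have h2 : (-w * I).re ≤ |w.im| := by simpa using le_abs_self w.im
  linarith [Real.exp_le_exp.2 h1, Real.exp_le_exp.2 h2]

lemma norm_zetaChi_le_mul_norm_Gamma {s : ℂ} (hs : s.re ≤ 3 / 2) (hi : 0 < s.im) :
    ‖zetaChi s‖ ≤ 14 * ‖Complex.Gamma (1 - s)‖ * Real.exp (π / 2 * s.im) := by
  have h1 : ‖((2 * π : ℂ)) ^ (s - 1)‖ ≤ 7 := by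
    have : ((2 * π : ℂ)) = ((2 * π : ℝ) : ℂ) := by push_cast; rfl
    rw [this, Complex.norm_cpow_eq_rpow_re_of_pos (by positivity)]
    have h7 : 2 * π ≤ 7 := by linarith [Real.pi_lt_d2]
    have h8 : 1 ≤ 2 * π := by linarith [Real.pi_gt_three]
    calc (2 * π) ^ (s - 1).re ≤ (2 * π) ^ (1:ℝ) :=
          Real.rpow_le_rpow_of_exponent_le h8 (by simp; linarith)
      _ ≤ 7 := by simpa using h7
  have h2 : ‖Complex.cos (π * (1 - s) / 2)‖ ≤ Real.exp (π / 2 * s.im) := by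
    refine (norm_cos_le_exp _).trans (Real.exp_le_exp.2 (le_of_eq ?_))
    have : (π * (1 - s) / 2 : ℂ) = ((π / 2 : ℝ) : ℂ) * (1 - s) := by push_cast; ring
    rw [this, Complex.im_ofReal_mul]
    simp only [Complex.sub_im, Complex.one_im, zero_sub, mul_neg, abs_neg]
    exact abs_of_nonneg (by positivity)
  unfold zetaChi
  rw [norm_mul, norm_mul, norm_mul, Complex.norm_ofNat]
  calc 2 * ‖((2 * π : ℂ)) ^ (s - 1)‖ * ‖Complex.Gamma (1 - s)‖ * ‖Complex.cos (π * (1 - s) / 2)‖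
      ≤ 2 * 7 * ‖Complex.Gamma (1 - s)‖ * Real.exp (π / 2 * s.im) := by gcongr
    _ = _ := by ring

lemma norm_Gamma_half_sub_le {t : ℝ} :
    ‖Complex.Gamma (1 / 2 - t * I)‖ ≤ 3 * Real.exp (-(π / 2 * t)) := by
  have h := Complex.Gamma_mul_Gamma_one_sub (1 / 2 - t * I)
  have e1 : (1 - (1 / 2 - t * I) : ℂ) = (starRingEnd ℂ) (1 / 2 - t * I) := by
    apply Complex.ext <;> simp
    norm_num
  have e2 : (π * (1 / 2 - t * I) : ℂ) = π / 2 - ((π * t : ℝ) : ℂ) * I := by push_cast; ring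
  rw [e1, Complex.Gamma_conj, Complex.mul_conj, e2, Complex.sin_pi_div_two_sub, Complex.cos_mul_I]
    at h
  rw [Complex.normSq_eq_norm_sq, ← Complex.ofReal_cosh, ← Complex.ofReal_div] at h
  have h' : ‖Complex.Gamma (1 / 2 - t * I)‖ ^ 2 = π / Real.cosh (π * t) := by exact_mod_cast h
  refine le_of_sq_le_sq ?_ (by positivity)
  rw [h', div_le_iff₀ (Real.cosh_pos _), mul_pow, ← Real.exp_nat_mul, Real.cosh_eq]
  have : Real.exp (((2:ℕ):ℝ) * -(π / 2 * t)) = Real.exp (-(π * t)) := by congr 1; push_cast; ring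
  rw [this]
  have h3 : Real.exp (-(π * t)) * Real.exp (π * t) = 1 := by rw [← Real.exp_add]; simp
  nlinarith [Real.exp_pos (-(π * t)), Real.pi_lt_d2]

lemma norm_zetaChi_right_le {t : ℝ} (ht : 0 < t) :
    ‖zetaChi (3 / 2 + t * I)‖ ≤ 42 / t := by
  have h := norm_zetaChi_le_mul_norm_Gamma (s := 3 / 2 + t * I) (by simp) (by simpa)
  have e1 : (1 - (3 / 2 + t * I) : ℂ) = -1 / 2 - t * I := by ring
  have hne : (-1 / 2 - t * I : ℂ) ≠ 0 := fun h => by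
    have := congrArg Complex.im h
    simp at this; linarith
  have h2 := Complex.Gamma_add_one _ hne
  have e2 : (-1 / 2 - t * I + 1 : ℂ) = 1 / 2 - t * I := by ring
  rw [e2] at h2
  have h3 := norm_Gamma_half_sub_le (t := t)
  have h4 : t ≤ ‖(-1 / 2 - t * I : ℂ)‖ := by
    have := Complex.abs_im_le_norm (-1 / 2 - t * I : ℂ)
    simp at this
    exact (le_abs_self t).trans this
  rw [h2, norm_mul] at h3
  rw [e1] at h
  have e3 : (3 / 2 + t * I : ℂ).im = t := by simp
  rw [e3] at h
  have h5 : Real.exp (-(π / 2 * t)) * Real.exp (π / 2 * t) = 1 := by rw [← Real.exp_add]; simp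
  rw [le_div_iff₀ ht]
  calc _ ≤ 14 * ‖Complex.Gamma (-1 / 2 - t * I)‖ * Real.exp (π / 2 * t) * t := by gcongr
    _ ≤ 14 * ‖Complex.Gamma (-1 / 2 - t * I)‖ * Real.exp (π / 2 * t) * ‖(-1 / 2 - t * I : ℂ)‖ := by
        gcongr
    _ = 14 * (‖(-1 / 2 - t * I : ℂ)‖ * ‖Complex.Gamma (-1 / 2 - t * I)‖) * Real.exp (π / 2 * t) := by
        ring
    _ ≤ 14 * (3 * Real.exp (-(π / 2 * t))) * Real.exp (π / 2 * t) := by gcongr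
    _ = 42 * (Real.exp (-(π / 2 * t)) * Real.exp (π / 2 * t)) := by ring
    _ = 42 := by rw [h5]; ring

lemma norm_zetaChi_left_le {t : ℝ} (ht : 1 ≤ t) :
    ‖zetaChi (-1 / 2 + t * I)‖ ≤ 84 * t := by
  have h := norm_zetaChi_le_mul_norm_Gamma (s := -1 / 2 + t * I) (by simp; norm_num)
    (by simp; linarith)
  have e1 : (1 - (-1 / 2 + t * I) : ℂ) = (1 / 2 - t * I) + 1 := by ring
  have hne : (1 / 2 - t * I : ℂ) ≠ 0 := fun h => by
    have := congrArg Complex.im h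
    simp at this; linarith
  rw [e1, Complex.Gamma_add_one _ hne, norm_mul] at h
  have h3 := norm_Gamma_half_sub_le (t := t)
  have h4 : ‖(1 / 2 - t * I : ℂ)‖ ≤ 2 * t := by
    refine (norm_sub_le _ _).trans ?_
    simp
    rw [abs_of_nonneg (by linarith)]
    linarith
  have e3 : (-1 / 2 + t * I : ℂ).im = t := by simp
  rw [e3] at h
  have h5 : Real.exp (-(π / 2 * t)) * Real.exp (π / 2 * t) = 1 := by rw [← Real.exp_add]; simp
  refine h.trans ?_
  calc _ ≤ 14 * (2 * t * (3 * Real.exp (-(π / 2 * t)))) * Real.exp (π / 2 * t) := by gcongr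
    _ = 84 * t * (Real.exp (-(π / 2 * t)) * Real.exp (π / 2 * t)) := by ring
    _ = 84 * t := by rw [h5]; ring

lemma exists_norm_zetaChi_le_exp :
    ∃ C : ℝ, 1 ≤ C ∧ ∀ s : ℂ, -1 / 2 ≤ s.re → s.re ≤ 3 / 2 → 1 ≤ s.im →
      ‖zetaChi s‖ ≤ C * Real.exp (2 * s.im) := by
  have hc : ContinuousOn Real.Gamma (Icc (3/2) (7/2)) := fun x hx =>
    (Real.differentiableAt_Gamma fun m h => by
      have := hx.1; rw [h] at this; have : (0:ℝ) ≤ m := m.cast_nonneg; linarith).continuousAt.continuousWithinAt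
  obtain ⟨B, hB⟩ := (isCompact_Icc.image_of_continuousOn hc).bddAbove
  refine ⟨max 1 (14 * B), le_max_left _ _, fun s h1 h2 h3 => ?_⟩
  have h := norm_zetaChi_le_mul_norm_Gamma h2 (by linarith)
  have hne1 : (1 - s : ℂ) ≠ 0 := fun h => by
    have := congrArg Complex.im h
    simp at this; linarith
  have hne2 : (1 - s + 1 : ℂ) ≠ 0 := fun h => by
    have := congrArg Complex.im h
    simp at this; linarith
  have e := Complex.Gamma_add_one _ hne2
  rw [Complex.Gamma_add_one _ hne1] at e
  have hG : ‖Complex.Gamma (1 - s + 1 + 1)‖ ≤ B := by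
    have hre : (1 - s + 1 + 1).re = 3 - s.re := by simp; ring
    refine (norm_Gamma_le (by rw [hre]; linarith)).trans (hB ⟨_, ?_, rfl⟩)
    rw [hre]; constructor <;> linarith
  rw [e, norm_mul, norm_mul] at hG
  have n1 : 1 ≤ ‖1 - s‖ := by
    have := Complex.abs_im_le_norm (1 - s)
    simp at this; exact h3.trans ((le_abs_self _).trans this)
  have n2 : 1 ≤ ‖1 - s + 1‖ := by
    have := Complex.abs_im_le_norm (1 - s + 1)
    simp at this; exact h3.trans ((le_abs_self _).trans this)
  have hG' : ‖Complex.Gamma (1 - s)‖ ≤ B := by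
    refine le_trans ?_ hG
    have := norm_nonneg (Complex.Gamma (1 - s))
    nlinarith [mul_nonneg (sub_nonneg.2 n1) this, mul_nonneg (sub_nonneg.2 n2) (mul_nonneg (norm_nonneg (1 - s)) this)]
  have hB0 : 0 ≤ B := (norm_nonneg _).trans hG'
  refine h.trans ?_
  have : π / 2 * s.im ≤ 2 * s.im := by nlinarith [Real.pi_lt_d2]
  calc _ ≤ 14 * B * Real.exp (2 * s.im) := by gcongr
    _ ≤ _ := by gcongr; exact le_max_right _ _

/-- Polynomial bound for `χ` in the strip `-1/2 ≤ σ ≤ 3/2`. -/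
lemma exists_norm_zetaChi_le :
    ∃ C T₀ : ℝ, 1 ≤ C ∧ 1 ≤ T₀ ∧ ∀ s : ℂ, -1 / 2 ≤ s.re → s.re ≤ 3 / 2 → T₀ ≤ s.im →
      ‖zetaChi s‖ ≤ C * s.im := by
  obtain ⟨A, hA1, hA⟩ := exists_norm_zetaChi_le_exp
  have hlA : 0 ≤ Real.log A := Real.log_nonneg hA1
  refine ⟨Real.exp 9 * 168, 100 + 4 * Real.log A, by nlinarith [Real.add_one_le_exp (9:ℝ)],
    by linarith, fun s h1 h2 h3 => ?_⟩
  set t := s.im with ht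
  have ht100 : 100 ≤ t := by linarith
  set H := Real.sqrt (4 * t) with hH
  have hH2 : H ^ 2 = 4 * t := Real.sq_sqrt (by linarith)
  have hHp : 0 < H := Real.sqrt_pos.2 (by linarith)
  have hHt : H ≤ t / 5 := by
    rw [hH]; refine Real.sqrt_le_iff.2 ⟨by linarith, by nlinarith⟩
  have key := norm_le_exp_of_box (f := zetaChi) (a := -1/2) (b := 3/2) (t := t) (H := H)
    (α := Real.log (168 * t)) (β := Real.log (168 * t)) (γ := Real.log A + 2 * (t + H)) (σ := s.re)
    (by norm_num) (by norm_num) hHp ?_ ?_ ?_ ?_ ?_ ?_ ⟨h1, h2⟩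
  · have e : ((s.re : ℂ) + (t : ℂ) * I) = s := by rw [ht]; exact Complex.re_add_im s
    rw [e] at key
    refine key.trans (le_of_eq ?_)
    have : 9 + ((3 / 2 - s.re) * Real.log (168 * t) + (s.re - -1 / 2) * Real.log (168 * t)) / (3 / 2 - -1 / 2)
      = 9 + Real.log (168 * t) := by ring
    rw [this, Real.exp_add, Real.exp_log (by linarith)]; ring
  · intro z hz hz'
    have := (abs_le.1 hz').1
    exact differentiableAt_zetaChi (by linarith)
  · intro u hu
    have := abs_le.1 hu
    rw [Real.exp_log (by linarith)]
    have h := norm_zetaChi_left_le (t := u) (by linarith)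
    push_cast
    exact h.trans (by linarith)
  · intro u hu
    have := abs_le.1 hu
    rw [Real.exp_log (by linarith)]
    have h := norm_zetaChi_right_le (t := u) (by linarith)
    push_cast
    refine h.trans ?_
    rw [div_le_iff₀ (by linarith)]
    nlinarith
  · intro z hz hz'
    have := abs_le.1 hz'
    refine (hA z hz.1 hz.2 (by linarith)).trans ?_
    rw [Real.exp_add, Real.exp_log (by linarith)]
    gcongr
    linarith
  all_goals
    have : 0 ≤ Real.log (168 * t) := Real.log_nonneg (by linarith)
    rw [hH2]; linarith

/-- Polynomial bound for `ζ` in the half plane `σ ≥ -1/2`. -/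
lemma exists_norm_riemannZeta_le_of_neg_half_le :
    ∃ C T₀ : ℝ, 1 ≤ C ∧ 1 ≤ T₀ ∧ ∀ s : ℂ, -1 / 2 ≤ s.re → s.re ≤ 3 / 2 → T₀ ≤ s.im →
      ‖riemannZeta s‖ ≤ C * s.im ^ 2 := by
  obtain ⟨A, T₀, hA1, hT₀, hA⟩ := exists_norm_zetaChi_le
  obtain ⟨B, hB1, hB⟩ := exists_norm_riemannZeta_le
  refine ⟨A * B * 3, T₀ + 2, by nlinarith, by linarith, fun s h1 h2 h3 => ?_⟩
  have hns : ‖s‖ ≤ 3 * s.im := by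
    refine (Complex.norm_le_abs_re_add_abs_im s).trans ?_
    have : |s.re| ≤ 2 := abs_le.2 ⟨by linarith, by linarith⟩
    rw [abs_of_nonneg (show 0 ≤ s.im by linarith)]; linarith
  rcases le_or_gt (1/4) s.re with h | h
  · refine (hB s h (by linarith)).trans ?_
    calc B * ‖s‖ ≤ 1 * B * (3 * s.im) * 1 := by rw [one_mul, mul_one]; gcongr
      _ ≤ A * B * (3 * s.im) * s.im := by
          have h0 : 0 ≤ s.im := by linarith
          gcongr
          linarith
      _ = _ := by ring
  · rw [riemannZeta_eq_zetaChi_mul (by linarith), norm_mul]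
    have hc : riemannZeta (1 - s) = (starRingEnd ℂ) (riemannZeta (1 - (starRingEnd ℂ) s)) := by
      rw [← riemannZeta_conj]; simp
    have hn : ‖1 - (starRingEnd ℂ) s‖ ≤ 3 * s.im := by
      refine (Complex.norm_le_abs_re_add_abs_im _).trans ?_
      have : |(1 - (starRingEnd ℂ) s).re| ≤ 2 := by
        simp; exact abs_le.2 ⟨by linarith, by linarith⟩
      have h' : |(1 - (starRingEnd ℂ) s).im| = s.im := by
        simp; linarith
      rw [h']; linarith
    rw [hc, RCLike.norm_conj]
    have := hB (1 - (starRingEnd ℂ) s) (by simp; linarith) (by simp; linarith)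
    calc _ ≤ (A * s.im) * (B * (3 * s.im)) := by
          gcongr
          · nlinarith
          · exact hA s h1 h2 (by linarith)
          · exact this.trans (by gcongr)
      _ = _ := by ring

open scoped Pointwise in

lemma card_divisors_mul_le (a b : ℕ) :
    (a * b).divisors.card ≤ a.divisors.card * b.divisors.card := by
  rw [Nat.divisors_mul]; exact Finset.card_mul_le

lemma sum_card_divisors_mul_div_le (N : ℕ) (f : ℕ → ℝ) (hf : ∀ n, 0 ≤ f n)
    (hmul : ∀ a b, f (a * b) ≤ f a * f b) :
    ∑ m ∈ Finset.Icc 1 N, (m.divisors.card : ℝ) * f m / m ≤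
      (∑ m ∈ Finset.Icc 1 N, f m / m) ^ 2 := by
  have h1 : ∀ m ∈ Finset.Icc 1 N, (m.divisors.card : ℝ) * f m / m
      ≤ ∑ p ∈ (Finset.Icc 1 N ×ˢ Finset.Icc 1 N).filter (fun p => p.1 * p.2 = m),
        f p.1 / p.1 * (f p.2 / p.2) := by
    intro m hm
    have hm1 := Finset.mem_Icc.1 hm
    have hsub : m.divisorsAntidiagonal ⊆
        (Finset.Icc 1 N ×ˢ Finset.Icc 1 N).filter (fun p => p.1 * p.2 = m) := by
      intro p hp
      rw [Nat.mem_divisorsAntidiagonal] at hp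
      have h1 : p.1 ≠ 0 := fun h => hp.2 (by rw [← hp.1, h, zero_mul])
      have h2 : p.2 ≠ 0 := fun h => hp.2 (by rw [← hp.1, h, mul_zero])
      have h3 : p.1 ≤ m := by rw [← hp.1]; exact Nat.le_mul_of_pos_right _ (Nat.pos_of_ne_zero h2)
      have h4 : p.2 ≤ m := by rw [← hp.1]; exact Nat.le_mul_of_pos_left _ (Nat.pos_of_ne_zero h1)
      simp only [Finset.mem_filter, Finset.mem_product, Finset.mem_Icc]
      omega
    refine le_trans ?_ (Finset.sum_le_sum_of_subset_of_nonneg hsub fun p _ _ =>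
      mul_nonneg (div_nonneg (hf _) (Nat.cast_nonneg _)) (div_nonneg (hf _) (Nat.cast_nonneg _)))
    have hcard : m.divisorsAntidiagonal.card = m.divisors.card := by
      rw [← Nat.map_div_right_divisors, Finset.card_map]
    rw [← hcard, mul_div_assoc, ← nsmul_eq_mul]
    refine Finset.card_nsmul_le_sum _ _ _ fun p hp => ?_
    rw [Nat.mem_divisorsAntidiagonal] at hp
    rw [div_mul_div_comm, ← hp.1]
    push_cast
    gcongr
    exact hmul _ _
  refine (Finset.sum_le_sum h1).trans ?_
  rw [sq, Finset.sum_mul_sum, ← Finset.sum_product']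
  refine Finset.sum_fiberwise_le_sum_of_sum_fiber_nonneg ?_
  intro m _
  exact Finset.sum_nonneg fun p _ =>
    mul_nonneg (div_nonneg (hf _) (Nat.cast_nonneg _)) (div_nonneg (hf _) (Nat.cast_nonneg _))

lemma sum_card_divisors_sq_div_le (N : ℕ) :
    ∑ m ∈ Finset.Icc 1 N, (m.divisors.card : ℝ) ^ 2 / m ≤ (1 + Real.log N) ^ 4 := by
  have h1 := sum_card_divisors_mul_div_le N (fun n => (n.divisors.card : ℝ))
    (fun _ => Nat.cast_nonneg _) (fun a b => by exact_mod_cast card_divisors_mul_le a b)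
  have h2 := sum_card_divisors_mul_div_le N (fun _ => (1:ℝ)) (fun _ => zero_le_one)
    (fun a b => by norm_num)
  simp only [mul_one] at h2
  have h3 := sum_Icc_one_div_le N
  have h0 : (0:ℝ) ≤ ∑ n ∈ Finset.Icc 1 N, 1 / (n:ℝ) := Finset.sum_nonneg fun _ _ => by positivity
  have h00 : (0:ℝ) ≤ ∑ m ∈ Finset.Icc 1 N, (m.divisors.card : ℝ) / m :=
    Finset.sum_nonneg fun _ _ => by positivity
  calc _ = ∑ m ∈ Finset.Icc 1 N, (m.divisors.card : ℝ) * m.divisors.card / m := by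
        simp only [sq]
    _ ≤ _ := h1
    _ ≤ ((∑ n ∈ Finset.Icc 1 N, 1 / (n:ℝ)) ^ 2) ^ 2 := by gcongr
    _ ≤ ((1 + Real.log N) ^ 2) ^ 2 := by gcongr
    _ = _ := by ring

/-- The Dirichlet polynomial `∑_{n ∈ s} n^{-σ - iv}`. -/
def dirichletSum (s : Finset ℕ) (σ v : ℝ) : ℂ :=
  ∑ n ∈ s, (((n : ℝ) ^ (-σ) : ℝ) : ℂ) * cexp (-(I * Real.log n * v))

lemma sum_cpow_eq_dirichletSum {s : Finset ℕ} (hs : ∀ n ∈ s, 1 ≤ n) (σ v : ℝ) :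
    ∑ n ∈ s, (n : ℂ) ^ (-(σ + v * I : ℂ)) = dirichletSum s σ v := by
  refine Finset.sum_congr rfl fun n hn => ?_
  have h := ofReal_cpow_neg_add_mul_I (x := (n:ℝ)) (by exact_mod_cast hs n hn) σ v
  rw [Complex.ofReal_natCast] at h
  exact h

lemma norm_sum_cpow_sub_mul_I {s : Finset ℕ} (hs : ∀ n ∈ s, 1 ≤ n) (σ v : ℝ) :
    ‖∑ n ∈ s, (n : ℂ) ^ (-(σ - v * I : ℂ))‖ = ‖dirichletSum s σ v‖ := by
  have : (∑ n ∈ s, (n : ℂ) ^ (-(σ - v * I : ℂ))) = (starRingEnd ℂ) (dirichletSum s σ v) := by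
    have h := sum_cpow_eq_dirichletSum hs σ (-v)
    have e : ((σ:ℂ) + ((-v : ℝ):ℂ) * I) = σ - v * I := by push_cast; ring
    rw [e] at h
    rw [h, dirichletSum, dirichletSum, map_sum]
    refine Finset.sum_congr rfl fun n _ => ?_
    rw [map_mul, Complex.conj_ofReal, ← Complex.exp_conj, map_neg, map_mul, map_mul,
      Complex.conj_I, Complex.conj_ofReal, Complex.conj_ofReal, Complex.ofReal_neg]
    ring_nf
  rw [this, RCLike.norm_conj]

/-- A majorant for the local supremum of the fourth power of a Dirichlet polynomial with
coefficients `1`. -/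
lemma exists_majorant_pow_four {T H : ℝ} (hT : 20 ≤ T) (hH : 0 ≤ H) (hHT : H + 1 ≤ T)
    {s : Finset ℕ} {X : ℕ} (hs : ∀ n ∈ s, 1 ≤ n ∧ n ≤ X) {σ W : ℝ} (hW : 0 ≤ W)
    (hw : ∀ a ∈ s, ∀ b ∈ s,
      (T + (a * b : ℕ)) * (((a * b : ℕ) : ℝ) ^ (-σ)) ^ 2 ≤ W / (a * b : ℕ)) :
    ∃ Z : ℝ → ℝ, Continuous Z ∧ (∀ t, 0 ≤ Z t) ∧
      (∀ t u : ℝ, |u - t| ≤ H → ‖dirichletSum s σ u‖ ^ 4 ≤ Z t) ∧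
      ∫ t in (0:ℝ)..T, Z t ≤ 1600 * (2 * H + 1) * W * (1 + 2 * Real.log X) ^ 6 := by
  classical
  set S : Finset ℕ := (s ×ˢ s).image (fun p => p.1 * p.2) with hS
  set c : ℕ → ℝ := fun m => (((s ×ˢ s).filter (fun p => p.1 * p.2 = m)).card : ℝ) with hc
  set b : ℕ → ℂ := fun m => ((c m * (m : ℝ) ^ (-σ) : ℝ) : ℂ) with hb
  have hSm : ∀ m ∈ S, 1 ≤ m ∧ (m:ℝ) ≤ ((X ^ 2 : ℕ) : ℝ) := by
    intro m hm
    obtain ⟨p, hp, rfl⟩ := Finset.mem_image.1 hm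
    rw [Finset.mem_product] at hp
    have h1 := hs _ hp.1
    have h2 := hs _ hp.2
    refine ⟨Nat.mul_pos h1.1 h2.1, ?_⟩
    have : p.1 * p.2 ≤ X ^ 2 := by rw [sq]; exact Nat.mul_le_mul h1.2 h2.2
    exact_mod_cast this
  obtain ⟨Z, hZc, hZ0, hZ, hZi⟩ := exists_majorant hT hH hHT S hSm b
  have hsq : ∀ u : ℝ, dirichletSum s σ u ^ 2 = ∑ m ∈ S, b m * cexp (-(I * Real.log m * u)) := by
    intro u
    rw [sq, dirichletSum, Finset.sum_mul_sum, ← Finset.sum_product',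
      ← Finset.sum_fiberwise_of_maps_to (g := fun p : ℕ × ℕ => p.1 * p.2) (t := S)
        (fun p hp => Finset.mem_image_of_mem _ hp)]
    refine Finset.sum_congr rfl fun m _ => ?_
    have : ∀ p ∈ (s ×ˢ s).filter (fun p => p.1 * p.2 = m),
        ((((p.1 : ℝ) ^ (-σ) : ℝ) : ℂ) * cexp (-(I * Real.log p.1 * u))) *
          ((((p.2 : ℝ) ^ (-σ) : ℝ) : ℂ) * cexp (-(I * Real.log p.2 * u))) =
        (((m : ℝ) ^ (-σ) : ℝ) : ℂ) * cexp (-(I * Real.log m * u)) := by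
      intro p hp
      rw [Finset.mem_filter, Finset.mem_product] at hp
      have h1 : (0:ℝ) < p.1 := by exact_mod_cast (hs _ hp.1.1).1
      have h2 : (0:ℝ) < p.2 := by exact_mod_cast (hs _ hp.1.2).1
      rw [← hp.2, Nat.cast_mul, Real.mul_rpow h1.le h2.le, Real.log_mul h1.ne' h2.ne']
      have e : (-(I * ((Real.log p.1 + Real.log p.2 : ℝ) : ℂ) * u) : ℂ) =
        -(I * Real.log p.1 * u) + -(I * Real.log p.2 * u) := by push_cast; ring
      rw [e, Complex.exp_add]
      push_cast
      ring
    rw [Finset.sum_congr rfl this, Finset.sum_const, nsmul_eq_mul, hb, hc]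
    push_cast
    ring
  refine ⟨Z, hZc, hZ0, fun t u htu => ?_, hZi.trans ?_⟩
  · have := hZ t u htu
    rw [← hsq, norm_pow] at this
    calc _ = (‖dirichletSum s σ u‖ ^ 2) ^ 2 := by ring
      _ ≤ _ := this
  · have hX0 : 0 ≤ Real.log X := Real.log_natCast_nonneg X
    have hlog : Real.log ((X ^ 2 : ℕ) : ℝ) = 2 * Real.log X := by
      push_cast; rw [Real.log_pow]; norm_num
    rw [hlog]
    have hcd : ∀ m ∈ S, c m ≤ m.divisors.card := by
      intro m hm
      have h1 := (hSm m hm).1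
      have hcard : m.divisorsAntidiagonal.card = m.divisors.card := by
        rw [← Nat.map_div_right_divisors, Finset.card_map]
      rw [← hcard]
      simp only [hc]
      refine Nat.cast_le.2 (Finset.card_le_card fun p hp => ?_)
      rw [Nat.mem_divisorsAntidiagonal]
      exact ⟨(Finset.mem_filter.1 hp).2, by omega⟩
    have hsum : ∑ n ∈ S, (T + n) * ‖b n‖ ^ 2 ≤ W * (1 + 2 * Real.log X) ^ 4 := by
      calc ∑ n ∈ S, (T + n) * ‖b n‖ ^ 2 ≤ ∑ n ∈ S, W * ((n.divisors.card : ℝ) ^ 2 / n) := by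
            refine Finset.sum_le_sum fun n hn => ?_
            have h1 := (hSm n hn).1
            have h2 := hcd n hn
            have h0 : 0 ≤ c n := Nat.cast_nonneg _
            obtain ⟨p, hp, rfl⟩ := Finset.mem_image.1 hn
            rw [Finset.mem_product] at hp
            have h3 := hw _ hp.1 _ hp.2
            set m := p.1 * p.2 with hm
            have hbn : ‖b m‖ ^ 2 = c m ^ 2 * ((m:ℝ) ^ (-σ)) ^ 2 := by
              rw [hb, Complex.norm_real, Real.norm_eq_abs, sq_abs, mul_pow]
            rw [hbn]
            calc _ = c m ^ 2 * ((T + m) * ((m:ℝ) ^ (-σ)) ^ 2) := by ring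
              _ ≤ (m.divisors.card : ℝ) ^ 2 * (W / m) := by gcongr
              _ = _ := by ring
        _ = W * ∑ n ∈ S, (n.divisors.card : ℝ) ^ 2 / n := by rw [Finset.mul_sum]
        _ ≤ W * ∑ n ∈ Finset.Icc 1 (X ^ 2), (n.divisors.card : ℝ) ^ 2 / n := by
            gcongr
            intro n hn
            have := hSm n hn
            exact Finset.mem_Icc.2 ⟨this.1, by exact_mod_cast this.2⟩
        _ ≤ W * (1 + Real.log ((X ^ 2 : ℕ) : ℝ)) ^ 4 := by
            gcongr
            exact sum_card_divisors_sq_div_le _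
        _ = _ := by rw [hlog]
    calc _ ≤ 1600 * (2 * H + 1) * (1 + 2 * Real.log X) ^ 2 * (W * (1 + 2 * Real.log X) ^ 4) := by
          gcongr
      _ = _ := by ring

lemma exists_norm_zeta_sub_sum_le :
    ∃ C : ℝ, 1 ≤ C ∧ ∀ (X : ℕ) (s : ℂ), 1 ≤ X → s.re = 3 / 2 →
      ‖riemannZeta s - ∑ n ∈ Finset.Icc 1 X, (n : ℂ) ^ (-s)‖ ≤ C * (X : ℝ) ^ (-(1 / 4) : ℝ) := by
  have hsum : Summable (fun n : ℕ => ((n + 1 : ℕ) : ℝ) ^ (-(5 / 4) : ℝ)) :=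
    (summable_nat_add_iff 1).2 (Real.summable_nat_rpow.2 (by norm_num))
  refine ⟨max 1 (∑' n : ℕ, ((n + 1 : ℕ) : ℝ) ^ (-(5 / 4) : ℝ)), le_max_left _ _,
    fun X s hX hs => ?_⟩
  have hX0 : (0:ℝ) < X := by exact_mod_cast hX
  have hnorm : ∀ n : ℕ, ‖((n + 1 : ℕ) : ℂ) ^ (-s)‖ = ((n + 1 : ℕ) : ℝ) ^ (-(3 / 2) : ℝ) := by
    intro n
    rw [Complex.norm_natCast_cpow_of_pos (Nat.succ_pos n), Complex.neg_re, hs]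
  have hs1 : Summable (fun n : ℕ => ((n + 1 : ℕ) : ℂ) ^ (-s)) := by
    refine Summable.of_norm ?_
    simp only [hnorm]
    exact (summable_nat_add_iff 1).2 (Real.summable_nat_rpow.2 (by norm_num))
  have hz : riemannZeta s = ∑' n : ℕ, ((n + 1 : ℕ) : ℂ) ^ (-s) := by
    rw [zeta_eq_tsum_one_div_nat_add_one_cpow (by rw [hs]; norm_num)]
    refine tsum_congr fun n => ?_
    rw [Complex.cpow_neg, one_div]; push_cast; rfl
  have hIcc : ∑ n ∈ Finset.Icc 1 X, (n : ℂ) ^ (-s) =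
      ∑ n ∈ Finset.range X, ((n + 1 : ℕ) : ℂ) ^ (-s) := by
    rw [Finset.range_eq_Ico, Finset.sum_Ico_add' (fun n : ℕ => ((n : ℕ) : ℂ) ^ (-s)) 0 X 1]
    rfl
  rw [hz, hIcc, ← hs1.sum_add_tsum_nat_add X, add_sub_cancel_left]
  have hle : ∀ n : ℕ, ‖((n + X + 1 : ℕ) : ℂ) ^ (-s)‖ ≤
      (X : ℝ) ^ (-(1 / 4) : ℝ) * ((n + 1 : ℕ) : ℝ) ^ (-(5 / 4) : ℝ) := by
    intro n
    rw [hnorm]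
    have hp : (0:ℝ) < ((n + X + 1 : ℕ) : ℝ) := by positivity
    have : (-(3 / 2) : ℝ) = -(1/4) + -(5/4) := by norm_num
    rw [this, Real.rpow_add hp]
    gcongr ?_ * ?_
    · refine Real.rpow_le_rpow_of_nonpos hX0 ?_ (by norm_num)
      exact_mod_cast (by omega : X ≤ n + X + 1)
    · refine Real.rpow_le_rpow_of_nonpos (by positivity) ?_ (by norm_num)
      exact_mod_cast (by omega : n + 1 ≤ n + X + 1)
  have hs2 := hsum.mul_left ((X : ℝ) ^ (-(1 / 4) : ℝ))
  refine (tsum_of_norm_bounded hs2.hasSum hle).trans ?_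
  rw [tsum_mul_left, mul_comm]
  gcongr
  exact le_max_right _ _

lemma norm_sum_cpow_le_sq {N : ℕ} {s : ℂ} (hs : -1 / 2 ≤ s.re) :
    ‖∑ n ∈ Finset.Icc 1 N, (n : ℂ) ^ (-s)‖ ≤ (N : ℝ) ^ 2 := by
  refine (norm_sum_le _ _).trans ?_
  calc ∑ n ∈ Finset.Icc 1 N, ‖(n : ℂ) ^ (-s)‖ ≤ ∑ n ∈ Finset.Icc 1 N, (N : ℝ) := by
        refine Finset.sum_le_sum fun n hn => ?_
        rw [Finset.mem_Icc] at hn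
        rw [Complex.norm_natCast_cpow_of_pos hn.1]
        have h1 : (1:ℝ) ≤ n := by exact_mod_cast hn.1
        calc (n:ℝ) ^ (-s).re ≤ (n:ℝ) ^ (1:ℝ) :=
              Real.rpow_le_rpow_of_exponent_le h1 (by rw [Complex.neg_re]; linarith)
          _ = n := Real.rpow_one _
          _ ≤ N := by exact_mod_cast hn.2
    _ = (N : ℝ) ^ 2 := by simp; ring

lemma norm_zetaChi_half_le {t : ℝ} (ht : 0 < t) : ‖zetaChi (1 / 2 + t * I)‖ ≤ 42 := by
  have h := norm_zetaChi_le_mul_norm_Gamma (s := 1 / 2 + t * I) (by simp; norm_num) (by simpa)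
  have e1 : (1 - (1 / 2 + t * I) : ℂ) = 1 / 2 - t * I := by ring
  have e3 : (1 / 2 + t * I : ℂ).im = t := by simp
  rw [e1, e3] at h
  have h5 : Real.exp (-(π / 2 * t)) * Real.exp (π / 2 * t) = 1 := by rw [← Real.exp_add]; simp
  calc _ ≤ _ := h
    _ ≤ 14 * (3 * Real.exp (-(π / 2 * t))) * Real.exp (π / 2 * t) := by
        gcongr; exact norm_Gamma_half_sub_le
    _ = 42 * (Real.exp (-(π / 2 * t)) * Real.exp (π / 2 * t)) := by ring
    _ = 42 := by rw [h5]; ring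

set_option maxHeartbeats 1000000 in
/-- An approximate functional equation on the critical line, with the error term expressed through
Dirichlet polynomials on the lines `σ = 3/2` and `σ = -1/2`. -/
lemma exists_norm_zeta_half_le :
    ∃ C B : ℝ, 1 ≤ C ∧ ∀ (T u d a b : ℝ) (N X : ℕ), 20 ≤ T → B ≤ Real.log T →
      T / (2 * Real.log T ^ 3) ≤ u - Real.log T → u + Real.log T ≤ 2 * T →
      B ≤ T / (2 * Real.log T ^ 3) →
      1 ≤ N → N ≤ X → (N : ℝ) ^ 2 ≤ T → (X : ℝ) ^ (-(1 / 4) : ℝ) ≤ 1 / T ^ 2 →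
      ‖dirichletSum (Finset.Icc 1 N) (1 / 2) u‖ ≤ d →
      (∀ v, |v - u| ≤ Real.log T → ‖dirichletSum (Finset.Ioc N X) (3 / 2) v‖ ≤ a) →
      (∀ v, |v - u| ≤ Real.log T → ‖dirichletSum (Finset.Icc 1 N) (-1 / 2) v‖ ≤ b) →
      ‖riemannZeta (1 / 2 + u * I)‖ ≤
        C * (d + Real.sqrt T * (1 / T ^ 2 + a + Real.log T ^ 3 / T * b)) := by
  obtain ⟨C1, T1, hC1, hT1, hchi⟩ := exists_norm_zetaChi_le
  obtain ⟨C2, T2, hC2, hT2, hzeta⟩ := exists_norm_riemannZeta_le_of_neg_half_le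
  obtain ⟨C3, hC3, htail⟩ := exists_norm_zeta_sub_sum_le
  set c := 4 * C2 + 2 * C1 + 1 with hc
  have hc1 : 1 ≤ c := by linarith
  have hlc : 0 ≤ Real.log c := Real.log_nonneg hc1
  refine ⟨43 + Real.exp 9 * Real.sqrt 168 * (C3 + 84), max (max T1 T2) (5 + Real.log c),
    ?_, ?_⟩
  · have : 0 ≤ Real.exp 9 * Real.sqrt 168 * (C3 + 84) := by positivity
    linarith
  intro T u d a b N X hT hB hu1 hu2 hB2 hN hNX hNT hX hd ha hb
  set L := Real.log T with hL
  have hLT1 : T1 ≤ T / (2 * L ^ 3) := ((le_max_left _ _).trans (le_max_left _ _)).trans hB2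
  have hLT2 : T2 ≤ T / (2 * L ^ 3) := ((le_max_right _ _).trans (le_max_left _ _)).trans hB2
  have hL5 : 5 + Real.log c ≤ L := (le_max_right _ _).trans hB
  have hLp : 0 < L := by linarith
  have hTp : 0 < T := by linarith
  have ha0 : 0 ≤ a := (norm_nonneg _).trans (ha u (by simpa using hLp.le))
  have hb0 : 0 ≤ b := (norm_nonneg _).trans (hb u (by simpa using hLp.le))
  set w := C3 * (1 / T ^ 2) + a + 84 * L ^ 3 / T * b with hw
  have hw2 : 1 / T ^ 2 ≤ w := by
    have h1 : 1 / T ^ 2 ≤ C3 * (1 / T ^ 2) := le_mul_of_one_le_left (by positivity) hC3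
    have h2 : 0 ≤ 84 * L ^ 3 / T * b := by positivity
    linarith
  have hwp : 0 < w := lt_of_lt_of_le (by positivity) hw2
  have hlogw : -(2 * L) ≤ Real.log w := by
    have := Real.log_le_log (by positivity) hw2
    rw [one_div, Real.log_inv, Real.log_pow] at this
    simpa using this
  set D : ℂ → ℂ := fun s => ∑ n ∈ Finset.Icc 1 N, (n : ℂ) ^ (-s) with hD
  set R : ℂ → ℂ := fun s => riemannZeta s - D s - zetaChi s * D (1 - s) with hR
  have hIcc1 : ∀ n ∈ Finset.Icc 1 N, 1 ≤ n := fun n hn => (Finset.mem_Icc.1 hn).1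
  have hIoc1 : ∀ n ∈ Finset.Ioc N X, 1 ≤ n := fun n hn => by
    have := (Finset.mem_Ioc.1 hn).1; omega
  have hdiffD : Differentiable ℂ D := by
    intro s
    refine DifferentiableAt.fun_sum fun n hn => ?_
    refine DifferentiableAt.const_cpow (by fun_prop) (Or.inl ?_)
    have := hIcc1 n hn
    exact_mod_cast (by omega : n ≠ 0)
  -- the truncated tail on the line `σ = 3/2`
  have hright : ∀ v : ℝ, |v - u| ≤ L →
      ‖riemannZeta (3 / 2 + v * I) - D (3 / 2 + v * I)‖ ≤ C3 * (1 / T ^ 2) + a := by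
    intro v hv
    have h1 := htail X (3 / 2 + v * I) (hN.trans hNX) (by simp)
    have h2 : ∑ n ∈ Finset.Icc 1 X, (n : ℂ) ^ (-(3 / 2 + v * I : ℂ)) = D (3 / 2 + v * I) +
        dirichletSum (Finset.Ioc N X) (3 / 2) v := by
      rw [← sum_cpow_eq_dirichletSum hIoc1]
      simp only [hD]
      have : Finset.Icc 1 X = Finset.Icc 1 N ∪ Finset.Ioc N X := by
        ext n; simp only [Finset.mem_union, Finset.mem_Icc, Finset.mem_Ioc]; omega
      rw [this, Finset.sum_union]
      · push_cast; rfl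
      · rw [Finset.disjoint_left]; intro n; simp only [Finset.mem_Icc, Finset.mem_Ioc]; omega
    rw [h2] at h1
    have h3 := ha v hv
    calc _ = ‖(riemannZeta (3 / 2 + v * I) - (D (3 / 2 + v * I) +
          dirichletSum (Finset.Ioc N X) (3 / 2) v)) + dirichletSum (Finset.Ioc N X) (3 / 2) v‖ := by
          congr 1; ring
      _ ≤ _ := norm_add_le _ _
      _ ≤ C3 * (X : ℝ) ^ (-(1 / 4) : ℝ) + a := by gcongr
      _ ≤ _ := by gcongr
  have hb84 : b ≤ 168 * T * (84 * L ^ 3 / T * b) := by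
    have e : 168 * T * (84 * L ^ 3 / T * b) = (168 * 84 * L ^ 3) * b := by field_simp
    rw [e]
    refine le_mul_of_one_le_left hb0 ?_
    have : 1 ≤ L ^ 3 := one_le_pow₀ (by linarith)
    linarith
  have hv : ∀ v : ℝ, |v - u| ≤ L → T / (2 * L ^ 3) ≤ v ∧ v ≤ 2 * T := fun v hv => by
    have := abs_le.1 hv
    constructor <;> linarith
  have key := norm_le_exp_of_box (f := R) (a := -1/2) (b := 3/2) (t := u) (H := L)
    (α := Real.log (168 * T * w)) (β := Real.log w) (γ := Real.log c + 2 * L) (σ := 1 / 2)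
    (by norm_num) (by norm_num) hLp ?_ ?_ ?_ ?_ ?_ ?_ ⟨by norm_num, by norm_num⟩
  · have e0 : 9 + ((3 / 2 - 1 / 2) * Real.log (168 * T * w) + (1 / 2 - -1 / 2) * Real.log w) /
        (3 / 2 - -1 / 2) = 9 + Real.log (Real.sqrt (168 * T)) + Real.log w := by
      rw [Real.log_mul (by positivity) (by positivity), Real.log_sqrt (by positivity)]; ring
    rw [e0, Real.exp_add, Real.exp_add, Real.exp_log (by positivity), Real.exp_log hwp,
      Real.sqrt_mul (by norm_num)] at key
    have hup : 0 < u := by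
      have := (hv u (by simpa using hLp.le)).1
      have h' : 0 < T / (2 * L ^ 3) := by positivity
      linarith
    have hd1 : ‖D (1 / 2 + u * I)‖ ≤ d := by
      have := sum_cpow_eq_dirichletSum hIcc1 (1 / 2) u
      push_cast at this
      simp only [hD]; rw [this]; exact hd
    have hd2 : ‖D (1 - (1 / 2 + u * I))‖ ≤ d := by
      have := norm_sum_cpow_sub_mul_I hIcc1 (1 / 2) u
      push_cast at this
      have e : (1 - (1 / 2 + u * I) : ℂ) = 1 / 2 - u * I := by ring
      simp only [hD]; rw [e, this]; exact hd
    have hd0 : 0 ≤ d := (norm_nonneg _).trans hd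
    have hchi42 := norm_zetaChi_half_le hup
    push_cast at key
    have hz : riemannZeta (1 / 2 + u * I) = D (1 / 2 + u * I) +
        zetaChi (1 / 2 + u * I) * D (1 - (1 / 2 + u * I)) + R (1 / 2 + u * I) := by
      simp only [hR]; ring
    have hwle : w ≤ (C3 + 84) * (1 / T ^ 2 + a + L ^ 3 / T * b) := by
      have e : (C3 + 84) * (1 / T ^ 2 + a + L ^ 3 / T * b) - w =
        84 * (1 / T ^ 2) + (C3 + 83) * a + C3 * (L ^ 3 / T * b) := by rw [hw]; ring
      have : 0 ≤ 84 * (1 / T ^ 2) + (C3 + 83) * a + C3 * (L ^ 3 / T * b) := by positivity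
      linarith
    have hq : 0 ≤ Real.sqrt T * (1 / T ^ 2 + a + L ^ 3 / T * b) := by positivity
    rw [hz]
    calc _ ≤ ‖D (1 / 2 + u * I)‖ + ‖zetaChi (1 / 2 + u * I)‖ * ‖D (1 - (1 / 2 + u * I))‖ +
          ‖R (1 / 2 + u * I)‖ := by
          refine (norm_add_le _ _).trans ?_
          rw [← norm_mul]; gcongr; exact norm_add_le _ _
      _ ≤ d + 42 * d + Real.exp 9 * (Real.sqrt 168 * Real.sqrt T) *
          ((C3 + 84) * (1 / T ^ 2 + a + L ^ 3 / T * b)) := by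
          gcongr
          exact key.trans (by gcongr)
      _ = 43 * d + (Real.exp 9 * Real.sqrt 168 * (C3 + 84)) *
          (Real.sqrt T * (1 / T ^ 2 + a + L ^ 3 / T * b)) := by ring
      _ ≤ (43 + Real.exp 9 * Real.sqrt 168 * (C3 + 84)) * d +
          (43 + Real.exp 9 * Real.sqrt 168 * (C3 + 84)) *
          (Real.sqrt T * (1 / T ^ 2 + a + L ^ 3 / T * b)) := by
          gcongr
          · have : 0 ≤ Real.exp 9 * Real.sqrt 168 * (C3 + 84) := by positivity
            linarith
          · linarith
      _ = _ := by ring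
  · intro z hz hz'
    have h1 := hv z.im hz'
    have h2 : 0 < z.im := by linarith
    refine ((differentiableAt_riemannZeta (ne_one_of_im_pos h2)).sub (hdiffD z)).sub
      ((differentiableAt_zetaChi h2).mul ?_)
    exact DifferentiableAt.comp (g := D) z (hdiffD _) (by fun_prop)
  · intro v hv'
    have h1 := hv v hv'
    have hv1 : 1 ≤ v := by linarith
    rw [Real.exp_log (by positivity)]
    have h2 := norm_zetaChi_left_le hv1
    have e1 : (1 - (-1 / 2 + v * I) : ℂ) = (starRingEnd ℂ) (3 / 2 + v * I) := by
      apply Complex.ext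
      · rw [Complex.conj_re]; simp; norm_num
      · rw [Complex.conj_im]; simp
    have hDconj : D ((starRingEnd ℂ) (3 / 2 + v * I)) = (starRingEnd ℂ) (D (3 / 2 + v * I)) := by
      simp only [hD, map_sum]
      refine Finset.sum_congr rfl fun n _ => ?_
      rw [← map_neg, Complex.cpow_conj _ _ (by rw [Complex.natCast_arg]; exact Real.pi_ne_zero.symm),
        map_natCast]
    have hRv : R (-1 / 2 + v * I) = zetaChi (-1 / 2 + v * I) *
        (starRingEnd ℂ) (riemannZeta (3 / 2 + v * I) - D (3 / 2 + v * I)) - D (-1 / 2 + v * I) := by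
      simp only [hR]
      rw [riemannZeta_eq_zetaChi_mul (by simp; linarith), e1, hDconj, riemannZeta_conj, map_sub]
      ring
    have hDb : ‖D (-1 / 2 + v * I)‖ ≤ b := by
      have := sum_cpow_eq_dirichletSum hIcc1 (-1 / 2) v
      push_cast at this
      simp only [hD]; rw [this]; exact hb v hv'
    push_cast
    rw [hRv]
    calc _ ≤ 84 * v * (C3 * (1 / T ^ 2) + a) + b := by
          refine (norm_sub_le _ _).trans ?_
          rw [norm_mul, RCLike.norm_conj]
          gcongr
          exact hright v hv'
      _ ≤ 168 * T * (C3 * (1 / T ^ 2) + a) + 168 * T * (84 * L ^ 3 / T * b) := by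
          gcongr ?_ * _ + ?_
          linarith
      _ = _ := by rw [hw]; ring
  · intro v hv'
    have h1 := hv v hv'
    have hv1 : 1 ≤ v := by linarith
    rw [Real.exp_log hwp]
    have h2 := norm_zetaChi_right_le (t := v) (by linarith)
    have hDb : ‖D (1 - (3 / 2 + v * I))‖ ≤ b := by
      have := norm_sum_cpow_sub_mul_I hIcc1 (-1 / 2) v
      push_cast at this
      have e : (1 - (3 / 2 + v * I) : ℂ) = -1 / 2 - v * I := by ring
      simp only [hD]; rw [e, this]; exact hb v hv'
    push_cast
    simp only [hR]
    calc _ ≤ (C3 * (1 / T ^ 2) + a) + 42 / v * b := by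
          refine (norm_sub_le _ _).trans ?_
          rw [norm_mul]
          gcongr
          exact hright v hv'
      _ ≤ (C3 * (1 / T ^ 2) + a) + 84 * L ^ 3 / T * b := by
          gcongr _ + ?_ * b
          rw [div_le_div_iff₀ (by linarith) hTp]
          have := h1.1
          rw [div_le_iff₀ (by positivity)] at this
          nlinarith
      _ = _ := by rw [hw]
  · intro z hz hz'
    have h1 := hv z.im hz'
    have h2 : 0 < z.im := by linarith
    have hz2 := hzeta z hz.1 hz.2 (by linarith)
    have hc2 := hchi z hz.1 hz.2 (by linarith)
    have hD1 : ‖D z‖ ≤ T := (norm_sum_cpow_le_sq hz.1).trans hNT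
    have hD2 : ‖D (1 - z)‖ ≤ T :=
      (norm_sum_cpow_le_sq (by simp only [Complex.sub_re, Complex.one_re]; linarith [hz.2])).trans hNT
    have hexp : Real.exp (Real.log c + 2 * L) = c * T ^ 2 := by
      rw [Real.exp_add, Real.exp_log (by linarith), two_mul, Real.exp_add, hL, Real.exp_log hTp]
      ring
    rw [hexp]
    simp only [hR]
    calc _ ≤ ‖riemannZeta z‖ + ‖D z‖ + ‖zetaChi z‖ * ‖D (1 - z)‖ := by
          refine (norm_sub_le _ _).trans ?_
          rw [← norm_mul]; gcongr; exact norm_sub_le _ _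
      _ ≤ C2 * (2 * T) ^ 2 + T + C1 * (2 * T) * T := by
          gcongr
          · exact hz2.trans (by gcongr; exact h1.2)
          · exact hc2.trans (by gcongr; exact h1.2)
      _ ≤ c * T ^ 2 := by rw [hc]; nlinarith
  · rw [Real.log_mul (by positivity) (by positivity)]
    have : 0 ≤ Real.log (168 * T) := Real.log_nonneg (by linarith)
    nlinarith
  · nlinarith

lemma exists_log_large (B : ℝ) (k : ℕ) :
    ∃ T₁ : ℝ, 20 ≤ T₁ ∧ ∀ T, T₁ ≤ T → B ≤ Real.log T ∧ 100 * Real.log T ^ k ≤ T := by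
  have h1 : ∀ᶠ T in atTop, B ≤ Real.log T := Real.tendsto_log_atTop.eventually_ge_atTop B
  have h2 : ∀ᶠ T : ℝ in atTop, 100 * Real.log T ^ k ≤ T := by
    have h := (isLittleO_pow_log_id_atTop (n := k)).bound (show (0:ℝ) < 1 / 100 by norm_num)
    filter_upwards [h, eventually_ge_atTop (1:ℝ)] with T hT hT1
    rw [Real.norm_of_nonneg (pow_nonneg (Real.log_nonneg hT1) _), id,
      Real.norm_of_nonneg (by linarith)] at hT
    linarith
  obtain ⟨T₁, hT₁⟩ := (h1.and h2).exists_forall_of_atTop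
  exact ⟨max 20 T₁, le_max_left _ _, fun T hT => hT₁ T ((le_max_right _ _).trans hT)⟩

lemma le_sqrt_sqrt {x y : ℝ} (hx : 0 ≤ x) (h : x ^ 4 ≤ y) : x ≤ Real.sqrt (Real.sqrt y) := by
  refine Real.le_sqrt_of_sq_le (Real.le_sqrt_of_sq_le ?_)
  calc (x ^ 2) ^ 2 = x ^ 4 := by ring
    _ ≤ y := h

lemma sqrt_sqrt_pow_four {y : ℝ} (hy : 0 ≤ y) : Real.sqrt (Real.sqrt y) ^ 4 = y := by
  calc Real.sqrt (Real.sqrt y) ^ 4 = (Real.sqrt (Real.sqrt y) ^ 2) ^ 2 := by ring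
    _ = y := by rw [Real.sq_sqrt (Real.sqrt_nonneg _), Real.sq_sqrt hy]

lemma approx_pow_four_le {C d x a b T r : ℝ} (hC : 0 ≤ C) (hd : 0 ≤ d) (hx : 0 ≤ x) (ha : 0 ≤ a)
    (hb : 0 ≤ b) (hT : 0 ≤ T) (hr : 0 ≤ r) :
    (C * (d + Real.sqrt T * (x + a + r * b))) ^ 4 ≤
      C ^ 4 * 8 * (d ^ 4 + 64 * T ^ 2 * (x ^ 4 + a ^ 4 + r ^ 4 * b ^ 4)) := by
  have h1 := add_pow_le hd (show 0 ≤ Real.sqrt T * (x + a + r * b) by positivity) 4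
  have h2 := add_pow_le (show 0 ≤ x + a by positivity) (show 0 ≤ r * b by positivity) 4
  have h3 := add_pow_le hx ha 4
  have hs : Real.sqrt T ^ 4 = T ^ 2 := by
    calc Real.sqrt T ^ 4 = (Real.sqrt T ^ 2) ^ 2 := by ring
      _ = _ := by rw [Real.sq_sqrt hT]
  norm_num at h1 h2 h3
  rw [mul_pow]
  rw [mul_assoc]
  gcongr
  refine h1.trans ?_
  rw [mul_pow, hs]
  rw [mul_pow] at h2
  have h4 : (x + a + r * b) ^ 4 ≤ 64 * (x ^ 4 + a ^ 4 + r ^ 4 * b ^ 4) := by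
    have : 0 ≤ r ^ 4 * b ^ 4 := by positivity
    linarith
  calc _ ≤ 8 * (d ^ 4 + T ^ 2 * (64 * (x ^ 4 + a ^ 4 + r ^ 4 * b ^ 4))) := by gcongr
    _ = _ := by ring

lemma rpow_neg_sq_nat {m : ℕ} (hm : 1 ≤ m) (σ : ℝ) :
    (((m : ℝ) ^ (-σ)) ^ 2) = (m : ℝ) ^ (-(2 * σ)) := by
  rw [← Real.rpow_natCast, ← Real.rpow_mul (Nat.cast_nonneg m)]
  congr 1; push_cast; ring

set_option maxHeartbeats 1000000 in
/-- Local suprema of `|ζ(1/2+iu)|⁴` are majorised by a function with a small mean value. -/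
lemma exists_zeta_fourth_moment_majorant :
    ∃ T₁ : ℝ, 20 ≤ T₁ ∧ ∀ T, T₁ ≤ T → ∃ Z : ℝ → ℝ, Continuous Z ∧ (∀ t, 0 ≤ Z t) ∧
      (∀ t u : ℝ, T / Real.log T ^ 3 ≤ t → t ≤ T → |u - t| ≤ 4 * Real.log T →
        ‖riemannZeta (1 / 2 + u * I)‖ ^ 4 ≤ Z t) ∧
      ∫ t in (0:ℝ)..T, Z t ≤ T * Real.log T ^ 20 := by
  obtain ⟨C, B, hC, hmain⟩ := exists_norm_zeta_half_le
  set c0 : ℝ := 1600 * 11 * 33 ^ 6 with hc0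
  set K : ℝ := C ^ 4 * 8 * (2 * c0 + 64 * (1 + 4 * c0)) with hK
  obtain ⟨T₁, hT₁, hlarge⟩ := exists_log_large (max (max B K) 1) 4
  refine ⟨T₁, hT₁, fun T hT => ?_⟩
  obtain ⟨hBL, hTL⟩ := hlarge T hT
  set L := Real.log T with hL
  have hBL' : B ≤ L := ((le_max_left _ _).trans (le_max_left _ _)).trans hBL
  have hKL : K ≤ L := ((le_max_right _ _).trans (le_max_left _ _)).trans hBL
  have hL1 : 1 ≤ L := (le_max_right _ _).trans hBL
  have hT20 : 20 ≤ T := hT₁.trans hT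
  have hTp : 0 < T := by linarith
  have hLp : 0 < L := by linarith
  have hL4 : L ≤ L ^ 4 := le_self_pow₀ hL1 (by norm_num)
  have hHT : 5 * L + 1 ≤ T := by linarith
  set N := ⌊Real.sqrt T⌋₊ with hN
  set X := ⌈T⌉₊ ^ 8 with hX
  have hsT : Real.sqrt T ^ 2 = T := Real.sq_sqrt hTp.le
  have hsT1 : 1 ≤ Real.sqrt T := Real.one_le_sqrt.2 (by linarith)
  have hsTT : Real.sqrt T ≤ T := (le_self_pow₀ hsT1 two_ne_zero).trans_eq hsT
  have hN1 : 1 ≤ N := Nat.le_floor (by simpa using hsT1)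
  have hNle : (N:ℝ) ≤ Real.sqrt T := Nat.floor_le (Real.sqrt_nonneg _)
  have hN2 : (N:ℝ) ^ 2 ≤ T := by rw [← hsT]; gcongr
  have hNlt : Real.sqrt T < N + 1 := Nat.lt_floor_add_one _
  have hcT : T ≤ ⌈T⌉₊ := Nat.le_ceil T
  have hcT2 : (⌈T⌉₊ : ℝ) ≤ T ^ 2 := by
    have := Nat.ceil_lt_add_one hTp.le
    linarith [mul_le_mul_of_nonneg_right hT20 hTp.le]
  have hNX : N ≤ X := by
    have h1 : (N:ℝ) ≤ ⌈T⌉₊ := hNle.trans (hsTT.trans hcT)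
    have h2 : N ≤ ⌈T⌉₊ := by exact_mod_cast h1
    exact h2.trans (Nat.le_self_pow (by norm_num) _)
  have hXT : (X : ℝ) ^ (-(1 / 4) : ℝ) ≤ 1 / T ^ 2 := by
    rw [hX, Nat.cast_pow, ← Real.rpow_natCast, ← Real.rpow_mul (Nat.cast_nonneg _)]
    have e : ((8:ℕ):ℝ) * -(1 / 4) = -((2:ℕ):ℝ) := by norm_num
    rw [e, Real.rpow_neg (Nat.cast_nonneg _), Real.rpow_natCast, one_div]
    gcongr
  have hlogN : Real.log N ≤ L := by
    exact Real.log_le_log (by exact_mod_cast hN1) (hNle.trans hsTT)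
  have hlogX : Real.log X ≤ 16 * L := by
    rw [hX, Nat.cast_pow, Real.log_pow]
    have h1 : Real.log (⌈T⌉₊ : ℝ) ≤ 2 * L := by
      have := Real.log_le_log (by linarith) hcT2
      rw [Real.log_pow] at this
      simpa using this
    push_cast
    linarith
  have hlogN0 : 0 ≤ Real.log N := Real.log_natCast_nonneg _
  have hlogX0 : 0 ≤ Real.log X := Real.log_natCast_nonneg _
  have hprodle : ∀ a ∈ Finset.Icc 1 N, ∀ b ∈ Finset.Icc 1 N,
      1 ≤ a * b ∧ ((a * b : ℕ) : ℝ) ≤ T := by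
    intro a ha b hb
    rw [Finset.mem_Icc] at ha hb
    refine ⟨Nat.mul_pos ha.1 hb.1, le_trans ?_ hN2⟩
    rw [sq]; exact_mod_cast Nat.mul_le_mul ha.2 hb.2
  obtain ⟨Zd, hZdc, hZd0, hZd, hZdi⟩ := exists_majorant_pow_four (T := T) (H := 5 * L) hT20
    (by positivity) hHT (s := Finset.Icc 1 N) (X := N) (fun n hn => Finset.mem_Icc.1 hn)
    (σ := 1 / 2) (W := 2 * T) (by positivity) (by
      intro a ha b hb
      obtain ⟨h1, h2⟩ := hprodle a ha b hb
      rw [rpow_neg_sq_nat h1]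
      have : (-(2 * (1 / 2)) : ℝ) = -1 := by norm_num
      rw [this, Real.rpow_neg_one, ← div_eq_mul_inv]
      gcongr
      linarith)
  obtain ⟨Za, hZac, hZa0, hZa, hZai⟩ := exists_majorant_pow_four (T := T) (H := 5 * L) hT20
    (by positivity) hHT (s := Finset.Ioc N X) (X := X)
    (fun n hn => by rw [Finset.mem_Ioc] at hn; omega)
    (σ := 3 / 2) (W := 2 / T) (by positivity) (by
      intro a ha b hb
      rw [Finset.mem_Ioc] at ha hb
      have h1 : 1 ≤ a * b := Nat.mul_pos (by omega) (by omega)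
      rw [rpow_neg_sq_nat h1]
      have h2 : T ≤ (a * b : ℕ) := by
        have h3 : (N + 1) * (N + 1) ≤ a * b := Nat.mul_le_mul ha.1 hb.1
        have h4 : ((N:ℝ) + 1) * (N + 1) ≤ (a * b : ℕ) := by exact_mod_cast h3
        linarith [mul_self_le_mul_self (Real.sqrt_nonneg T) hNlt.le]
      set m := a * b
      have hm : (0:ℝ) < m := by exact_mod_cast h1
      have : (-(2 * (3 / 2)) : ℝ) = -((3:ℕ):ℝ) := by norm_num
      rw [this, Real.rpow_neg hm.le, Real.rpow_natCast, ← div_eq_mul_inv, div_div,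
        div_le_div_iff₀ (by positivity) (by positivity)]
      calc (T + m) * (T * m) ≤ (m + m) * (m * m) := by gcongr
        _ = 2 * (m:ℝ) ^ 3 := by ring)
  obtain ⟨Zb, hZbc, hZb0, hZb, hZbi⟩ := exists_majorant_pow_four (T := T) (H := 5 * L) hT20
    (by positivity) hHT (s := Finset.Icc 1 N) (X := N) (fun n hn => Finset.mem_Icc.1 hn)
    (σ := -1 / 2) (W := 2 * T ^ 3) (by positivity) (by
      intro a ha b hb
      obtain ⟨h1, h2⟩ := hprodle a ha b hb
      rw [rpow_neg_sq_nat h1]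
      set m := a * b
      have hm : (0:ℝ) < m := by exact_mod_cast h1
      have : (-(2 * (-1 / 2)) : ℝ) = 1 := by norm_num
      rw [this, Real.rpow_one, le_div_iff₀ hm]
      calc (T + m) * m * m ≤ (T + T) * T * T := by gcongr
        _ = _ := by ring)
  have hcoef : ∀ W Y : ℝ, 0 ≤ W → 0 ≤ Y → Y ≤ 16 * L →
      1600 * (2 * (5 * L) + 1) * W * (1 + 2 * Y) ^ 6 ≤ c0 * L ^ 7 * W := by
    intro W Y hW hY hYL
    calc _ ≤ 1600 * (11 * L) * W * (33 * L) ^ 6 := by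
          gcongr <;> linarith
      _ = _ := by rw [hc0]; ring
  have hZdi' := hZdi.trans (hcoef _ _ (by positivity) hlogN0 (by linarith))
  have hZai' := hZai.trans (hcoef _ _ (by positivity) hlogX0 hlogX)
  have hZbi' := hZbi.trans (hcoef _ _ (by positivity) hlogN0 (by linarith))
  refine ⟨fun t => C ^ 4 * 8 * (Zd t + 64 * T ^ 2 * ((1 / T ^ 2) ^ 4 + Za t +
    (L ^ 3 / T) ^ 4 * Zb t)), by fun_prop, fun t => ?_, fun t u ht1 ht2 hu => ?_, ?_⟩
  · have := hZd0 t; have := hZa0 t; have := hZb0 t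
    positivity
  · have h0 := abs_le.1 hu
    have hLL : 10 * L ≤ T / L ^ 3 := by
      rw [le_div_iff₀ (by positivity)]; linarith [pow_pos hLp 4]
    have e2 : T / (2 * L ^ 3) = T / L ^ 3 / 2 := by rw [div_div, mul_comm]
    have hTL3 : 100 * L ≤ T / L ^ 3 := by
      rw [le_div_iff₀ (by positivity)]; linarith [pow_pos hLp 4]
    have h := hmain T u (Real.sqrt (Real.sqrt (Zd t))) (Real.sqrt (Real.sqrt (Za t)))
      (Real.sqrt (Real.sqrt (Zb t))) N X hT20 hBL' (by rw [e2]; linarith) (by linarith)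
      (by rw [e2]; linarith) hN1 hNX hN2 hXT
      (le_sqrt_sqrt (norm_nonneg _) (hZd t u (hu.trans (by linarith))))
      (fun v hv => le_sqrt_sqrt (norm_nonneg _) (hZa t v (by
        calc |v - t| = |(v - u) + (u - t)| := by ring_nf
          _ ≤ |v - u| + |u - t| := abs_add_le _ _
          _ ≤ 5 * L := by linarith)))
      (fun v hv => le_sqrt_sqrt (norm_nonneg _) (hZb t v (by
        calc |v - t| = |(v - u) + (u - t)| := by ring_nf
          _ ≤ |v - u| + |u - t| := abs_add_le _ _
          _ ≤ 5 * L := by linarith)))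
    have h4 := pow_le_pow_left₀ (norm_nonneg _) h 4
    refine h4.trans ((approx_pow_four_le (by linarith) (Real.sqrt_nonneg _) (by positivity)
      (Real.sqrt_nonneg _) (Real.sqrt_nonneg _) hTp.le (by positivity)).trans (le_of_eq ?_))
    rw [sqrt_sqrt_pow_four (hZd0 t), sqrt_sqrt_pow_four (hZa0 t), sqrt_sqrt_pow_four (hZb0 t)]
  · have i1 : IntervalIntegrable Zd volume 0 T := hZdc.intervalIntegrable _ _
    have i2 : IntervalIntegrable Za volume 0 T := hZac.intervalIntegrable _ _
    have i3 : IntervalIntegrable (fun t => (L ^ 3 / T) ^ 4 * Zb t) volume 0 T :=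
      (hZbc.intervalIntegrable _ _).const_mul _
    have i4 : IntervalIntegrable (fun _ : ℝ => (1 / T ^ 2) ^ 4) volume 0 T :=
      intervalIntegrable_const
    rw [intervalIntegral.integral_const_mul,
      intervalIntegral.integral_add i1 (((i4.add i2).add i3).const_mul _),
      intervalIntegral.integral_const_mul, intervalIntegral.integral_add (i4.add i2) i3,
      intervalIntegral.integral_add i4 i2, intervalIntegral.integral_const_mul,
      intervalIntegral.integral_const, smul_eq_mul, sub_zero]
    have hL7 : L ^ 7 ≤ L ^ 19 := pow_le_pow_right₀ hL1 (by norm_num)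
    have hL19 : 1 ≤ L ^ 19 := one_le_pow₀ hL1
    have hc0p : 0 < c0 := by norm_num [hc0]
    calc _ ≤ C ^ 4 * 8 * (c0 * L ^ 7 * (2 * T) + 64 * T ^ 2 * (T * (1 / T ^ 2) ^ 4 +
          c0 * L ^ 7 * (2 / T) + (L ^ 3 / T) ^ 4 * (c0 * L ^ 7 * (2 * T ^ 3)))) := by gcongr
      _ = C ^ 4 * 8 * (c0 * L ^ 7 * 2 + 64 * (1 / T ^ 6 +
          c0 * L ^ 7 * 2 + c0 * L ^ 19 * 2)) * T := by field_simp
      _ ≤ C ^ 4 * 8 * (c0 * L ^ 19 * 2 + 64 * (L ^ 19 +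
          c0 * L ^ 19 * 2 + c0 * L ^ 19 * 2)) * T := by
          have : 1 / T ^ 6 ≤ L ^ 19 := by
            refine le_trans ?_ hL19
            rw [div_le_one (by positivity)]
            exact one_le_pow₀ (by linarith)
          gcongr
      _ = K * L ^ 19 * T := by rw [hK]; ring
      _ ≤ L * L ^ 19 * T := by gcongr
      _ = _ := by ring

/-- The `k`-th power of a sum over primes is a sum over integers with exactly `k` prime factors,
with multiplicities at most `k!`. -/
lemma exists_coeff_sum_prime_pow (s : Finset ℕ) (Y : ℕ) (hs : ∀ p ∈ s, p.Prime ∧ p ≤ Y) (k : ℕ) :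
    ∃ a : ℕ → ℕ, (∀ n, a n ≤ Nat.factorial k) ∧
      (∀ n, a n ≠ 0 → n ≠ 0 ∧ n ≤ Y ^ k ∧ ArithmeticFunction.cardFactors n = k) ∧
      ∀ f : ℕ → ℂ, f 1 = 1 → (∀ m n, f (m * n) = f m * f n) →
        (∑ p ∈ s, f p) ^ k = ∑ n ∈ Finset.Icc 1 (Y ^ k), (a n : ℂ) * f n := by
  induction k with
  | zero =>
    refine ⟨fun n => if n = 1 then 1 else 0, fun n => ?_, fun n hn => ?_, fun f hf _ => ?_⟩
    · dsimp only
      split_ifs <;> simp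
    · have : n = 1 := by by_contra h; simp [h] at hn
      subst this; simp
    · simp [hf]
  | succ k ih =>
    obtain ⟨a, ha1, ha2, ha3⟩ := ih
    have hsupp : ∀ n p, p ∈ s → p ∣ n → a (n / p) ≠ 0 →
        n ≠ 0 ∧ n ≤ Y ^ (k + 1) ∧ ArithmeticFunction.cardFactors n = k + 1 := by
      rintro n p hp ⟨m, rfl⟩ hne
      have hpp := (hs p hp).1
      rw [Nat.mul_div_cancel_left _ hpp.pos] at hne
      obtain ⟨h1, h2, h3⟩ := ha2 m hne
      refine ⟨mul_ne_zero hpp.ne_zero h1, ?_, ?_⟩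
      · rw [pow_succ, mul_comm]; exact Nat.mul_le_mul h2 (hs p hp).2
      · rw [ArithmeticFunction.cardFactors_mul hpp.ne_zero h1,
          ArithmeticFunction.cardFactors_apply_prime hpp, h3, add_comm]
    refine ⟨fun n => ∑ p ∈ s with p ∣ n, a (n / p), fun n => ?_, fun n hn => ?_,
      fun f hf hm => ?_⟩
    · dsimp only
      by_cases hz : ∃ p ∈ s, p ∣ n ∧ a (n / p) ≠ 0
      · obtain ⟨p, hp, hpn, hne⟩ := hz
        obtain ⟨h1, h2, h3⟩ := hsupp n p hp hpn hne
        have hsub : {p ∈ s | p ∣ n} ⊆ n.primeFactors := by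
          intro q hq
          rw [Finset.mem_filter] at hq
          exact Nat.mem_primeFactors.2 ⟨(hs q hq.1).1, hq.2, h1⟩
        have hcard : n.primeFactors.card ≤ k + 1 := by
          rw [← h3, ArithmeticFunction.cardFactors_apply]
          exact List.toFinset_card_le _
        calc _ ≤ ∑ p ∈ s with p ∣ n, Nat.factorial k := Finset.sum_le_sum fun p _ => ha1 _
          _ = {p ∈ s | p ∣ n}.card * Nat.factorial k := by rw [Finset.sum_const, smul_eq_mul]
          _ ≤ (k + 1) * Nat.factorial k :=
            Nat.mul_le_mul_right _ ((Finset.card_le_card hsub).trans hcard)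
          _ = _ := (Nat.factorial_succ k).symm
      · push Not at hz
        rw [Finset.sum_eq_zero]
        · exact Nat.zero_le _
        · intro p hp
          rw [Finset.mem_filter] at hp
          exact hz p hp.1 hp.2
    · obtain ⟨p, hp, hne⟩ := Finset.exists_ne_zero_of_sum_ne_zero hn
      rw [Finset.mem_filter] at hp
      exact hsupp n p hp.1 hp.2 hne
    · rw [pow_succ, ha3 f hf hm, Finset.mul_sum]
      have : ∀ n ∈ Finset.Icc 1 (Y ^ (k + 1)),
          ((∑ p ∈ s with p ∣ n, a (n / p) : ℕ) : ℂ) * f n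
          = ∑ p ∈ s, if p ∣ n then (a (n / p) : ℂ) * f n else 0 := by
        intro n _
        rw [Nat.cast_sum, Finset.sum_mul, Finset.sum_filter]
      rw [Finset.sum_congr rfl this, Finset.sum_comm]
      refine Finset.sum_congr rfl fun p hp => ?_
      have hpp := (hs p hp).1
      rw [Finset.sum_mul]
      refine Finset.sum_of_injOn (fun m => p * m) ?_ ?_ ?_ ?_
      · intro x _ y _ hxy
        exact Nat.eq_of_mul_eq_mul_left hpp.pos hxy
      · intro m hm'
        simp only [Finset.coe_Icc, Set.mem_Icc] at hm' ⊢
        refine ⟨Nat.mul_pos hpp.pos hm'.1, ?_⟩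
        rw [pow_succ, mul_comm]; exact Nat.mul_le_mul hm'.2 (hs p hp).2
      · intro n hn hni
        split_ifs with hpn
        · obtain ⟨m, rfl⟩ := hpn
          rw [Nat.mul_div_cancel_left _ hpp.pos]
          by_cases h0 : a m = 0
          · simp [h0]
          · obtain ⟨h1, h2, h3⟩ := ha2 m h0
            exact absurd ⟨m, by simp only [Finset.coe_Icc, Set.mem_Icc]; omega, rfl⟩ hni
        · rfl
      · intro m _
        rw [if_pos (Dvd.intro _ rfl), Nat.mul_div_cancel_left _ hpp.pos, hm]
        ring

lemma exists_sum_prime_inv_le : ∃ T₁ : ℝ, 20 ≤ T₁ ∧ ∀ T, T₁ ≤ T → ∀ N : ℕ, (N : ℝ) ≤ T →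
    ∑ p ∈ (N + 1).primesBelow, 1 / (p : ℝ) ≤ 6 * Real.log (Real.log T) := by
  have h1 : ∀ᶠ s : ℝ in nhdsWithin 1 (Ioi 1), (s - 1) * ∑' n : ℕ, 1 / (n : ℝ) ^ s < 2 :=
    tendsto_sub_mul_tsum_nat_rpow.eventually_lt_const (by norm_num)
  have h2 : Tendsto (fun T : ℝ => 1 + 1 / Real.log T) atTop (nhdsWithin 1 (Ioi 1)) := by
    refine tendsto_nhdsWithin_iff.2 ⟨?_, ?_⟩
    · have := (tendsto_const_nhds (x := (1:ℝ)).div_atTop Real.tendsto_log_atTop).const_add 1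
      simpa using this
    · filter_upwards [eventually_gt_atTop (1:ℝ)] with T hT
      have := Real.log_pos hT
      simp [this]
  obtain ⟨T₀, hT₀⟩ := (h2.eventually h1).exists_forall_of_atTop
  obtain ⟨T₂, h20, hT₂⟩ := exists_log_large 2 1
  refine ⟨max T₀ T₂, h20.trans (le_max_right _ _), fun T hT N hN => ?_⟩
  have hlog := (hT₂ T ((le_max_right _ _).trans hT)).1
  have h := hT₀ T ((le_max_left _ _).trans hT)
  have hTp : 20 ≤ T := h20.trans ((le_max_right _ _).trans hT)
  set L := Real.log T with hL
  have hLp : 0 < L := by linarith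
  rw [add_sub_cancel_left, div_mul_eq_mul_div, div_lt_iff₀ hLp, one_mul] at h
  set η := 1 / L with hη
  have hηp : 0 < η := by positivity
  have hsum : Summable fun n : ℕ => 1 / (n : ℝ) ^ (1 + η) :=
    Real.summable_one_div_nat_rpow.2 (by linarith)
  let f : ℕ →* ℝ :=
    { toFun := fun n => 1 / (n : ℝ) ^ (1 + η)
      map_one' := by simp
      map_mul' := fun m n => by
        rw [Nat.cast_mul, Real.mul_rpow (Nat.cast_nonneg _) (Nat.cast_nonneg _), one_div_mul_one_div] }
  have hfp : ∀ p ∈ (N + 1).primesBelow, 0 < f p ∧ f p < 1 := by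
    intro p hp
    have hpp := (Nat.prime_of_mem_primesBelow hp)
    have h1p : (1:ℝ) < (p : ℝ) ^ (1 + η) :=
      Real.one_lt_rpow (by exact_mod_cast hpp.one_lt) (by linarith)
    refine ⟨?_, ?_⟩
    · change 0 < 1 / (p : ℝ) ^ (1 + η); positivity
    · change 1 / (p : ℝ) ^ (1 + η) < 1
      rw [div_lt_one (by linarith)]; exact h1p
  have hE := EulerProduct.prod_primesBelow_geometric_eq_tsum_smoothNumbers (f := f) hsum (N + 1)
  have hle : ∏ p ∈ (N + 1).primesBelow, (1 - f p)⁻¹ ≤ 2 * L := by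
    rw [hE]
    refine le_trans ?_ h.le
    exact hsum.tsum_subtype_le (fun n : ℕ => 1 / (n : ℝ) ^ (1 + η)) _
      (fun n => by positivity)
  have hlogle : ∑ p ∈ (N + 1).primesBelow, f p ≤ Real.log (2 * L) := by
    refine le_trans ?_ (Real.log_le_log (Finset.prod_pos fun p hp =>
      inv_pos.2 (by linarith [(hfp p hp).2])) hle)
    rw [Real.log_prod fun p hp => (inv_pos.2 (by linarith [(hfp p hp).2])).ne']
    refine Finset.sum_le_sum fun p hp => ?_
    rw [Real.log_inv]
    have := Real.log_le_sub_one_of_pos (x := 1 - f p) (by linarith [(hfp p hp).2])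
    linarith
  have hterm : ∀ p ∈ (N + 1).primesBelow, 1 / (p : ℝ) ≤ Real.exp 1 * f p := by
    intro p hp
    have hpp := (Nat.prime_of_mem_primesBelow hp)
    have hpN : (p : ℝ) ≤ T := le_trans (by
      exact_mod_cast Nat.lt_succ_iff.1 (Nat.lt_of_mem_primesBelow hp)) hN
    have hp0 : (0:ℝ) < p := by exact_mod_cast hpp.pos
    change 1 / (p : ℝ) ≤ Real.exp 1 * (1 / (p : ℝ) ^ (1 + η))
    have : (p : ℝ) ^ η ≤ Real.exp 1 := by
      rw [Real.rpow_def_of_pos hp0, Real.exp_le_exp, hη, mul_one_div, div_le_one hLp]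
      exact Real.log_le_log hp0 hpN
    rw [Real.rpow_add hp0, Real.rpow_one, mul_one_div, div_le_div_iff₀ hp0 (by positivity)]
    nlinarith
  have hl2 : Real.log 2 ≤ Real.log L := Real.log_le_log (by norm_num) hlog
  have hl0 : 0 < Real.log 2 := Real.log_pos (by norm_num)
  calc _ ≤ ∑ p ∈ (N + 1).primesBelow, Real.exp 1 * f p := Finset.sum_le_sum hterm
    _ = Real.exp 1 * ∑ p ∈ (N + 1).primesBelow, f p := by rw [Finset.mul_sum]
    _ ≤ 3 * Real.log (2 * L) := by
        have := Real.exp_one_lt_d9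
        have h0 : 0 ≤ ∑ p ∈ (N + 1).primesBelow, f p := Finset.sum_nonneg fun p hp => (hfp p hp).1.le
        exact mul_le_mul (by linarith) hlogle h0 (by norm_num)
    _ ≤ _ := by rw [Real.log_mul (by norm_num) hLp.ne']; linarith

/-- The partial sum of the Dirichlet series of `1/ζ`. -/
def moebiusSum (N : ℕ) (s : ℂ) : ℂ :=
  ∑ n ∈ Finset.Icc 1 N, (ArithmeticFunction.moebius n : ℂ) * (n : ℂ) ^ (-s)

/-- The sum of `p ^ (-s)` over the primes up to `N`. -/
def primeSum (N : ℕ) (s : ℂ) : ℂ := ∑ p ∈ (N + 1).primesBelow, (p : ℂ) ^ (-s)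

lemma exists_moebiusSum_majorant : ∃ T₁ : ℝ, 20 ≤ T₁ ∧ ∀ T, T₁ ≤ T → ∀ N : ℕ, (N : ℝ) ≤ T →
    ∃ Z : ℝ → ℝ, Continuous Z ∧ (∀ t, 0 ≤ Z t) ∧
      (∀ t u : ℝ, |u - t| ≤ 5 * Real.log T → ‖moebiusSum N (1 / 2 + u * I)‖ ^ 2 ≤ Z t) ∧
      ∫ t in (0:ℝ)..T, Z t ≤ T * Real.log T ^ 5 := by
  obtain ⟨T₁, h20, hT₁⟩ := exists_log_large 300000 1
  refine ⟨T₁, h20, fun T hT N hN => ?_⟩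
  obtain ⟨hL, hLT⟩ := hT₁ T hT
  have hT20 := h20.trans hT
  set L := Real.log T with hLdef
  rw [pow_one] at hLT
  obtain ⟨Z, hZc, hZ0, hZ, hZi⟩ := exists_majorant (T := T) (H := 5 * L) (X := T) hT20
    (by linarith) (by linarith) (Finset.Icc 1 N)
    (fun m hm => ⟨(Finset.mem_Icc.1 hm).1,
      le_trans (by exact_mod_cast (Finset.mem_Icc.1 hm).2) hN⟩)
    (fun n => (ArithmeticFunction.moebius n : ℂ) * (((n : ℝ) ^ (-(1 / 2) : ℝ) : ℝ) : ℂ))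
  refine ⟨Z, hZc, hZ0, fun t u hu => ?_, hZi.trans ?_⟩
  · refine le_trans (le_of_eq ?_) (hZ t u hu)
    congr 2
    refine Finset.sum_congr rfl fun n hn => ?_
    have hn0 : (0:ℝ) < n := by exact_mod_cast (Finset.mem_Icc.1 hn).1
    have := ofReal_cpow_neg_add_mul_I hn0 (1 / 2) u
    push_cast at this
    rw [this]
    push_cast
    ring
  · have hsum : ∑ n ∈ Finset.Icc 1 N, (T + n) *
        ‖(ArithmeticFunction.moebius n : ℂ) * (((n : ℝ) ^ (-(1 / 2) : ℝ) : ℝ) : ℂ)‖ ^ 2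
        ≤ 2 * T * (1 + L) := by
      calc _ ≤ ∑ n ∈ Finset.Icc 1 N, 2 * T * (1 / (n : ℝ)) := by
            refine Finset.sum_le_sum fun n hn => ?_
            obtain ⟨h1, h2⟩ := Finset.mem_Icc.1 hn
            have hnN : (n : ℝ) ≤ T := le_trans (by exact_mod_cast h2) hN
            have hm : ‖(ArithmeticFunction.moebius n : ℂ)‖ ≤ 1 := by
              rw [Complex.norm_intCast]
              exact_mod_cast ArithmeticFunction.abs_moebius_le_one
            have e := rpow_neg_sq_nat h1 (1 / 2)
            rw [norm_mul, mul_pow, Complex.norm_real, Real.norm_of_nonneg (by positivity), e,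
              mul_one_div_cancel (by norm_num), Real.rpow_neg_one, ← one_div]
            have hm2 : ‖(ArithmeticFunction.moebius n : ℂ)‖ ^ 2 ≤ 1 :=
              pow_le_one₀ (norm_nonneg _) hm
            have h0 : (0:ℝ) ≤ 1 / n := by positivity
            calc _ ≤ (T + T) * (1 * (1 / (n : ℝ))) := by gcongr
              _ = _ := by ring
        _ = 2 * T * ∑ n ∈ Finset.Icc 1 N, 1 / (n : ℝ) := by rw [Finset.mul_sum]
        _ ≤ 2 * T * (1 + L) := by
            gcongr
            refine (sum_Icc_one_div_le N).trans ?_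
            rcases Nat.eq_zero_or_pos N with h | h
            · subst h; simp; linarith
            · have : Real.log N ≤ L := Real.log_le_log (by exact_mod_cast h) hN
              linarith
    have hLp : 0 < L := by linarith
    calc _ ≤ 1600 * (2 * (5 * L) + 1) * (1 + L) ^ 2 * (2 * T * (1 + L)) := by gcongr
      _ ≤ 1600 * (2 * (5 * L) + L) * (L + L) ^ 2 * (2 * T * (L + L)) := by
          gcongr <;> linarith
      _ = 281600 * (T * L ^ 4) := by ring
      _ ≤ L * (T * L ^ 4) := by gcongr; linarith
      _ = _ := by ring

lemma exists_primeSum_majorant : ∃ T₁ : ℝ, 20 ≤ T₁ ∧ ∀ T, T₁ ≤ T → ∀ k N : ℕ, 1 ≤ k →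
    (N : ℝ) ^ k ≤ T → ∃ Z : ℝ → ℝ, Continuous Z ∧ (∀ t, 0 ≤ Z t) ∧
      (∀ t u : ℝ, |u - t| ≤ 5 * Real.log T → ‖primeSum N (1 / 2 + u * I)‖ ^ (2 * k) ≤
        (6 * k * Real.log (Real.log T)) ^ k * Z t) ∧
      ∫ t in (0:ℝ)..T, Z t ≤ T * Real.log T ^ 4 := by
  obtain ⟨T₁, h20, hT₁⟩ := exists_log_large 300000 1
  obtain ⟨T₂, h20', hT₂⟩ := exists_sum_prime_inv_le
  refine ⟨max T₁ T₂, h20.trans (le_max_left _ _), fun T hT k N hk hN => ?_⟩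
  obtain ⟨hL, hLT⟩ := hT₁ T ((le_max_left _ _).trans hT)
  have hT20 := h20.trans ((le_max_left _ _).trans hT)
  have hNT : (N : ℝ) ≤ T := by
    rcases Nat.eq_zero_or_pos N with h | h
    · subst h; simp; linarith
    · exact le_trans (le_self_pow₀ (by exact_mod_cast h) (by omega)) hN
  have hV := hT₂ T ((le_max_right _ _).trans hT) N hNT
  set L := Real.log T with hLdef
  rw [pow_one] at hLT
  have hLp : 0 < L := by linarith
  set l := Real.log L with hl
  have hlp : 0 < l := Real.log_pos (by linarith)
  obtain ⟨a, ha1, ha2, ha3⟩ := exists_coeff_sum_prime_pow (N + 1).primesBelow N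
    (fun p hp => ⟨Nat.prime_of_mem_primesBelow hp,
      Nat.lt_succ_iff.1 (Nat.lt_of_mem_primesBelow hp)⟩) k
  have hle : ∀ m ∈ Finset.Icc 1 (N ^ k), (m : ℝ) ≤ T := fun m hm =>
    le_trans (by exact_mod_cast (Finset.mem_Icc.1 hm).2) hN
  obtain ⟨Z, hZc, hZ0, hZ, hZi⟩ := exists_majorant (T := T) (H := 5 * L) (X := T) hT20
    (by linarith) (by linarith) (Finset.Icc 1 (N ^ k))
    (fun m hm => ⟨(Finset.mem_Icc.1 hm).1, hle m hm⟩)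
    (fun n => (a n : ℂ) * (((n : ℝ) ^ (-(1 / 2) : ℝ) : ℝ) : ℂ))
  have hkp : (0:ℝ) < k := by exact_mod_cast hk
  have hW : 0 < (6 * k * l) ^ k := by positivity
  refine ⟨fun t => ((6 * k * l) ^ k)⁻¹ * Z t, by fun_prop, fun t => ?_, fun t u hu => ?_, ?_⟩
  · have := hZ0 t; positivity
  · rw [mul_inv_cancel_left₀ hW.ne']
    refine le_trans (le_of_eq ?_) (hZ t u hu)
    rw [mul_comm 2 k, pow_mul, ← norm_pow, primeSum,
      ha3 (fun n => (n : ℂ) ^ (-(1 / 2 + u * I : ℂ))) (by simp)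
        (fun m n => by rw [Nat.cast_mul, Complex.natCast_mul_natCast_cpow])]
    congr 2
    refine Finset.sum_congr rfl fun n hn => ?_
    have hn0 : (0:ℝ) < n := by exact_mod_cast (Finset.mem_Icc.1 hn).1
    have := ofReal_cpow_neg_add_mul_I hn0 (1 / 2) u
    push_cast at this
    rw [this]
    push_cast
    ring
  · have hsa : ∑ n ∈ Finset.Icc 1 (N ^ k), (a n : ℝ) * (1 / (n : ℝ)) ≤ (6 * l) ^ k := by
      have h := ha3 (fun n => ((1 / (n : ℝ) : ℝ) : ℂ)) (by simp) (fun m n => by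
        push_cast; rw [one_div_mul_one_div])
      have h' : (∑ p ∈ (N + 1).primesBelow, 1 / (p : ℝ)) ^ k
          = ∑ n ∈ Finset.Icc 1 (N ^ k), (a n : ℝ) * (1 / (n : ℝ)) := by
        exact_mod_cast h
      rw [← h']
      exact pow_le_pow_left₀ (Finset.sum_nonneg fun _ _ => by positivity) hV k
    have hsum : ∑ n ∈ Finset.Icc 1 (N ^ k), (T + n) *
        ‖(a n : ℂ) * (((n : ℝ) ^ (-(1 / 2) : ℝ) : ℝ) : ℂ)‖ ^ 2 ≤ 2 * T * (6 * k * l) ^ k := by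
      calc _ ≤ ∑ n ∈ Finset.Icc 1 (N ^ k), 2 * T * (k ^ k * ((a n : ℝ) * (1 / (n : ℝ)))) := by
            refine Finset.sum_le_sum fun n hn => ?_
            obtain ⟨h1, h2⟩ := Finset.mem_Icc.1 hn
            have hnN := hle n hn
            have e := rpow_neg_sq_nat h1 (1 / 2)
            rw [norm_mul, mul_pow, Complex.norm_real, Real.norm_of_nonneg (by positivity), e,
              mul_one_div_cancel (by norm_num), Real.rpow_neg_one, ← one_div, Complex.norm_natCast]
            have hm : (a n : ℝ) ≤ (k : ℝ) ^ k := by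
              exact_mod_cast (ha1 n).trans (Nat.factorial_le_pow k)
            have h0 : (0:ℝ) ≤ 1 / n := by positivity
            calc (T + n) * ((a n : ℝ) ^ 2 * (1 / (n : ℝ)))
                = (T + n) * ((a n : ℝ) * ((a n : ℝ) * (1 / (n : ℝ)))) := by ring
              _ ≤ (T + T) * ((k : ℝ) ^ k * ((a n : ℝ) * (1 / (n : ℝ)))) := by gcongr
              _ = _ := by ring
        _ = 2 * T * (k ^ k * ∑ n ∈ Finset.Icc 1 (N ^ k), (a n : ℝ) * (1 / (n : ℝ))) := by
            rw [Finset.mul_sum, Finset.mul_sum]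
        _ ≤ 2 * T * (k ^ k * (6 * l) ^ k) := by gcongr
        _ = _ := by rw [← mul_pow]; ring_nf
    rw [intervalIntegral.integral_const_mul]
    calc _ ≤ ((6 * k * l) ^ k)⁻¹ * (1600 * (2 * (5 * L) + 1) * (1 + L) ^ 2 *
          (2 * T * (6 * k * l) ^ k)) := by
          gcongr
          exact hZi.trans (by gcongr)
      _ = 1600 * (2 * (5 * L) + 1) * (1 + L) ^ 2 * (2 * T) := by
          field_simp
      _ ≤ 1600 * (2 * (5 * L) + L) * (L + L) ^ 2 * (2 * T) := by
          gcongr <;> linarith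
      _ = 140800 * (T * L ^ 3) := by ring
      _ ≤ L * (T * L ^ 3) := by gcongr; linarith
      _ = _ := by ring

open scoped ComplexConjugate

lemma card_zeros_mul_log_le {f : ℂ → ℂ} {c : ℂ} {r R m : ℝ} (hr : 0 < r) (hrR : r < R)
    (hm : 0 ≤ m) (hf : AnalyticOnNhd ℂ f (Metric.closedBall c R)) (hc : f c ≠ 0)
    (hb : ∀ z ∈ Metric.sphere c R, ‖f z‖ ≤ Real.exp m * ‖f c‖) (W : Finset ℂ)
    (hW : ∀ w ∈ W, w ∈ Metric.closedBall c r ∧ f w = 0) :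
    (W.card : ℝ) * Real.log (R / r) ≤ m := by
  have hR : 0 < R := hr.trans hrR
  have hfr : AnalyticOnNhd ℂ f (Metric.closedBall c r) :=
    hf.mono (Metric.closedBall_subset_closedBall hrR.le)
  have hlog : 0 < Real.log (R / r) := Real.log_pos (by rwa [one_lt_div hr])
  set g : ℂ → ℂ := fun z => f z / f c with hg
  have hga : AnalyticOnNhd ℂ g (Metric.closedBall c R) := fun z hz => (hf z hz).div_const
  have hgr : AnalyticOnNhd ℂ g (Metric.closedBall c r) := fun z hz => (hfr z hz).div_const
  have hgc : g c = 1 := div_self hc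
  have hJ := AnalyticOnNhd.sum_divisor_le (f := g) (c := c) (r := r) (R := R) (M := Real.exp m)
    (by rwa [abs_of_pos hr]) (by rwa [abs_of_pos hr, abs_of_pos hR]) (Real.one_le_exp hm)
    (by rwa [abs_of_pos hR]) (by rw [hgc]; exact one_ne_zero) (by
      intro z hz
      rw [abs_of_pos hR] at hz
      rw [hg]
      dsimp only
      rw [norm_div, div_le_iff₀ (norm_pos_iff.2 hc)]
      exact hb z hz)
  rw [hgc, norm_one, div_one, Real.log_exp, abs_of_pos hr, le_div_iff₀ hlog] at hJ
  refine le_trans ?_ hJ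
  gcongr
  have hfin : (Function.support (MeromorphicOn.divisor g (Metric.closedBall c r))).Finite :=
    (MeromorphicOn.divisor g (Metric.closedBall c r)).finiteSupport (isCompact_closedBall ..)
  have hge : ∀ w ∈ W, 1 ≤ MeromorphicOn.divisor g (Metric.closedBall c r) w := by
    intro w hw
    obtain ⟨hwb, hw0⟩ := hW w hw
    rw [MeromorphicOn.AnalyticOnNhd.divisor_apply hgr hwb]
    have h0 : analyticOrderAt g w ≠ 0 := by
      rw [(hgr w hwb).analyticOrderAt_ne_zero]
      simp [hg, hw0]
    have htop : analyticOrderAt g w ≠ ⊤ := by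
      intro h
      rw [analyticOrderAt_eq_top] at h
      have := hgr.eqOn_zero_of_preconnected_of_eventuallyEq_zero
        (convex_closedBall c r).isPreconnected hwb h (Metric.mem_closedBall_self hr.le)
      rw [hgc] at this
      exact one_ne_zero this
    obtain ⟨n, hn⟩ := ENat.ne_top_iff_exists.1 htop
    rw [← hn] at h0 ⊢
    have : n ≠ 0 := by rintro rfl; simp at h0
    simp
    omega
  have hnn : ∀ w, 0 ≤ MeromorphicOn.divisor g (Metric.closedBall c r) w := fun w =>
    MeromorphicOn.AnalyticOnNhd.divisor_nonneg hgr w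
  rw [finsum_eq_sum_of_support_subset (s := hfin.toFinset ∪ W) _ (by
    intro w hw; simp only [Finset.coe_union, Set.Finite.coe_toFinset]; exact Or.inl hw)]
  have : ((W.card : ℤ)) ≤ ∑ w ∈ hfin.toFinset ∪ W,
      MeromorphicOn.divisor g (Metric.closedBall c r) w := by
    calc (W.card : ℤ) = ∑ w ∈ W, 1 := by simp
      _ ≤ ∑ w ∈ W, MeromorphicOn.divisor g (Metric.closedBall c r) w := Finset.sum_le_sum hge
      _ ≤ _ := Finset.sum_le_sum_of_subset_of_nonneg Finset.subset_union_right
          fun w _ _ => hnn w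
  exact_mod_cast this

/-- A continuous real function that moves by at least `n * π` meets the zeros of the cosine at `n`
distinct points. -/
lemma exists_finset_cos_eq_zero {φ : ℝ → ℝ} {x y : ℝ} (hxy : x ≤ y)
    (hφ : ContinuousOn φ (Icc x y)) (n : ℕ) (h : n * π ≤ |φ y - φ x|) :
    ∃ W : Finset ℝ, W.card = n ∧ ∀ w ∈ W, w ∈ Icc x y ∧ Real.cos (φ w) = 0 := by
  have hkey : ∀ v ∈ uIcc (φ x) (φ y), ∃ w ∈ Icc x y, φ w = v := by
    intro v hv
    have := intermediate_value_uIcc (by rwa [uIcc_of_le hxy]) hv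
    rwa [uIcc_of_le hxy] at this
  set lo := min (φ x) (φ y) with hlo
  have hlen : max (φ x) (φ y) = lo + |φ y - φ x| := by
    rw [hlo, ← max_sub_min_eq_abs']; rw [min_comm, max_comm]; ring
  set j0 : ℤ := ⌈lo / π - 1 / 2⌉ with hj0
  have hpi := Real.pi_pos
  have hj1 : lo ≤ (j0 + 1 / 2) * π := by
    have := Int.le_ceil (lo / π - 1 / 2)
    rw [← hj0] at this
    have h' : lo / π ≤ j0 + 1 / 2 := by linarith
    rwa [div_le_iff₀ hpi] at h'
  have hj2 : (j0 - 1 / 2) * π < lo := by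
    have := Int.ceil_lt_add_one (lo / π - 1 / 2)
    rw [← hj0] at this
    have h' : j0 - 1 / 2 < lo / π := by linarith
    rwa [lt_div_iff₀ hpi] at h'
  have hex : ∀ i : Fin n, ∃ w ∈ Icc x y, φ w = (j0 + 1 / 2 + i) * π := by
    intro i
    refine hkey _ ?_
    rw [uIcc, Set.mem_Icc]
    have hi : ((i : ℕ) : ℝ) + 1 ≤ n := by exact_mod_cast i.2
    have hi0 : (0:ℝ) ≤ (i : ℕ) := Nat.cast_nonneg _
    refine ⟨?_, ?_⟩
    · change lo ≤ _
      nlinarith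
    · rw [hlen]
      nlinarith
  choose w hw hwφ using hex
  have hinj : Function.Injective w := by
    intro i j hij
    have := (hwφ i).symm.trans ((congrArg φ hij).trans (hwφ j))
    have h2 := mul_right_cancel₀ hpi.ne' this
    have h3 : ((i : ℕ) : ℝ) = (j : ℕ) := by linarith
    exact Fin.ext (by exact_mod_cast h3)
  refine ⟨Finset.univ.map ⟨w, hinj⟩, by simp, fun v hv => ?_⟩
  simp only [Finset.mem_map, Finset.mem_univ, true_and, Function.Embedding.coeFn_mk] at hv
  obtain ⟨i, rfl⟩ := hv
  refine ⟨hw i, ?_⟩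
  rw [Real.cos_eq_zero_iff]
  refine ⟨j0 + i, ?_⟩
  rw [hwφ]
  push_cast
  ring

/-- Backlund's bound for the change of argument along a horizontal segment through the centre of a
disc on which the function is bounded. -/
lemma abs_im_sub_le_of_bound {f : ℂ → ℂ} {c T r m x y : ℝ} {φ : ℝ → ℂ} (hr : 0 < r) (hm : 0 ≤ m)
    (hf : ∀ z : ℂ, ‖z - (c + T * I)‖ < 2 * r → DifferentiableAt ℂ f z)
    (hc : f (c + T * I) ≠ 0)
    (hb : ∀ z : ℂ, ‖z - (c + T * I)‖ ≤ 5 / 4 * r → ‖f z‖ ≤ Real.exp m * ‖f (c + T * I)‖)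
    (hxy : x ≤ y) (hcx : c - r ≤ x) (hcy : y ≤ c + r) (hφ : ContinuousOn φ (Icc x y))
    (hφf : ∀ u ∈ Icc x y, cexp (φ u) = f (u + T * I)) :
    |(φ y).im - (φ x).im| ≤ 20 * (m + 1) := by
  set z₀ : ℂ := c + T * I with hz₀
  set α := arg (f z₀) with hα
  set h : ℂ → ℂ := fun z => cexp (-(α * I)) * f (z₀ + z) with hh
  set g : ℂ → ℂ := fun z => (h z + conj (h (conj z))) / 2 with hg
  have hw : ‖cexp (-(α * I))‖ = 1 := by
    rw [← neg_mul, ← ofReal_neg, Complex.norm_exp_ofReal_mul_I]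
  have hh0 : h 0 = ‖f z₀‖ := by
    rw [hh]
    dsimp only
    rw [add_zero]
    conv_lhs => rw [← Complex.norm_mul_exp_arg_mul_I (f z₀)]
    rw [mul_left_comm, ← Complex.exp_add, neg_add_cancel, Complex.exp_zero, mul_one]
  have hg0 : g 0 = ‖f z₀‖ := by
    rw [hg]
    dsimp only
    rw [map_zero, hh0, conj_ofReal]
    ring
  have hn0 : 0 < ‖f z₀‖ := norm_pos_iff.2 hc
  have hhd : ∀ z : ℂ, ‖z‖ < 2 * r → DifferentiableAt ℂ h z := by
    intro z hz
    have : DifferentiableAt ℂ f (z₀ + z) := hf _ (by rwa [add_sub_cancel_left])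
    exact (this.comp z (differentiableAt_id.const_add z₀)).const_mul _
  have hgd : ∀ z : ℂ, ‖z‖ < 2 * r → DifferentiableAt ℂ g z := by
    intro z hz
    have h2 : DifferentiableAt ℂ (fun z => conj (h (conj z))) z :=
      differentiableAt_conj_conj_iff.2 (hhd _ (by rwa [Complex.norm_conj]))
    exact ((hhd z hz).add h2).div_const 2
  have hhb : ∀ z : ℂ, ‖z‖ ≤ 5 / 4 * r → ‖h z‖ ≤ Real.exp m * ‖f z₀‖ := by
    intro z hz
    rw [hh]
    dsimp only
    rw [norm_mul, hw, one_mul]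
    exact hb _ (by rwa [add_sub_cancel_left])
  have hga : AnalyticOnNhd ℂ g (Metric.closedBall 0 (5 / 4 * r)) := by
    have : DifferentiableOn ℂ g (Metric.ball 0 (2 * r)) := fun z hz =>
      (hgd z (by rwa [mem_ball_zero_iff] at hz)).differentiableWithinAt
    exact (this.analyticOnNhd Metric.isOpen_ball).mono
      (Metric.closedBall_subset_ball (by linarith))
  have hreal : ∀ u ∈ Icc x y, g ((u - c : ℝ) : ℂ)
      = ((Real.exp (φ u).re * Real.cos ((φ u).im - α) : ℝ) : ℂ) := by
    intro u hu
    rw [hg]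
    dsimp only
    rw [conj_ofReal, Complex.add_conj]
    have : h ((u - c : ℝ) : ℂ) = cexp (φ u - α * I) := by
      rw [hh]
      dsimp only
      have e : z₀ + ((u - c : ℝ) : ℂ) = u + T * I := by rw [hz₀]; push_cast; ring
      rw [e, ← hφf u hu, ← Complex.exp_add]
      congr 1; ring
    rw [this, Complex.exp_re]
    simp
  have hφi : ContinuousOn (fun u => (φ u).im - α) (Icc x y) :=
    (Complex.continuous_im.comp_continuousOn hφ).sub continuousOn_const
  set D := |(φ y).im - (φ x).im| with hD
  have hpi := Real.pi_pos
  have hfl : (⌊D / π⌋₊ : ℝ) * π ≤ D := by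
    have := Nat.floor_le (show 0 ≤ D / π by positivity)
    rwa [le_div_iff₀ hpi] at this
  obtain ⟨W, hWc, hW⟩ := exists_finset_cos_eq_zero hxy hφi ⌊D / π⌋₊ (by
    rw [sub_sub_sub_cancel_right]; exact hfl)
  have hinj : Function.Injective (fun u : ℝ => ((u - c : ℝ) : ℂ)) := fun a b hab => by
    have := Complex.ofReal_injective hab
    linarith
  have hJ := card_zeros_mul_log_le (f := g) (c := 0) (r := r) (R := 5 / 4 * r) (m := m) hr
    (by linarith) hm hga (by rw [hg0]; exact_mod_cast hn0.ne') (by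
      intro z hz
      rw [mem_sphere_zero_iff_norm] at hz
      rw [hg0, Complex.norm_real, norm_norm, hg]
      dsimp only
      rw [norm_div, Complex.norm_ofNat]
      have h1 := hhb z hz.le
      have h2 := hhb (conj z) (by rw [Complex.norm_conj]; exact hz.le)
      have h3 := norm_add_le (h z) (conj (h (conj z)))
      rw [Complex.norm_conj] at h3
      rw [div_le_iff₀ (by norm_num)]
      linarith) (W.map ⟨_, hinj⟩) (by
      intro w hw
      simp only [Finset.mem_map, Function.Embedding.coeFn_mk] at hw
      obtain ⟨u, hu, rfl⟩ := hw
      obtain ⟨hu1, hu2⟩ := hW u hu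
      refine ⟨?_, ?_⟩
      · rw [mem_closedBall_zero_iff, Complex.norm_real, Real.norm_eq_abs, abs_le]
        constructor <;> linarith [hu1.1, hu1.2]
      · rw [hreal u hu1, hu2]; simp)
  rw [Finset.card_map, hWc, mul_div_assoc, div_self hr.ne', mul_one] at hJ
  have hl : 1 / 5 ≤ Real.log (5 / 4) := by
    have := Real.one_sub_inv_le_log_of_pos (show (0:ℝ) < 5 / 4 by norm_num)
    norm_num at this ⊢
    linarith
  have hlt : D / π < ⌊D / π⌋₊ + 1 := Nat.lt_floor_add_one _
  rw [div_lt_iff₀ hpi] at hlt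
  have hn : (0:ℝ) ≤ ⌊D / π⌋₊ := Nat.cast_nonneg _
  have hn5 : (⌊D / π⌋₊ : ℝ) ≤ 5 * m := by nlinarith
  have hpi4 := Real.pi_lt_d2
  nlinarith

lemma exists_tail_bound : ∃ C : ℝ, 1 ≤ C ∧ ∀ (f : ℕ → ℂ) (K : ℝ), 0 ≤ K →
    (∀ n, ‖f n‖ ≤ K / (n : ℝ) ^ 2) → Summable f ∧ ‖∑' n, f n‖ ≤ K * C ∧
      ∀ N : ℕ, 1 ≤ N → ‖∑' n, f n - ∑ n ∈ Finset.range (N + 1), f n‖ ≤ K * C / √N := by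
  have hs2 : Summable fun n : ℕ => 1 / (n : ℝ) ^ 2 := Real.summable_one_div_nat_pow.2 (by norm_num)
  have hs : Summable fun n : ℕ => 1 / ((n + 1 : ℕ) : ℝ) ^ (3 / 2 : ℝ) :=
    (summable_nat_add_iff 1).2 (Real.summable_one_div_nat_rpow.2 (by norm_num))
  set A := ∑' n : ℕ, 1 / (n : ℝ) ^ 2 with hA
  set B := ∑' n : ℕ, 1 / ((n + 1 : ℕ) : ℝ) ^ (3 / 2 : ℝ) with hB
  have hA0 : 0 ≤ A := tsum_nonneg fun n => by positivity
  have hB0 : 0 ≤ B := tsum_nonneg fun n => by positivity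
  refine ⟨1 + A + B, by linarith, fun f K hK hf => ?_⟩
  have hf' : ∀ n, ‖f n‖ ≤ K * (1 / (n : ℝ) ^ 2) := fun n => by rw [mul_one_div]; exact hf n
  have hsum : Summable f := Summable.of_norm_bounded (hs2.mul_left K) hf'
  refine ⟨hsum, ?_, fun N hN => ?_⟩
  · refine (tsum_of_norm_bounded (hs2.mul_left K).hasSum hf').trans ?_
    rw [tsum_mul_left, ← hA]
    gcongr; linarith
  · rw [← hsum.sum_add_tsum_nat_add (N + 1), add_sub_cancel_left]
    have hN0 : (0:ℝ) < N := by exact_mod_cast hN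
    have hb : ∀ n, ‖f (n + (N + 1))‖ ≤ K / √N * (1 / ((n + 1 : ℕ) : ℝ) ^ (3 / 2 : ℝ)) := by
      intro n
      refine (hf _).trans ?_
      rw [div_mul_div_comm, mul_one]
      have hx : (0:ℝ) < ((n + (N + 1) : ℕ) : ℝ) := by positivity
      have e : ((n + (N + 1) : ℕ) : ℝ) ^ 2 = √((n + (N + 1) : ℕ) : ℝ) *
          ((n + (N + 1) : ℕ) : ℝ) ^ (3 / 2 : ℝ) := by
        rw [Real.sqrt_eq_rpow, ← Real.rpow_add hx, ← Real.rpow_natCast]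
        norm_num
      rw [e]
      have h1 : (N : ℝ) ≤ ((n + (N + 1) : ℕ) : ℝ) := by push_cast; linarith [Nat.cast_nonneg (α := ℝ) n]
      have h2 : ((n + 1 : ℕ) : ℝ) ≤ ((n + (N + 1) : ℕ) : ℝ) := by push_cast; linarith
      gcongr
    refine (tsum_of_norm_bounded (hs.mul_left _).hasSum hb).trans ?_
    rw [tsum_mul_left, ← hB, mul_div_right_comm]
    gcongr; linarith

lemma norm_natCast_cpow_neg_two {s : ℂ} (hs : s.re = 2) (n : ℕ) :
    ‖(n : ℂ) ^ (-s)‖ = 1 / (n : ℝ) ^ 2 := by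
  rcases Nat.eq_zero_or_pos n with h | h
  · subst h
    rw [Nat.cast_zero, Complex.zero_cpow (by intro h; rw [neg_eq_zero] at h; simp [h] at hs)]
    simp
  · rw [Complex.norm_natCast_cpow_of_pos h, neg_re, hs, Real.rpow_neg (Nat.cast_nonneg _)]
    norm_num

lemma exists_norm_zeta_mul_moebiusSum_sub_one_le : ∃ C : ℝ, 1 ≤ C ∧ ∀ N : ℕ, 1 ≤ N → ∀ s : ℂ,
    s.re = 2 → ‖riemannZeta s‖ ≤ C ∧ ‖riemannZeta s * moebiusSum N s - 1‖ ≤ C / √N := by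
  obtain ⟨C, hC, h⟩ := exists_tail_bound
  refine ⟨C * C, by nlinarith, fun N hN s hs => ?_⟩
  have hs1 : 1 < s.re := by rw [hs]; norm_num
  have hzeta : ‖riemannZeta s‖ ≤ C := by
    rw [zeta_eq_tsum_one_div_nat_cpow hs1]
    have := (h (fun n => 1 / (n : ℂ) ^ s) 1 zero_le_one (fun n => by
      rw [one_div, ← Complex.cpow_neg, norm_natCast_cpow_neg_two hs])).2.1
    rwa [one_mul] at this
  refine ⟨hzeta.trans (by nlinarith), ?_⟩
  set f : ℕ → ℂ := fun n => (ArithmeticFunction.moebius n : ℂ) * (n : ℂ) ^ (-s) with hf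
  have hfn : ∀ n, ‖f n‖ ≤ 1 / (n : ℝ) ^ 2 := by
    intro n
    rw [hf]
    dsimp only
    rw [norm_mul, norm_natCast_cpow_neg_two hs, Complex.norm_intCast]
    have : |((ArithmeticFunction.moebius n : ℤ) : ℝ)| ≤ 1 := by
      exact_mod_cast ArithmeticFunction.abs_moebius_le_one
    have h0 : (0:ℝ) ≤ 1 / (n : ℝ) ^ 2 := by positivity
    nlinarith
  obtain ⟨-, -, htail⟩ := h f 1 zero_le_one hfn
  have hL : riemannZeta s * ∑' n, f n = 1 := by
    have h1 := ArithmeticFunction.LSeries_zeta_mul_Lseries_moebius hs1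
    rw [ArithmeticFunction.LSeries_zeta_eq_riemannZeta hs1] at h1
    rw [← h1]
    congr 1
    rw [LSeries]
    refine tsum_congr fun n => ?_
    rcases Nat.eq_zero_or_pos n with h0 | h0
    · subst h0; simp [hf]
    · rw [LSeries.term_of_ne_zero h0.ne', hf]
      dsimp only
      rw [Complex.cpow_neg, div_eq_mul_inv]
  have hM : moebiusSum N s = ∑ n ∈ Finset.range (N + 1), f n := by
    rw [Finset.range_eq_Ico, Finset.sum_eq_sum_Ico_succ_bot (by omega), moebiusSum]
    simp only [hf]
    simp [← Finset.Ico_add_one_right_eq_Icc]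
  rw [hM, ← hL, ← mul_sub, norm_mul, norm_sub_rev]
  calc _ ≤ C * (1 * C / √N) := by
        gcongr
        exact htail N hN
    _ = _ := by ring

/-- The logarithm of the partial Euler product over the primes up to `N`. -/
def eulerLog (N : ℕ) (s : ℂ) : ℂ := ∑ p ∈ (N + 1).primesBelow, -Complex.log (1 - (p : ℂ) ^ (-s))

lemma norm_prime_cpow_le {p : ℕ} (hp : p.Prime) {s : ℂ} (hs : 1 / 2 ≤ s.re) :
    ‖(p : ℂ) ^ (-s)‖ ≤ 3 / 4 := by
  rw [Complex.norm_natCast_cpow_of_pos hp.pos, neg_re, Real.rpow_neg (Nat.cast_nonneg _)]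
  have h2 : (2:ℝ) ≤ p := by exact_mod_cast hp.two_le
  have h1 : √2 ≤ (p : ℝ) ^ s.re := by
    rw [Real.sqrt_eq_rpow]
    exact (Real.rpow_le_rpow (by norm_num) h2 (by norm_num)).trans
      (Real.rpow_le_rpow_of_exponent_le (by linarith) hs)
  have h3 : (4/3:ℝ) ≤ √2 := Real.le_sqrt_of_sq_le (by norm_num)
  calc _ ≤ (4/3:ℝ)⁻¹ := inv_anti₀ (by norm_num) (h3.trans h1)
    _ = _ := by norm_num

lemma norm_neg_log_one_sub_sub_le {z : ℂ} (hz : ‖z‖ ≤ 3 / 4) :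
    ‖-Complex.log (1 - z) - z‖ ≤ 2 * ‖z‖ ^ 2 := by
  have h := Complex.norm_log_one_sub_inv_sub_self_le (z := z) (by linarith)
  have hsl : 1 - z ∈ slitPlane := by
    left
    rw [sub_re, one_re]
    linarith [Complex.re_le_norm z]
  rw [Complex.log_inv _ (Complex.mem_slitPlane_iff_arg.1 hsl).1] at h
  refine h.trans ?_
  have h4 : (1 - ‖z‖)⁻¹ ≤ 4 := by
    calc _ ≤ (1/4:ℝ)⁻¹ := inv_anti₀ (by norm_num) (by linarith)
      _ = 4 := by norm_num
  nlinarith [sq_nonneg ‖z‖]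

lemma norm_neg_log_one_sub_le {z : ℂ} (hz : ‖z‖ ≤ 3 / 4) :
    ‖-Complex.log (1 - z)‖ ≤ 3 * ‖z‖ := by
  have h := norm_neg_log_one_sub_sub_le hz
  have h2 := norm_add_le (-Complex.log (1 - z) - z) z
  rw [sub_add_cancel] at h2
  nlinarith [norm_nonneg z]

lemma norm_eulerLog_le_mul (N : ℕ) {s : ℂ} (hs : 1 / 2 ≤ s.re) : ‖eulerLog N s‖ ≤ 3 * N := by
  have hb : ∀ p ∈ (N + 1).primesBelow, ‖-Complex.log (1 - (p : ℂ) ^ (-s))‖ ≤ 3 := fun p hp => by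
    have h1 := norm_prime_cpow_le (Nat.prime_of_mem_primesBelow hp) hs
    linarith [norm_neg_log_one_sub_le h1]
  have hcard : (N + 1).primesBelow.card ≤ N := by
    have : (N + 1).primesBelow ⊆ Finset.Icc 1 N := fun p hp => Finset.mem_Icc.2
      ⟨(Nat.prime_of_mem_primesBelow hp).pos, Nat.lt_succ_iff.1 (Nat.lt_of_mem_primesBelow hp)⟩
    simpa using Finset.card_le_card this
  calc _ ≤ (N + 1).primesBelow.card • (3:ℝ) := by
        rw [eulerLog]
        exact (norm_sum_le _ _).trans (Finset.sum_le_card_nsmul _ _ _ hb)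
    _ ≤ _ := by
        rw [nsmul_eq_mul, mul_comm]
        have : ((N + 1).primesBelow.card : ℝ) ≤ N := by exact_mod_cast hcard
        linarith

lemma differentiableAt_eulerLog (N : ℕ) {s : ℂ} (hs : 1 / 2 ≤ s.re) :
    DifferentiableAt ℂ (eulerLog N) s := by
  refine DifferentiableAt.fun_sum fun p hp => ?_
  have hpp := Nat.prime_of_mem_primesBelow hp
  have h1 := norm_prime_cpow_le hpp hs
  have hsl : 1 - (p : ℂ) ^ (-s) ∈ slitPlane := by
    left
    rw [sub_re, one_re]
    linarith [Complex.re_le_norm ((p : ℂ) ^ (-s))]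
  have hd : DifferentiableAt ℂ (fun s : ℂ => (p : ℂ) ^ (-s)) s :=
    differentiableAt_id.neg.const_cpow (Or.inl (by exact_mod_cast hpp.ne_zero))
  exact ((hd.const_sub 1).clog hsl).neg

lemma norm_eulerLog_half_le (N : ℕ) (u : ℝ) : ‖eulerLog N (1 / 2 + u * I)‖ ≤
    ‖primeSum N (1 / 2 + u * I)‖ + 2 * ∑ p ∈ (N + 1).primesBelow, 1 / (p : ℝ) := by
  have hre : (1 / 2 + u * I : ℂ).re = 1 / 2 := by simp
  have h : ‖eulerLog N (1 / 2 + u * I) - primeSum N (1 / 2 + u * I)‖ ≤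
      2 * ∑ p ∈ (N + 1).primesBelow, 1 / (p : ℝ) := by
    rw [eulerLog, primeSum, ← Finset.sum_sub_distrib, Finset.mul_sum]
    refine (norm_sum_le _ _).trans (Finset.sum_le_sum fun p hp => ?_)
    have hpp := Nat.prime_of_mem_primesBelow hp
    refine (norm_neg_log_one_sub_sub_le (norm_prime_cpow_le hpp hre.ge)).trans (le_of_eq ?_)
    rw [Complex.norm_natCast_cpow_of_pos hpp.pos, neg_re, hre, rpow_neg_sq_nat hpp.pos,
      mul_one_div_cancel (by norm_num), Real.rpow_neg_one, one_div]
  have h2 := norm_add_le (eulerLog N (1 / 2 + u * I) - primeSum N (1 / 2 + u * I))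
    (primeSum N (1 / 2 + u * I))
  rw [sub_add_cancel] at h2
  linarith

lemma exists_norm_eulerLog_two_le : ∃ C : ℝ, 1 ≤ C ∧ ∀ N : ℕ, ∀ s : ℂ, s.re = 2 →
    ‖eulerLog N s‖ ≤ C ∧ (C ≤ √N →
      ‖riemannZeta s * cexp (-eulerLog N s) - 1‖ ≤ 2 * C / √N) := by
  obtain ⟨C, hC, h⟩ := exists_tail_bound
  refine ⟨6 * C, by linarith, fun N s hs => ?_⟩
  have hs1 : 1 < s.re := by rw [hs]; norm_num
  have hs2 : 1 / 2 ≤ s.re := by rw [hs]; norm_num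
  set f : ℕ → ℂ := Set.indicator {p : ℕ | p.Prime} (fun p => -Complex.log (1 - (p : ℂ) ^ (-s)))
    with hf
  have hfn : ∀ n, ‖f n‖ ≤ 3 / (n : ℝ) ^ 2 := by
    intro n
    by_cases hn : n.Prime
    · rw [hf, Set.indicator_of_mem (by exact hn)]
      have h1 := norm_neg_log_one_sub_le (norm_prime_cpow_le hn hs2)
      rwa [norm_natCast_cpow_neg_two hs, mul_one_div] at h1
    · rw [hf, Set.indicator_of_notMem (by exact hn), norm_zero]
      positivity
  obtain ⟨hsum, hbd, htail⟩ := h f 3 (by norm_num) hfn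
  have hQ : eulerLog N s = ∑ n ∈ Finset.range (N + 1), f n := by
    rw [eulerLog, Nat.primesBelow, Finset.sum_filter]
    refine Finset.sum_congr rfl fun n _ => ?_
    rw [hf, Set.indicator_apply]
    rfl
  have hz : cexp (∑' n, f n) = riemannZeta s := by
    rw [← riemannZeta_eulerProduct_exp_log hs1, hf, ← tsum_subtype]
    rfl
  have htail0 : N = 0 ∨ ‖∑' n, f n - eulerLog N s‖ ≤ 3 * C / √N := by
    rcases Nat.eq_zero_or_pos N with h0 | h0
    · exact Or.inl h0
    · right; rw [hQ]; exact htail N h0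
  refine ⟨?_, fun hN => ?_⟩
  · rcases htail0 with h0 | h0
    · subst h0
      rw [hQ]; simp [hf, Set.indicator_apply, Nat.not_prime_zero]; linarith
    · rcases Nat.eq_zero_or_pos N with hN | hN
      · subst hN
        rw [hQ]; simp [hf, Set.indicator_apply, Nat.not_prime_zero]; linarith
      have h1 : (1:ℝ) ≤ √N := Real.one_le_sqrt.2 (by exact_mod_cast hN)
      have h2 : 3 * C / √N ≤ 3 * C := div_le_self (by linarith) h1
      have h3 := norm_sub_norm_le (eulerLog N s) (∑' n, f n)
      rw [norm_sub_rev] at h3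
      linarith
  · have hNp : 0 < √N := by linarith
    have h0 : ‖∑' n, f n - eulerLog N s‖ ≤ 3 * C / √N := by
      rcases htail0 with h0 | h0
      · subst h0; simp at hNp
      · exact h0
    have hle : 3 * C / √N ≤ 1 := by rw [div_le_one hNp]; linarith
    rw [← hz, ← Complex.exp_add, ← sub_eq_add_neg]
    refine (Complex.norm_exp_sub_one_le (h0.trans hle)).trans ?_
    calc _ ≤ 2 * (3 * C / √N) := by gcongr
      _ ≤ 2 * (6 * C) / √N := by rw [← mul_div_assoc]; gcongr; norm_num

lemma norm_le_exp_of_half_two {f : ℂ → ℂ} {t L α β σ : ℝ} (hL : 5 ≤ L)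
    (hf : ∀ z : ℂ, 1 / 2 ≤ z.re → z.re ≤ 2 → |z.im - t| ≤ L → DifferentiableAt ℂ f z)
    (hl : ∀ u : ℝ, |u - t| ≤ L → ‖f (1 / 2 + u * I)‖ ≤ Real.exp α)
    (hr : ∀ u : ℝ, |u - t| ≤ L → ‖f (2 + u * I)‖ ≤ Real.exp β)
    (hG : ∀ z : ℂ, 1 / 2 ≤ z.re → z.re ≤ 2 → |z.im - t| ≤ L → ‖f z‖ ≤ Real.exp (4 * L))
    (hα : -L ≤ α) (hβ : -L ≤ β) (hσ1 : 1 / 2 ≤ σ) (hσ2 : σ ≤ 2) :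
    ‖f (σ + t * I)‖ ≤ Real.exp (9 + (2 * (2 - σ) * α + (2 * σ - 1) * β) / 3) := by
  have h := norm_le_exp_of_box (f := f) (a := 1 / 2) (b := 2) (t := t) (H := L) (α := α) (β := β)
    (γ := 4 * L) (σ := σ) (by norm_num) (by norm_num) (by linarith)
    (fun z hz h => hf z hz.1 hz.2 h) (fun u hu => by push_cast; exact hl u hu)
    (fun u hu => by push_cast; exact hr u hu) (fun z hz h => hG z hz.1 hz.2 h)
    (by nlinarith) (by nlinarith) ⟨hσ1, hσ2⟩
  refine h.trans (le_of_eq ?_)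
  congr 1
  ring

lemma norm_le_exp_strip {f : ℂ → ℂ} {t L a : ℝ} (hL : 5 ≤ L) (ha : 0 ≤ a)
    (hf : ∀ z : ℂ, 1 / 2 ≤ z.re → z.re ≤ 2 → |z.im - t| ≤ 4 * L → DifferentiableAt ℂ f z)
    (hl : ∀ u : ℝ, |u - t| ≤ 4 * L → ‖f (1 / 2 + u * I)‖ ≤ Real.exp a)
    (hr : ∀ u : ℝ, |u - t| ≤ 4 * L → ‖f (2 + u * I)‖ ≤ Real.exp a)
    (hG : ∀ z : ℂ, 1 / 2 ≤ z.re → z.re ≤ 2 → |z.im - t| ≤ 4 * L → ‖f z‖ ≤ Real.exp (4 * L))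
    (z : ℂ) (hz1 : 1 / 2 ≤ z.re) (hz2 : z.re ≤ 2) (hzt : |z.im - t| ≤ 3 * L) :
    ‖f z‖ ≤ Real.exp (9 + a) := by
  have htr : ∀ v : ℝ, |v - z.im| ≤ L → |v - t| ≤ 4 * L := fun v hv => by
    calc |v - t| = |(v - z.im) + (z.im - t)| := by ring_nf
      _ ≤ |v - z.im| + |z.im - t| := abs_add_le _ _
      _ ≤ _ := by linarith
  have h := norm_le_exp_of_half_two (f := f) (t := z.im) (L := L) (α := a) (β := a) (σ := z.re) hL
    (fun w h1 h2 h3 => hf w h1 h2 (htr _ h3)) (fun u hu => hl u (htr _ hu))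
    (fun u hu => hr u (htr _ hu)) (fun w h1 h2 h3 => hG w h1 h2 (htr _ h3))
    (by linarith) (by linarith) hz1 hz2
  rw [Complex.re_add_im] at h
  refine h.trans (le_of_eq ?_)
  congr 1
  ring

lemma norm_sub_one_le_half {g : ℂ → ℂ} {t L a b σ : ℝ} (hL : 5 ≤ L) (ha : 0 ≤ a) (hb : 0 ≤ b)
    (hbL : b ≤ L)
    (hf : ∀ z : ℂ, 1 / 2 ≤ z.re → z.re ≤ 2 → |z.im - t| ≤ L → DifferentiableAt ℂ g z)
    (hl : ∀ u : ℝ, |u - t| ≤ L → ‖g (1 / 2 + u * I)‖ ≤ Real.exp a)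
    (hr : ∀ u : ℝ, |u - t| ≤ L → ‖g (2 + u * I) - 1‖ ≤ Real.exp (-b))
    (hG : ∀ z : ℂ, 1 / 2 ≤ z.re → z.re ≤ 2 → |z.im - t| ≤ L → ‖g z‖ ≤ Real.exp (3 * L))
    (hσ1 : 1 / 2 ≤ σ) (hσ2 : σ ≤ 2) (hσ : 3 * (a + 11) ≤ (2 * σ - 1) * b) :
    ‖g (σ + t * I) - 1‖ ≤ 1 / 2 := by
  have hadd : ∀ (z : ℂ) (c : ℝ), 0 ≤ c → ‖g z‖ ≤ Real.exp c → ‖g z - 1‖ ≤ Real.exp (c + 1) := by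
    intro z c hc h
    have h1 : 1 ≤ Real.exp c := Real.one_le_exp hc
    have h2 : (2:ℝ) ≤ Real.exp 1 := by linarith [Real.add_one_le_exp (1:ℝ)]
    calc _ ≤ ‖g z‖ + ‖(1:ℂ)‖ := norm_sub_le _ _
      _ ≤ Real.exp c + Real.exp c := by rw [norm_one]; linarith
      _ = Real.exp c * 2 := by ring
      _ ≤ Real.exp c * Real.exp 1 := by gcongr
      _ = _ := (Real.exp_add _ _).symm
  have h := norm_le_exp_of_half_two (f := fun z => g z - 1) (t := t) (L := L) (α := a + 1) (β := -b)
    (σ := σ) hL (fun z h1 h2 h3 => (hf z h1 h2 h3).sub_const 1)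
    (fun u hu => hadd _ _ ha (hl u hu)) hr
    (fun z h1 h2 h3 => (hadd _ _ (by linarith) (hG z h1 h2 h3)).trans
      (Real.exp_le_exp.2 (by linarith))) (by linarith) (by linarith) hσ1 hσ2
  refine h.trans ?_
  have h3 : Real.exp (-1) ≤ 1 / 2 := by
    rw [Real.exp_neg, inv_eq_one_div]
    gcongr
    linarith [Real.add_one_le_exp (1:ℝ)]
  refine le_trans (Real.exp_le_exp.2 ?_) h3
  nlinarith

lemma exists_zeta_crude : ∃ B : ℝ, 5 ≤ B ∧ ∀ T t : ℝ, B ≤ Real.log T → 100 * Real.log T ^ 4 ≤ T →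
    T / Real.log T ^ 3 ≤ t → t ≤ T → ∀ z : ℂ, 1 / 4 ≤ z.re → z.re ≤ 2 →
      |z.im - t| ≤ 5 * Real.log T → 1 ≤ z.im ∧ ‖riemannZeta z‖ ≤ Real.exp (2 * Real.log T) := by
  obtain ⟨C, hC, h⟩ := exists_norm_riemannZeta_le
  refine ⟨5 + Real.log (3 * C), by linarith [Real.log_nonneg (show (1:ℝ) ≤ 3 * C by linarith)],
    fun T t hB hT h1 h2 z hz1 hz2 hz3 => ?_⟩
  have hlogC := Real.log_nonneg (show (1:ℝ) ≤ 3 * C by linarith)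
  set L := Real.log T with hL
  have hLp : 5 ≤ L := by linarith
  have hTp : 0 < T := lt_of_lt_of_le (by positivity) hT
  have h100 : 100 * L ≤ t := by
    refine le_trans ?_ h1
    rw [le_div_iff₀ (by positivity)]
    calc _ = 100 * L ^ 4 := by ring
      _ ≤ T := hT
  have ha := abs_le.1 hz3
  have him : 1 ≤ z.im := by linarith
  refine ⟨him, (h z hz1 him).trans ?_⟩
  have hn : ‖z‖ ≤ 3 * T := by
    refine (Complex.norm_le_abs_re_add_abs_im z).trans ?_
    rw [abs_of_nonneg (by linarith), abs_of_nonneg (by linarith)]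
    linarith
  have e : Real.exp (2 * L) = T * T := by rw [two_mul, Real.exp_add, hL, Real.exp_log hTp]
  have hCT : 3 * C ≤ T := by
    rw [← Real.log_le_log_iff (by linarith) hTp, ← hL]; linarith
  rw [e]
  calc C * ‖z‖ ≤ C * (3 * T) := by gcongr
    _ = 3 * C * T := by ring
    _ ≤ T * T := by gcongr

lemma norm_moebiusSum_le (N : ℕ) {s : ℂ} (hs : 0 ≤ s.re) : ‖moebiusSum N s‖ ≤ N := by
  have hb : ∀ n ∈ Finset.Icc 1 N, ‖(ArithmeticFunction.moebius n : ℂ) * (n : ℂ) ^ (-s)‖ ≤ 1 := by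
    intro n hn
    have hn1 := (Finset.mem_Icc.1 hn).1
    rw [norm_mul, Complex.norm_natCast_cpow_of_pos hn1, Complex.norm_intCast]
    have h1 : |((ArithmeticFunction.moebius n : ℤ) : ℝ)| ≤ 1 := by
      exact_mod_cast ArithmeticFunction.abs_moebius_le_one
    have h2 : (n : ℝ) ^ (-s).re ≤ 1 :=
      Real.rpow_le_one_of_one_le_of_nonpos (by exact_mod_cast hn1) (by rw [neg_re]; linarith)
    exact mul_le_one₀ h1 (by positivity) h2
  calc _ ≤ (Finset.Icc 1 N).card • (1:ℝ) := by
        rw [moebiusSum]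
        exact (norm_sum_le _ _).trans (Finset.sum_le_card_nsmul _ _ _ hb)
    _ = _ := by simp

lemma differentiableAt_moebiusSum (N : ℕ) (s : ℂ) : DifferentiableAt ℂ (moebiusSum N) s := by
  refine DifferentiableAt.fun_sum fun n hn => ?_
  have hn1 := (Finset.mem_Icc.1 hn).1
  have hd : DifferentiableAt ℂ (fun s : ℂ => (n : ℂ) ^ (-s)) s :=
    differentiableAt_id.neg.const_cpow (Or.inl (Nat.cast_ne_zero.2 (by omega)))
  exact hd.const_mul _

/-- A continuous logarithm of a function staying in the unit disc around `1` moves its imaginary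
part by at most `π`. -/
lemma abs_im_sub_le_pi {ψ : ℝ → ℂ} {x y : ℝ} (hxy : x ≤ y) (hψ : ContinuousOn ψ (Icc x y))
    (h : ∀ u ∈ Icc x y, ‖cexp (ψ u) - 1‖ < 1) : |(ψ y).im - (ψ x).im| ≤ π := by
  by_contra hcon
  push Not at hcon
  obtain ⟨W, hWc, hW⟩ := exists_finset_cos_eq_zero (φ := fun u => (ψ u).im) hxy
    (Complex.continuous_im.comp_continuousOn hψ) 1 (by rw [Nat.cast_one, one_mul]; exact hcon.le)
  obtain ⟨w, hw⟩ := Finset.card_pos.1 (show 0 < W.card by omega)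
  obtain ⟨hw1, hw2⟩ := hW w hw
  have h1 := h w hw1
  have h2 : (cexp (ψ w) - 1).re = -1 := by
    rw [sub_re, Complex.exp_re, hw2]; simp
  have h3 := Complex.abs_re_le_norm (cexp (ψ w) - 1)
  rw [h2] at h3
  norm_num at h3
  linarith

lemma exists_norm_moebiusSum_two_le : ∃ C : ℝ, 1 ≤ C ∧ ∀ N : ℕ, ∀ s : ℂ, s.re = 2 →
    ‖moebiusSum N s‖ ≤ C := by
  have hs2 : Summable fun n : ℕ => 1 / (n : ℝ) ^ 2 := Real.summable_one_div_nat_pow.2 (by norm_num)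
  have h0 : 0 ≤ ∑' n : ℕ, 1 / (n : ℝ) ^ 2 := tsum_nonneg fun n => by positivity
  refine ⟨1 + ∑' n : ℕ, 1 / (n : ℝ) ^ 2, by linarith, fun N s hs => ?_⟩
  rw [moebiusSum]
  have h1 : ‖∑ n ∈ Finset.Icc 1 N, (ArithmeticFunction.moebius n : ℂ) * (n : ℂ) ^ (-s)‖
      ≤ ∑ n ∈ Finset.Icc 1 N, 1 / (n : ℝ) ^ 2 := by
    refine (norm_sum_le _ _).trans (Finset.sum_le_sum fun n _ => ?_)
    rw [norm_mul, norm_natCast_cpow_neg_two hs, Complex.norm_intCast]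
    have : |((ArithmeticFunction.moebius n : ℤ) : ℝ)| ≤ 1 := by
      exact_mod_cast ArithmeticFunction.abs_moebius_le_one
    have h0 : (0:ℝ) ≤ 1 / (n : ℝ) ^ 2 := by positivity
    nlinarith
  have h2 := hs2.sum_le_tsum (Finset.Icc 1 N) (fun n _ => by positivity)
  linarith

lemma norm_zeta_le_left {T t A l : ℝ} (hA : 1 ≤ A) (hl : 1 ≤ l)
    (hL : 5 ≤ Real.log T) (hAl : 32 * A * l ≤ Real.log T)
    (hcr : ∀ z : ℂ, 1 / 4 ≤ z.re → z.re ≤ 2 → |z.im - t| ≤ 5 * Real.log T →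
      1 ≤ z.im ∧ ‖riemannZeta z‖ ≤ Real.exp (2 * Real.log T))
    (hz : ∀ u : ℝ, |u - t| ≤ 4 * Real.log T → ‖riemannZeta (1 / 2 + u * I)‖ ≤ Real.exp (A * l))
    (z : ℂ) (hz1 : 1 / 2 - 8 * A * l / Real.log T ≤ z.re) (hz2 : z.re ≤ 1 / 2)
    (hz3 : |z.im - t| ≤ 3 * Real.log T) : ‖riemannZeta z‖ ≤ Real.exp (9 + 65 * (A * l)) := by
  set L := Real.log T
  have hLp : 0 < L := by linarith
  have hd : 8 * A * l / L ≤ 1 / 4 := by rw [div_le_iff₀ hLp]; linarith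
  have hdL : 8 * A * l / L * L = 8 * A * l := div_mul_cancel₀ _ hLp.ne'
  have hAl0 : 1 ≤ A * l := one_le_mul_of_one_le_of_one_le hA hl
  have htr : ∀ v : ℝ, |v - z.im| ≤ L → |v - t| ≤ 4 * L := fun v hv => by
    calc |v - t| = |(v - z.im) + (z.im - t)| := by ring_nf
      _ ≤ |v - z.im| + |z.im - t| := abs_add_le _ _
      _ ≤ _ := by linarith
  have h := norm_le_exp_of_box (f := riemannZeta) (a := 1 / 4) (b := 1 / 2) (t := z.im) (H := L)
    (α := 2 * L) (β := A * l) (γ := 2 * L) (σ := z.re) (by norm_num) (by norm_num) hLp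
    (fun w hw h => differentiableAt_riemannZeta (ne_one_of_im_pos (by
      linarith [(hcr w hw.1 (by linarith [hw.2]) (by linarith [htr _ h])).1])))
    (fun u hu => (hcr _ (by simp) (by simp; norm_num) (by
      simp only [add_im, ofReal_im, mul_im, ofReal_re, I_im, I_re]; ring_nf
      linarith [htr u hu])).2)
    (fun u hu => by push_cast; exact hz u (htr u hu))
    (fun w hw h => (hcr w hw.1 (by linarith [hw.2]) (by linarith [htr _ h])).2)
    (by nlinarith) (by nlinarith) ⟨by linarith, hz2⟩
  rw [Complex.re_add_im] at h
  refine h.trans (Real.exp_le_exp.2 ?_)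
  have e : ((1 / 2 - z.re) * (2 * L) + (z.re - 1 / 4) * (A * l)) / (1 / 2 - 1 / 4)
      = 8 * (1 / 2 - z.re) * L + (4 * z.re - 1) * (A * l) := by ring
  rw [e]
  have h1 : (1 / 2 - z.re) * L ≤ 8 * A * l := by nlinarith
  have h2 : (4 * z.re - 1) * (A * l) ≤ 1 * (A * l) := by gcongr; linarith
  linarith

lemma exists_zeta_two_sided {A : ℝ} (hA : 1 ≤ A) : ∃ B : ℝ, 5 ≤ B ∧ ∀ T t l : ℝ, B ≤ l →
    32 * A * l ≤ Real.log T → B ≤ Real.log T → 0 < T →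
    (∀ z : ℂ, 1 / 4 ≤ z.re → z.re ≤ 2 → |z.im - t| ≤ 5 * Real.log T →
      1 ≤ z.im ∧ ‖riemannZeta z‖ ≤ Real.exp (2 * Real.log T)) →
    (∀ u : ℝ, |u - t| ≤ 4 * Real.log T → ‖riemannZeta (1 / 2 + u * I)‖ ≤ Real.exp (A * l)) →
    (∀ u : ℝ, |u - t| ≤ 4 * Real.log T →
      ‖moebiusSum ⌊T⌋₊ (1 / 2 + u * I)‖ ≤ Real.exp (A * l)) →
    (∀ z : ℂ, 1 / 2 ≤ z.re → z.re ≤ 2 → |z.im - t| ≤ 3 * Real.log T →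
      ‖riemannZeta z‖ ≤ Real.exp (9 + A * l)) ∧
    ∀ σ : ℝ, 1 / 2 + 30 * A * l / Real.log T ≤ σ → σ ≤ 2 →
      Real.exp (-(10 + A * l)) ≤ ‖riemannZeta (σ + t * I)‖ := by
  obtain ⟨C₁, hC₁, h₁⟩ := exists_norm_zeta_mul_moebiusSum_sub_one_le
  obtain ⟨C₂, hC₂, h₂⟩ := exists_norm_moebiusSum_two_le
  refine ⟨5 + 4 * C₁ ^ 2 + C₂, by nlinarith, fun T t l hl hAl hBL hT hcr hz hM => ?_⟩
  set L := Real.log T with hLdef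
  have hC1sq : C₁ ≤ C₁ ^ 2 := by nlinarith
  have hL5 : 5 ≤ L := by nlinarith
  have hLp : 0 < L := by linarith
  have hTL : Real.exp L = T := Real.exp_log hT
  have hAl0 : l ≤ A * l := by nlinarith
  have hAl5 : 0 ≤ A * l := by nlinarith
  have hexpA : ∀ c : ℝ, c ≤ l → c ≤ Real.exp (A * l) := fun c hc => by
    linarith [Real.add_one_le_exp (A * l)]
  have hdz : ∀ z : ℂ, 1 / 2 ≤ z.re → z.re ≤ 2 → |z.im - t| ≤ 4 * L →
      DifferentiableAt ℂ riemannZeta z := fun z h1 h2 h3 =>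
    differentiableAt_riemannZeta (ne_one_of_im_pos (by
      linarith [(hcr z (by linarith) h2 (by linarith)).1]))
  have hT1 : 1 ≤ T := by rw [← hTL]; exact Real.one_le_exp hLp.le
  have hN1 : 1 ≤ ⌊T⌋₊ := Nat.le_floor (by simpa using hT1)
  have hNT : (⌊T⌋₊ : ℝ) ≤ T := Nat.floor_le hT.le
  have hN2 : T / 2 ≤ (⌊T⌋₊ : ℝ) := by
    have := Nat.lt_floor_add_one T
    have h1 : (1:ℝ) ≤ (⌊T⌋₊ : ℝ) := by exact_mod_cast hN1
    linarith
  have hre2 : ∀ u : ℝ, (2 + u * I : ℂ).re = 2 := fun u => by simp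
  have hup := norm_le_exp_strip (f := riemannZeta) (t := t) (L := L) (a := A * l) hL5 hAl5 hdz hz
    (fun u hu => ((h₁ _ hN1 _ (hre2 u)).1).trans (hexpA _ (by nlinarith)))
    (fun z h1 h2 h3 => ((hcr z (by linarith) h2 (by linarith)).2).trans
      (Real.exp_le_exp.2 (by linarith)))
  have hMcr : ∀ z : ℂ, 1 / 2 ≤ z.re → ‖moebiusSum ⌊T⌋₊ z‖ ≤ Real.exp L := fun z h1 => by
    rw [hTL]; exact (norm_moebiusSum_le _ (by linarith)).trans hNT
  have hMup := norm_le_exp_strip (f := moebiusSum ⌊T⌋₊) (t := t) (L := L) (a := A * l) hL5 hAl5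
    (fun z _ _ _ => differentiableAt_moebiusSum _ z) hM
    (fun u hu => (h₂ _ _ (hre2 u)).trans (hexpA _ (by nlinarith)))
    (fun z h1 h2 h3 => (hMcr z h1).trans (Real.exp_le_exp.2 (by linarith)))
  refine ⟨hup, fun σ hσ1 hσ2 => ?_⟩
  have hδ : 0 ≤ 30 * A * l / L := div_nonneg (by linarith) hLp.le
  have hδL : 30 * A * l / L * L = 30 * A * l := div_mul_cancel₀ _ hLp.ne'
  have hhalf := norm_sub_one_le_half (g := fun z => riemannZeta z * moebiusSum ⌊T⌋₊ z) (t := t)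
    (L := L) (a := 2 * (A * l)) (b := L / 4) (σ := σ) hL5 (by linarith) (by linarith) (by linarith)
    (fun z h1 h2 h3 => (hdz z h1 h2 (by linarith)).mul (differentiableAt_moebiusSum _ z))
    (fun u hu => by
      rw [norm_mul, two_mul, Real.exp_add]
      exact mul_le_mul (hz u (by linarith)) (hM u (by linarith)) (norm_nonneg _)
        (Real.exp_nonneg _))
    (fun u hu => by
      refine (h₁ _ hN1 _ (hre2 u)).2.trans ?_
      have hNp : (0:ℝ) < ⌊T⌋₊ := by exact_mod_cast hN1
      rw [div_le_iff₀ (Real.sqrt_pos.2 hNp), Real.exp_neg, inv_mul_eq_div,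
        le_div_iff₀ (Real.exp_pos _)]
      refine Real.le_sqrt_of_sq_le (le_trans ?_ hN2)
      have e1 : Real.exp (L / 4) ^ 2 = Real.exp (L / 2) := by
        rw [← Real.exp_nat_mul]; congr 1; push_cast; ring
      have e2 : T = Real.exp (L / 2) * Real.exp (L / 2) := by
        rw [← Real.exp_add, ← hTL]; congr 1; ring
      have h3 : 2 * C₁ ^ 2 ≤ Real.exp (L / 2) := by linarith [Real.add_one_le_exp (L / 2)]
      rw [mul_pow, e1, e2]
      nlinarith [Real.exp_pos (L / 2)])
    (fun z h1 h2 h3 => by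
      rw [norm_mul]
      calc _ ≤ Real.exp (2 * L) * Real.exp L :=
            mul_le_mul (hcr z (by linarith) h2 (by linarith)).2 (hMcr z h1) (norm_nonneg _)
              (Real.exp_nonneg _)
        _ = _ := by rw [← Real.exp_add]; congr 1; ring)
    (by linarith) hσ2 (by nlinarith)
  have hM' := hMup (σ + t * I) (by simp; linarith) (by simpa using hσ2) (by simp; linarith)
  have h1 : 1 / 2 ≤ ‖riemannZeta (σ + t * I) * moebiusSum ⌊T⌋₊ (σ + t * I)‖ := by
    have := norm_sub_norm_le (1:ℂ) (1 - riemannZeta (σ + t * I) * moebiusSum ⌊T⌋₊ (σ + t * I))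
    rw [norm_one, norm_sub_rev (1:ℂ), sub_sub_cancel] at this
    linarith
  rw [norm_mul] at h1
  have h2 : Real.exp (-1) ≤ 1 / 2 := by
    rw [Real.exp_neg, inv_eq_one_div]
    gcongr
    linarith [Real.add_one_le_exp (1:ℝ)]
  have h3 : Real.exp (-1) ≤ ‖riemannZeta (σ + t * I)‖ * Real.exp (9 + A * l) :=
    h2.trans (h1.trans (by gcongr))
  have e : Real.exp (-(10 + A * l)) = Real.exp (-1) / Real.exp (9 + A * l) := by
    rw [← Real.exp_sub]; congr 1; ring
  rw [e, div_le_iff₀ (Real.exp_pos _)]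
  exact h3

lemma exists_arg_right {A : ℝ} (hA : 1 ≤ A) : ∃ B : ℝ, 6 ≤ B ∧ ∀ (T t l : ℝ) (N : ℕ), B ≤ l →
    B * l ≤ Real.log T → 0 < T → (N : ℝ) ≤ T → Real.exp (Real.log T / (8 * l)) ≤ √N →
    (∀ z : ℂ, 1 / 4 ≤ z.re → z.re ≤ 2 → |z.im - t| ≤ 5 * Real.log T →
      1 ≤ z.im ∧ ‖riemannZeta z‖ ≤ Real.exp (2 * Real.log T)) →
    (∀ u : ℝ, |u - t| ≤ 4 * Real.log T → ‖riemannZeta (1 / 2 + u * I)‖ ≤ Real.exp (A * l)) →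
    (∀ u : ℝ, |u - t| ≤ 4 * Real.log T → ‖eulerLog N (1 / 2 + u * I)‖ ≤ A * l) →
    ∀ φ : ℝ → ℂ, ContinuousOn φ (Icc (1 / 2) 2) →
    (∀ x ∈ Icc (1 / 2 : ℝ) 2, cexp (φ x) = riemannZeta (x + t * I)) →
    ∀ σ : ℝ, 1 / 2 + 100 * A * l ^ 2 / Real.log T ≤ σ → σ ≤ 2 →
      |(φ 2).im - (φ σ).im| ≤ π + 2 * (Real.exp 9 * (A * l)) := by
  obtain ⟨C, hC, hQ2⟩ := exists_norm_eulerLog_two_le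
  have hE : (10:ℝ) ≤ Real.exp 9 := by linarith [Real.add_one_le_exp (9:ℝ)]
  refine ⟨6 + 32 * C + A * Real.exp 9, by nlinarith, fun T t l N hl hBL hT hNT hN hcr hz hQ φ hφ
    hφz σ hσ1 hσ2 => ?_⟩
  set L := Real.log T with hLdef
  have hAE : 10 ≤ A * Real.exp 9 := by nlinarith
  have hl6 : 48 ≤ l := by nlinarith
  have hlp : 0 < l := by linarith
  have hL1 : 32 * C * l ≤ L := by nlinarith
  have hL2 : Real.exp 9 * (A * l) ≤ L := by nlinarith
  have hLl : l ≤ L := by nlinarith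
  have hLp : 0 < L := by linarith
  have hTL : Real.exp L = T := Real.exp_log hT
  have hAl0 : l ≤ A * l := by nlinarith
  have hAlp : 0 < A * l := by linarith
  have hre2 : ∀ u : ℝ, (2 + u * I : ℂ).re = 2 := fun u => by simp
  have hCs : C ≤ √N := by
    refine le_trans ?_ hN
    have : C ≤ L / (8 * l) := by rw [le_div_iff₀ (by positivity)]; nlinarith
    linarith [Real.add_one_le_exp (L / (8 * l))]
  have hQup : ∀ z : ℂ, 1 / 2 ≤ z.re → z.re ≤ 2 → |z.im - t| ≤ 3 * L →
      ‖eulerLog N z‖ ≤ Real.exp 9 * (A * l) := by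
    have h := norm_le_exp_strip (f := eulerLog N) (t := t) (L := L) (a := Real.log (A * l))
      (by linarith) (Real.log_nonneg (by linarith))
      (fun z h1 _ _ => differentiableAt_eulerLog N h1)
      (fun u hu => by rw [Real.exp_log hAlp]; exact hQ u hu)
      (fun u hu => by
        rw [Real.exp_log hAlp]
        exact (hQ2 N _ (hre2 u)).1.trans (by nlinarith))
      (fun z h1 _ _ => by
        refine (norm_eulerLog_le_mul N h1).trans ?_
        have h3 : 3 ≤ Real.exp (3 * L) := by linarith [Real.add_one_le_exp (3 * L)]
        have e : Real.exp (4 * L) = Real.exp (3 * L) * T := by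
          rw [← hTL, ← Real.exp_add]; congr 1; ring
        rw [e]
        gcongr)
    intro z h1 h2 h3
    have := h z h1 h2 h3
    rwa [Real.exp_add, Real.exp_log hAlp] at this
  have hδ : 0 ≤ 100 * A * l ^ 2 / L := by positivity
  have hhalf : ∀ x : ℝ, σ ≤ x → x ≤ 2 →
      ‖riemannZeta (x + t * I) * cexp (-eulerLog N (x + t * I)) - 1‖ ≤ 1 / 2 := by
    intro x hx1 hx2
    have hb : L / (16 * l) ≤ L := div_le_self hLp.le (by linarith)
    have hlow : 200 * A * l ^ 2 / L ≤ 2 * x - 1 := by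
      have : 200 * A * l ^ 2 / L = 2 * (100 * A * l ^ 2 / L) := by ring
      rw [this]; linarith
    refine norm_sub_one_le_half (g := fun z => riemannZeta z * cexp (-eulerLog N z)) (t := t)
      (L := L) (a := 2 * (A * l)) (b := L / (16 * l)) (σ := x) (by linarith) (by linarith)
      (by positivity) hb ?_ ?_ ?_ ?_ (by linarith) hx2 ?_
    · intro z h1 h2 h3
      have hd : DifferentiableAt ℂ riemannZeta z := differentiableAt_riemannZeta (ne_one_of_im_pos (by
        linarith [(hcr z (by linarith) h2 (by linarith)).1]))
      exact hd.mul (differentiableAt_eulerLog N h1).neg.cexp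
    · intro u hu
      rw [norm_mul, two_mul, Real.exp_add]
      refine mul_le_mul (hz u (by linarith)) ?_ (norm_nonneg _) (Real.exp_nonneg _)
      refine (Complex.norm_exp_le_exp_norm _).trans (Real.exp_le_exp.2 ?_)
      rw [norm_neg]
      exact hQ u (by linarith)
    · intro u hu
      refine ((hQ2 N _ (hre2 u)).2 hCs).trans ?_
      have hsp : 0 < √N := lt_of_lt_of_le (Real.exp_pos _) hN
      rw [div_le_iff₀ hsp]
      have h2C : 2 * C ≤ Real.exp (L / (16 * l)) := by
        have : 2 * C ≤ L / (16 * l) := by rw [le_div_iff₀ (by positivity)]; linarith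
        linarith [Real.add_one_le_exp (L / (16 * l))]
      calc 2 * C ≤ Real.exp (L / (16 * l)) := h2C
        _ = Real.exp (-(L / (16 * l))) * Real.exp (L / (8 * l)) := by
            rw [← Real.exp_add]; congr 1; field_simp; ring
        _ ≤ _ := by gcongr
    · intro z h1 h2 h3
      rw [norm_mul]
      calc _ ≤ Real.exp (2 * L) * Real.exp L := by
            refine mul_le_mul (hcr z (by linarith) h2 (by linarith)).2 ?_ (norm_nonneg _)
              (Real.exp_nonneg _)
            refine (Complex.norm_exp_le_exp_norm _).trans (Real.exp_le_exp.2 ?_)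
            rw [norm_neg]
            exact (hQup z h1 h2 (by linarith)).trans hL2
        _ = _ := by rw [← Real.exp_add]; congr 1; ring
    · calc 3 * (2 * (A * l) + 11) ≤ 200 * A * l / 16 := by linarith
        _ = 200 * A * l ^ 2 / L * (L / (16 * l)) := by field_simp
        _ ≤ _ := by gcongr
  have hQc : ContinuousOn (fun x : ℝ => eulerLog N (x + t * I)) (Icc σ 2) := by
    intro x hx
    have h1 : DifferentiableAt ℂ (eulerLog N) (x + t * I) :=
      differentiableAt_eulerLog N (by simp; linarith [hx.1])
    have h2 : ContinuousAt (fun x : ℝ => (x + t * I : ℂ)) x := by fun_prop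
    exact (ContinuousAt.comp (f := fun x : ℝ => (x + t * I : ℂ)) h1.continuousAt
      h2).continuousWithinAt
  have hpi := abs_im_sub_le_pi (ψ := fun x => φ x - eulerLog N (x + t * I)) hσ2
    ((hφ.mono (Icc_subset_Icc_left (by linarith))).sub hQc) (fun x hx => by
      rw [Complex.exp_sub, hφz x ⟨by linarith [hx.1], hx.2⟩, div_eq_mul_inv, ← Complex.exp_neg]
      linarith [hhalf x hx.1 hx.2])
  have hq : ∀ x : ℝ, σ ≤ x → x ≤ 2 → |(eulerLog N (x + t * I)).im| ≤ Real.exp 9 * (A * l) :=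
    fun x hx1 hx2 => (Complex.abs_im_le_norm _).trans
      (hQup _ (by simp; linarith) (by simpa using hx2) (by simp; linarith))
  have q1 := abs_le.1 (hq σ le_rfl hσ2)
  have q2 := abs_le.1 (hq 2 hσ2 le_rfl)
  have q3 := abs_le.1 hpi
  simp only [sub_im] at q3
  rw [abs_le]
  constructor <;> linarith [q1.1, q1.2, q2.1, q2.2, q3.1, q3.2]

lemma abs_im_sub_le_dyadic {t a b δ : ℝ} {φ : ℝ → ℂ} (ht : 10 ≤ t) (hδ : 0 < δ) (hab : 0 ≤ a + b)
    (hup : ∀ z : ℂ, 1 / 2 ≤ z.re → z.re ≤ 2 → |z.im - t| ≤ 3 → ‖riemannZeta z‖ ≤ Real.exp a)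
    (hlo : ∀ σ : ℝ, 1 / 2 + δ ≤ σ → σ ≤ 2 → Real.exp (-b) ≤ ‖riemannZeta (σ + t * I)‖)
    (hφ : ContinuousOn φ (Icc (1 / 2) 2))
    (hφz : ∀ x ∈ Icc (1 / 2 : ℝ) 2, cexp (φ x) = riemannZeta (x + t * I)) (j : ℕ)
    (hj : 2 ^ j * δ ≤ 1 / 3) :
    |(φ (1 / 2 + 2 ^ j * δ)).im - (φ (1 / 2 + δ)).im| ≤ j * (20 * (a + b + 1)) := by
  induction j with
  | zero => simp
  | succ j ih =>
    set r := 2 ^ j * δ with hr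
    have hrp : 0 < r := by positivity
    have hr2 : 2 ^ (j + 1) * δ = 2 * r := by rw [hr, pow_succ]; ring
    have hδr : δ ≤ r := by
      rw [hr]; exact le_mul_of_one_le_left hδ.le (one_le_pow₀ (by norm_num))
    rw [hr2] at hj ⊢
    have ih' := ih (by linarith)
    have hstep := abs_im_sub_le_of_bound (f := riemannZeta) (c := 1 / 2 + 2 * r) (T := t) (r := r)
      (m := a + b) (x := 1 / 2 + r) (y := 1 / 2 + 2 * r) (φ := φ) hrp hab
      (fun z hz => by
        refine differentiableAt_riemannZeta (ne_one_of_im_pos ?_)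
        have h1 := (Complex.abs_im_le_norm _).trans hz.le
        simp at h1
        linarith [(abs_le.1 h1).1])
      (by
        have := hlo (1 / 2 + 2 * r) (by linarith) (by linarith)
        rw [← norm_pos_iff]
        exact lt_of_lt_of_le (Real.exp_pos _) this)
      (fun z hz => by
        have h1 := (Complex.abs_im_le_norm _).trans hz
        have h2 := (Complex.abs_re_le_norm _).trans hz
        simp at h1 h2
        have h3 := abs_le.1 h2
        calc _ ≤ Real.exp a := hup z (by linarith [h3.1]) (by linarith [h3.2]) (by linarith)
          _ = Real.exp (a + b) * Real.exp (-b) := by rw [← Real.exp_add]; congr 1; ring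
          _ ≤ _ := by
            gcongr
            exact hlo (1 / 2 + 2 * r) (by linarith) (by linarith))
      (by linarith) (by linarith) (by linarith)
      (hφ.mono (Icc_subset_Icc (by linarith) (by linarith)))
      (fun u hu => hφz u ⟨by linarith [hu.1], by linarith [hu.2]⟩)
    have h1 := abs_le.1 ih'
    have h2 := abs_le.1 hstep
    rw [abs_le]
    push_cast
    constructor <;> linarith [h1.1, h1.2, h2.1, h2.2]

set_option maxHeartbeats 1000000 in
lemma exists_arg_good {A : ℝ} (hA : 1 ≤ A) : ∃ B K : ℝ, 6 ≤ B ∧ 0 ≤ K ∧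
    ∀ (T t l : ℝ) (N J : ℕ), B ≤ l → B * l ≤ Real.log T → 0 < T → 10 ≤ t →
    4 * l ≤ 2 ^ J → 90 * A * l * 2 ^ J ≤ Real.log T → (J : ℝ) ≤ √l →
    (N : ℝ) ≤ T → Real.exp (Real.log T / (8 * l)) ≤ √N →
    (∀ z : ℂ, 1 / 4 ≤ z.re → z.re ≤ 2 → |z.im - t| ≤ 5 * Real.log T →
      1 ≤ z.im ∧ ‖riemannZeta z‖ ≤ Real.exp (2 * Real.log T)) →
    (∀ u : ℝ, |u - t| ≤ 4 * Real.log T → ‖riemannZeta (1 / 2 + u * I)‖ ≤ Real.exp (A * l)) →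
    (∀ u : ℝ, |u - t| ≤ 4 * Real.log T →
      ‖moebiusSum ⌊T⌋₊ (1 / 2 + u * I)‖ ≤ Real.exp (A * l)) →
    (∀ u : ℝ, |u - t| ≤ 4 * Real.log T → ‖eulerLog N (1 / 2 + u * I)‖ ≤ A * l) →
    ∀ φ : ℝ → ℂ, ContinuousOn φ (Icc (1 / 2) 2) →
    (∀ x ∈ Icc (1 / 2 : ℝ) 2, cexp (φ x) = riemannZeta (x + t * I)) →
      |(φ 2).im - (φ (1 / 2)).im| ≤ K * (l * √l) := by
  obtain ⟨B₁, hB₁, h₁⟩ := exists_arg_right hA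
  obtain ⟨B₂, hB₂, h₂⟩ := exists_zeta_two_sided hA
  have hE : 0 < Real.exp 9 := Real.exp_pos 9
  refine ⟨B₁ + B₂ + 32 * A, 4 + 2 * (Real.exp 9 * A) + 20 * (22 * A) + 20 * (86 * A), by linarith,
    by positivity, fun T t l N J hl hBL hT ht h4 hJL hJ hNT hN hcr hz hM hQ φ hφ hφz => ?_⟩
  set L := Real.log T with hLdef
  have hl1 : 1 ≤ l := by linarith
  have hlp : 0 < l := by linarith
  have hAl : 1 ≤ A * l := one_le_mul_of_one_le_of_one_le hA hl1
  have hL32 : 32 * A * l ≤ L := by nlinarith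
  have hLB : B₂ * l ≤ L := by nlinarith
  have hLB' : B₂ ≤ L := by nlinarith
  have hLp : 0 < L := by linarith
  obtain ⟨hup, hlo⟩ := h₂ T t l (by linarith) hL32 hLB' hT hcr hz hM
  have hright := h₁ T t l N (by linarith) (by nlinarith) hT hNT hN hcr hz hQ φ hφ hφz
  have hleft := norm_zeta_le_left (T := T) (t := t) hA hl1 (by linarith) hL32 hcr hz
  set δ := 30 * A * l / L with hδ
  have hδp : 0 < δ := by positivity
  have hδL : δ * L = 30 * A * l := div_mul_cancel₀ _ hLp.ne'
  have hJδ : 2 ^ J * δ ≤ 1 / 3 := by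
    rw [hδ, mul_div_assoc', div_le_iff₀ hLp]; nlinarith
  have hJ1 : 1 / 2 + 100 * A * l ^ 2 / L ≤ 1 / 2 + 2 ^ J * δ := by
    have h : 100 * A * l ^ 2 ≤ 2 ^ J * (30 * A * l) := by
      nlinarith [mul_le_mul_of_nonneg_right h4 (show 0 ≤ 30 * A * l by positivity),
        mul_nonneg (zero_le_one.trans hA) (sq_nonneg l)]
    rw [hδ, mul_div_assoc']
    linarith [(div_le_div_iff_of_pos_right hLp).2 h]
  have h2J1 : (1:ℝ) ≤ 2 ^ J := one_le_pow₀ (by norm_num)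
  have hδ13 : δ ≤ 1 / 3 := le_trans (le_mul_of_one_le_left hδp.le h2J1) hJδ
  have a1 := hright _ hJ1 (by linarith)
  have a2 := abs_im_sub_le_dyadic (a := 9 + A * l) (b := 10 + A * l) ht hδp (by linarith)
    (fun z h1 h2 h3 => hup z h1 h2 (by linarith)) hlo hφ hφz J hJδ
  have a3 := abs_im_sub_le_of_bound (f := riemannZeta) (c := 1 / 2 + δ) (T := t) (r := δ)
      (m := 19 + 66 * (A * l)) (x := 1 / 2) (y := 1 / 2 + δ) (φ := φ) hδp (by linarith)
      (fun z hz => by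
        refine differentiableAt_riemannZeta (ne_one_of_im_pos ?_)
        have h1 := (Complex.abs_im_le_norm _).trans hz.le
        simp at h1
        linarith [(abs_le.1 h1).1])
      (by
        have := hlo (1 / 2 + δ) le_rfl (by linarith)
        rw [← norm_pos_iff]
        exact lt_of_lt_of_le (Real.exp_pos _) this)
      (fun z hz => by
        have h1 := (Complex.abs_im_le_norm _).trans hz
        have h2 := (Complex.abs_re_le_norm _).trans hz
        simp at h1 h2
        have h3 := abs_le.1 h2
        have hb : ‖riemannZeta z‖ ≤ Real.exp (9 + 65 * (A * l)) := by
          rcases le_total (1 / 2) z.re with h | h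
          · exact (hup z h (by linarith [h3.2]) (by linarith)).trans
              (Real.exp_le_exp.2 (by linarith))
          · refine hleft z ?_ h (by linarith)
            have : δ / 4 ≤ 8 * A * l / L := by
              rw [hδ, div_div, div_le_div_iff₀ (by positivity) hLp]
              nlinarith [mul_pos hLp (show 0 < A * l by linarith)]
            linarith [h3.1]
        calc _ ≤ Real.exp (9 + 65 * (A * l)) := hb
          _ = Real.exp (19 + 66 * (A * l)) * Real.exp (-(10 + A * l)) := by
            rw [← Real.exp_add]; congr 1; ring
          _ ≤ _ := by
            gcongr
            exact hlo (1 / 2 + δ) le_rfl (by linarith))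
      (by linarith) (by linarith) (by linarith)
      (hφ.mono (Icc_subset_Icc (by linarith) (by linarith)))
      (fun u hu => hφz u ⟨by linarith [hu.1], by linarith [hu.2]⟩)
  have hs1 : 1 ≤ √l := Real.one_le_sqrt.2 hl1
  have b1 : π + 2 * (Real.exp 9 * (A * l)) ≤ (4 + 2 * (Real.exp 9 * A)) * (l * √l) := by
    have hpi := Real.pi_lt_four
    have hls : l ≤ l * √l := le_mul_of_one_le_right hlp.le hs1
    have : 0 ≤ Real.exp 9 * A := by positivity
    nlinarith
  have b2 : (J : ℝ) * (20 * (9 + A * l + (10 + A * l) + 1)) ≤ 20 * (22 * A) * (l * √l) := by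
    calc _ ≤ √l * (20 * (22 * (A * l))) := by gcongr; linarith
      _ = _ := by ring
  have b3 : 20 * (19 + 66 * (A * l) + 1) ≤ 20 * (86 * A) * (l * √l) := by
    have hls : l ≤ l * √l := le_mul_of_one_le_right hlp.le hs1
    calc _ ≤ 20 * (86 * A) * l := by linarith
      _ ≤ _ := by gcongr
  have c1 := abs_le.1 a1
  have c2 := abs_le.1 a2
  have c3 := abs_le.1 a3
  rw [abs_le]
  constructor <;> linarith [c1.1, c1.2, c2.1, c2.2, c3.1, c3.2]

lemma norm_zeta_sub_one_lt_one {s : ℂ} (hs : s.re = 2) : ‖riemannZeta s - 1‖ < 1 := by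
  have h1 : 1 < s.re := by rw [hs]; norm_num
  have hterm : ∀ n : ℕ, ‖1 / (n + 1 : ℂ) ^ s‖ = 1 / ((n + 1 : ℕ) : ℝ) ^ 2 := by
    intro n
    have e : (n + 1 : ℂ) = ((n + 1 : ℕ) : ℂ) := by push_cast; rfl
    rw [e, norm_div, norm_one, Complex.norm_natCast_cpow_of_pos (by omega), hs]
    norm_num
  have hZ : HasSum (fun n : ℕ => 1 / ((n + 1 : ℕ) : ℝ) ^ 2) (π ^ 2 / 6) := by
    have h := (hasSum_nat_add_iff' (f := fun n : ℕ => (1 : ℝ) / (n : ℝ) ^ 2) 1).2 hasSum_zeta_two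
    simpa using h
  have hZ2 : HasSum (fun n : ℕ => 1 / ((n + 1 + 1 : ℕ) : ℝ) ^ 2) (π ^ 2 / 6 - 1) := by
    have h := (hasSum_nat_add_iff' (f := fun n : ℕ => (1 : ℝ) / ((n + 1 : ℕ) : ℝ) ^ 2) 1).2 hZ
    simpa using h
  have hsum : Summable fun n : ℕ => 1 / (n + 1 : ℂ) ^ s :=
    Summable.of_norm (by simp_rw [hterm]; exact hZ.summable)
  rw [zeta_eq_tsum_one_div_nat_add_one_cpow h1, hsum.tsum_eq_zero_add]
  have e : ∀ n : ℕ, ‖1 / (((n + 1 : ℕ) : ℂ) + 1) ^ s‖ = 1 / ((n + 1 + 1 : ℕ) : ℝ) ^ 2 :=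
    fun n => hterm (n + 1)
  have hb : ‖∑' n : ℕ, 1 / (((n + 1 : ℕ) : ℂ) + 1) ^ s‖ ≤ π ^ 2 / 6 - 1 := by
    rw [← hZ2.tsum_eq]
    refine (norm_tsum_le_tsum_norm ?_).trans (le_of_eq ?_)
    · simp_rw [e]; exact hZ2.summable
    · simp_rw [e]
  have hpi : π ^ 2 / 6 - 1 < 1 := by nlinarith [Real.pi_lt_d2, Real.pi_pos]
  simpa using hb.trans_lt hpi

lemma exists_one_le_mul_norm_zeta :
    ∃ D : ℝ, 1 ≤ D ∧ ∀ s : ℂ, s.re = 3 / 2 → 1 ≤ D * ‖riemannZeta s‖ := by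
  have hsum : Summable fun n : ℕ => 1 / (n : ℝ) ^ (3 / 2 : ℝ) :=
    Real.summable_one_div_nat_rpow.2 (by norm_num)
  have h0 : 0 ≤ ∑' n : ℕ, 1 / (n : ℝ) ^ (3 / 2 : ℝ) := tsum_nonneg fun n => by positivity
  refine ⟨1 + ∑' n : ℕ, 1 / (n : ℝ) ^ (3 / 2 : ℝ), by linarith, fun s hs => ?_⟩
  have h1 : 1 < s.re := by rw [hs]; norm_num
  have hmul := LSeries_one_mul_Lseries_moebius h1
  rw [LSeries_one_eq_riemannZeta h1] at hmul
  have hle : ‖LSeries (fun n => (ArithmeticFunction.moebius n : ℂ)) s‖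
      ≤ ∑' n : ℕ, 1 / (n : ℝ) ^ (3 / 2 : ℝ) := by
    have ht : ∀ n : ℕ, ‖LSeries.term (fun n => (ArithmeticFunction.moebius n : ℂ)) s n‖
        ≤ 1 / (n : ℝ) ^ (3 / 2 : ℝ) := by
      intro n
      rw [LSeries.norm_term_eq, hs]
      split_ifs with h
      · positivity
      · gcongr
        rw [Complex.norm_intCast]
        exact_mod_cast ArithmeticFunction.abs_moebius_le_one
    exact tsum_of_norm_bounded hsum.hasSum ht
  have h2 := congrArg norm hmul
  rw [norm_mul, norm_one] at h2
  nlinarith [norm_nonneg (riemannZeta s)]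

lemma exists_arg_crude : ∃ C : ℝ, 0 ≤ C ∧ ∀ t : ℝ, 3 ≤ t → ∀ φ : ℝ → ℂ,
    ContinuousOn φ (Icc (1 / 2) 2) →
    (∀ x ∈ Icc (1 / 2 : ℝ) 2, cexp (φ x) = riemannZeta (x + t * I)) →
      |(φ 2).im - (φ (1 / 2)).im| ≤ C * Real.log t := by
  obtain ⟨C, hC, h⟩ := exists_norm_riemannZeta_le
  obtain ⟨D, hD, hlow⟩ := exists_one_le_mul_norm_zeta
  have hCD : 1 ≤ 3 * C * D := by nlinarith
  have hlog := Real.log_nonneg hCD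
  refine ⟨20 * (Real.log (3 * C * D) + 2), by positivity, fun t ht φ hφ hφz => ?_⟩
  have ht0 : 0 < t := by linarith
  have hlt : 1 ≤ Real.log t := by
    rw [Real.le_log_iff_exp_le ht0]
    linarith [Real.exp_one_lt_d9]
  have hc := hlow (((3 / 2 : ℝ) : ℂ) + t * I) (by simp)
  have h1 := abs_im_sub_le_of_bound (f := riemannZeta) (c := 3 / 2) (T := t) (r := 1)
      (m := Real.log (3 * C * D * t)) (x := 1 / 2) (y := 2) (φ := φ) one_pos
      (Real.log_nonneg (by nlinarith))
      (fun z hz => by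
        refine differentiableAt_riemannZeta (ne_one_of_im_pos ?_)
        have h1 := (Complex.abs_im_le_norm _).trans hz.le
        simp at h1
        linarith [(abs_le.1 h1).1])
      (fun h0 => by rw [h0] at hc; norm_num at hc)
      (fun z hz => by
        have h1 := (Complex.abs_im_le_norm _).trans hz
        have h2 := (Complex.abs_re_le_norm _).trans hz
        rw [sub_im, add_im, ofReal_im, zero_add, im_ofReal_mul, I_im, mul_one] at h1
        rw [sub_re, add_re, ofReal_re, re_ofReal_mul, I_re, mul_zero, add_zero] at h2
        have h1' := abs_le.1 h1
        have h2' := abs_le.1 h2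
        have hn : ‖z‖ ≤ 3 * t := by
          refine (Complex.norm_le_abs_re_add_abs_im z).trans ?_
          rw [abs_of_pos (by linarith), abs_of_pos (by linarith)]
          linarith
        rw [Real.exp_log (by positivity)]
        calc _ ≤ C * ‖z‖ := h z (by linarith) (by linarith)
          _ ≤ C * (3 * t) := by gcongr
          _ ≤ C * (3 * t) * (D * ‖riemannZeta (((3 / 2 : ℝ) : ℂ) + t * I)‖) :=
            le_mul_of_one_le_right (by positivity) hc
          _ = _ := by ring)
      (by norm_num) (by norm_num) (by norm_num) hφ hφz
  refine h1.trans ?_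
  rw [Real.log_mul (by positivity) ht0.ne']
  nlinarith

lemma abs_S_le_of_arg {S : ℝ → ℝ} (hS : IsS S) {t b : ℝ} (ht : 0 < t)
    (hne : ∀ σ : ℝ, 1 / 2 ≤ σ → σ ≤ 2 → riemannZeta (σ + t * I) ≠ 0)
    (h : ∀ φ : ℝ → ℂ, ContinuousOn φ (Icc (1 / 2) 2) →
      (∀ x ∈ Icc (1 / 2 : ℝ) 2, cexp (φ x) = riemannZeta (x + t * I)) →
        |(φ 2).im - (φ (1 / 2)).im| ≤ b) : |S t| ≤ 2 + b := by
  obtain ⟨θ, hθ, hθ0, hθ1, hθ2, hSt⟩ := hS.1 t ht hne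
  have hv := abs_im_sub_le_pi (ψ := θ) zero_le_one
    (hθ.mono (Icc_subset_Icc le_rfl one_le_two)) (fun u hu => by
      rw [hθ1 u hu]
      exact norm_zeta_sub_one_lt_one (by simp))
  have h0 : |(θ 0).im| ≤ π := by
    rw [hθ0, Complex.log_im]
    exact abs_arg_le_pi _
  have hh := h (fun x => θ (1 + (2 - x) * (2 / 3)))
    (hθ.comp (by fun_prop) (fun x hx => ⟨by linarith [hx.2], by linarith [hx.1]⟩))
    (fun x hx => by
      rw [hθ2 _ ⟨by linarith [hx.2], by linarith [hx.1]⟩]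
      congr 1
      push_cast
      ring)
  norm_num at hh
  have hpi : (1:ℝ) ≤ π := by linarith [Real.pi_gt_three]
  have hb : 0 ≤ b := (abs_nonneg _).trans hh
  have h1 := abs_le.1 hv
  have h2 := abs_le.1 h0
  have h3 := abs_le.1 hh
  rw [hSt, abs_div, abs_of_pos Real.pi_pos, div_le_iff₀ Real.pi_pos]
  have : b ≤ b * π := le_mul_of_one_le_right hb hpi
  rw [abs_le]
  constructor <;> nlinarith [h1.1, h1.2, h2.1, h2.2, h3.1, h3.2]

lemma ae_zeta_ne_zero : ∀ᵐ t : ℝ, ∀ σ : ℝ, 1 / 2 ≤ σ → σ ≤ 2 → riemannZeta (σ + t * I) ≠ 0 := by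
  have hc : riemannZetaZeros.Countable := by
    have e : riemannZetaZeros = ⋃ n : ℕ, Metric.closedBall (0 : ℂ) n ∩ riemannZetaZeros := by
      rw [← iUnion_inter, Metric.iUnion_closedBall_nat, univ_inter]
    rw [e]
    exact countable_iUnion fun n =>
      ((isCompact_closedBall (0 : ℂ) n).inter_riemannZetaZeros_finite).countable
  have hn := (hc.image Complex.im).measure_zero volume
  filter_upwards [measure_eq_zero_iff_ae_notMem.1 hn] with t ht σ _ _ h0
  exact ht ⟨σ + t * I, h0, by simp⟩

lemma exists_abs_S_le {S : ℝ → ℝ} (hS : IsS S) : ∃ C : ℝ, 0 ≤ C ∧ ∀ᵐ t : ℝ, 3 ≤ t →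
    |S t| ≤ C * Real.log t := by
  obtain ⟨C, hC, h⟩ := exists_arg_crude
  refine ⟨2 + C, by linarith, ?_⟩
  filter_upwards [ae_zeta_ne_zero] with t hne ht
  have hlt : 1 ≤ Real.log t := by
    rw [Real.le_log_iff_exp_le (by linarith)]
    linarith [Real.exp_one_lt_d9]
  have := abs_S_le_of_arg hS (by linarith) hne (h t ht)
  linarith

lemma two_pow_floor_sqrt_bounds {A l : ℝ} (hA : 1 ≤ A) (hl : 384 * A ≤ √l) :
    4 * l ≤ 2 ^ ⌊√l⌋₊ ∧ 90 * A * l * 2 ^ ⌊√l⌋₊ ≤ Real.exp l := by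
  set s := √l with hs
  have hs0 : 384 ≤ s := by linarith
  have hl0 : 0 ≤ l := by
    by_contra h
    rw [hs, Real.sqrt_eq_zero_of_nonpos (by linarith)] at hs0
    norm_num at hs0
  have hls : l = s ^ 2 := (Real.sq_sqrt hl0).symm
  have hf1 : (⌊s⌋₊ : ℝ) ≤ s := Nat.floor_le (by linarith)
  have hf2 : s < ⌊s⌋₊ + 1 := Nat.lt_floor_add_one s
  have hlog2 := Real.log_two_gt_d9
  have hlog2' := Real.log_two_lt_d9
  have e2 : (2:ℝ) ^ ⌊s⌋₊ = Real.exp (⌊s⌋₊ * Real.log 2) := by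
    rw [Real.exp_nat_mul, Real.exp_log two_pos]
  constructor
  · have h1 : 2 * (2:ℝ) ^ ⌊s⌋₊ = Real.exp ((⌊s⌋₊ + 1) * Real.log 2) := by
      rw [add_mul, one_mul, Real.exp_add, ← e2, Real.exp_log two_pos, mul_comm]
    have h2 : Real.exp (s / 2) ≤ 2 * (2:ℝ) ^ ⌊s⌋₊ := by
      rw [h1, Real.exp_le_exp]
      nlinarith
    have h3 := Real.pow_div_factorial_le_exp (s / 2) (by linarith) 3
    norm_num [Nat.factorial] at h3
    nlinarith [sq_nonneg s]
  · have h1 : (2:ℝ) ^ ⌊s⌋₊ ≤ Real.exp s := by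
      rw [e2, Real.exp_le_exp]
      nlinarith [Nat.cast_nonneg (α := ℝ) ⌊s⌋₊]
    have h3 := Real.pow_div_factorial_le_exp s (by linarith) 2
    norm_num [Nat.factorial] at h3
    have h4 : 180 * A ≤ Real.exp s := by linarith [Real.add_one_le_exp s]
    calc 90 * A * l * 2 ^ ⌊s⌋₊ = (180 * A) * (s ^ 2 / 2) * 2 ^ ⌊s⌋₊ := by rw [hls]; ring
      _ ≤ Real.exp s * Real.exp s * Real.exp s := by gcongr
      _ = Real.exp (3 * s) := by rw [← Real.exp_add, ← Real.exp_add]; congr 1; ring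
      _ ≤ Real.exp l := by rw [Real.exp_le_exp, hls]; nlinarith

lemma exists_prime_range {T l : ℝ} (hT : 0 < T) (hl : 1 ≤ l) (hL : 4 * l ≤ Real.log T) :
    ∃ k N : ℕ, 1 ≤ k ∧ l ≤ k ∧ (k : ℝ) ≤ 2 * l ∧ (N : ℝ) ^ k ≤ T ∧ (N : ℝ) ≤ T ∧
      Real.exp (Real.log T / (8 * l)) ≤ √N := by
  set L := Real.log T with hLdef
  have hLp : 0 < L := by linarith
  have hk1 : l ≤ ⌈l⌉₊ := Nat.le_ceil l
  have hk2 : (⌈l⌉₊ : ℝ) < l + 1 := Nat.ceil_lt_add_one (by linarith)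
  have hkp : (1:ℝ) ≤ ⌈l⌉₊ := hl.trans hk1
  have hk0 : (0:ℝ) < ⌈l⌉₊ := by linarith
  have hN1 : ((⌊Real.exp (L / ⌈l⌉₊)⌋₊ : ℕ) : ℝ) ≤ Real.exp (L / ⌈l⌉₊) :=
    Nat.floor_le (Real.exp_pos _).le
  have hTL : Real.exp L = T := Real.exp_log hT
  refine ⟨⌈l⌉₊, ⌊Real.exp (L / ⌈l⌉₊)⌋₊, by exact_mod_cast hkp, hk1, by linarith, ?_, ?_, ?_⟩
  · calc _ ≤ Real.exp (L / ⌈l⌉₊) ^ ⌈l⌉₊ := by gcongr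
      _ = T := by rw [← Real.exp_nat_mul, mul_div_cancel₀ _ hk0.ne', hTL]
  · refine hN1.trans ?_
    rw [← hTL, Real.exp_le_exp]
    exact div_le_self hLp.le hkp
  · rw [Real.le_sqrt' (Real.exp_pos _), ← Real.exp_nat_mul]
    set y := Real.exp (L / (4 * l)) with hy
    have e1 : ((2 : ℕ) : ℝ) * (L / (8 * l)) = L / (4 * l) := by
      push_cast
      field_simp
      norm_num
    rw [e1, ← hy]
    have hy2 : 2 ≤ y := by
      have : 1 ≤ L / (4 * l) := by rw [le_div_iff₀ (by positivity)]; linarith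
      linarith [Real.add_one_le_exp (L / (4 * l))]
    have hyy : y ^ 2 ≤ Real.exp (L / ⌈l⌉₊) := by
      rw [hy, ← Real.exp_nat_mul, Real.exp_le_exp]
      have e2 : ((2 : ℕ) : ℝ) * (L / (4 * l)) = L / (2 * l) := by
        push_cast
        field_simp
        norm_num
      rw [e2]
      gcongr
      linarith
    have := Nat.lt_floor_add_one (Real.exp (L / ⌈l⌉₊))
    nlinarith

set_option maxHeartbeats 1000000 in
lemma exists_good_majorant : ∃ T₁ K : ℝ, 20 ≤ T₁ ∧ 0 ≤ K ∧ ∀ T, T₁ ≤ T →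
    ∃ Z : ℝ → ℝ, Continuous Z ∧ (∀ t, 0 ≤ Z t) ∧
      (∀ t : ℝ, T / Real.log T ^ 3 ≤ t → t ≤ T → ‖riemannZeta (1 / 2 + t * I)‖ ^ 4 ≤ Z t) ∧
      ∫ t in (0:ℝ)..T, Z t ≤ T * Real.log T ^ 21 ∧
      ∀ t : ℝ, T / Real.log T ^ 3 ≤ t → t ≤ T → Z t ≤ Real.log T ^ 60 →
        ∀ φ : ℝ → ℂ, ContinuousOn φ (Icc (1 / 2) 2) →
        (∀ x ∈ Icc (1 / 2 : ℝ) 2, cexp (φ x) = riemannZeta (x + t * I)) →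
        |(φ 2).im - (φ (1 / 2)).im| ≤
          K * (Real.log (Real.log T) * √(Real.log (Real.log T))) := by
  set A : ℝ := 4 * Real.exp 30 + 60 with hAdef
  have hE : 0 < Real.exp 30 := Real.exp_pos 30
  have hA : 1 ≤ A := by rw [hAdef]; linarith
  obtain ⟨B, K, hB, hK, hgood⟩ := exists_arg_good hA
  obtain ⟨Bc, hBc, hcrude⟩ := exists_zeta_crude
  obtain ⟨T₂, -, hζ⟩ := exists_zeta_fourth_moment_majorant
  obtain ⟨T₃, -, hM⟩ := exists_moebiusSum_majorant
  obtain ⟨T₄, -, hP⟩ := exists_primeSum_majorant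
  obtain ⟨T₅, -, hpr⟩ := exists_sum_prime_inv_le
  set l₀ : ℝ := 2 * B + (384 * A) ^ 2 with hl₀
  obtain ⟨T₆, h20, hlarge⟩ := exists_log_large (Real.exp l₀ + Bc) 4
  refine ⟨max T₆ (max (max T₂ T₃) (max T₄ T₅)), K, h20.trans (le_max_left _ _), hK,
    fun T hT => ?_⟩
  simp only [max_le_iff] at hT
  obtain ⟨hT6, ⟨hT2, hT3⟩, hT4, hT5⟩ := hT
  obtain ⟨hLl, h100⟩ := hlarge T hT6
  have hT20 : 20 ≤ T := h20.trans hT6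
  have hT0 : 0 < T := by linarith
  set L := Real.log T with hLdef
  have hLe : Real.exp l₀ ≤ L := by linarith
  have hLp : 0 < L := (Real.exp_pos _).trans_le hLe
  have hl : l₀ ≤ Real.log L := (Real.le_log_iff_exp_le hLp).2 hLe
  set l := Real.log L with hldef
  have hLexp : Real.exp l = L := Real.exp_log hLp
  have hBl : 2 * B ≤ l := by linarith [sq_nonneg (384 * A)]
  have hl1 : 1 ≤ l := by linarith
  have hlp : 0 < l := by linarith
  have hsq : 384 * A ≤ √l := Real.le_sqrt_of_sq_le (by linarith)
  have hBL : B * l ≤ L := by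
    have h3 := Real.pow_div_factorial_le_exp l hlp.le 2
    norm_num [Nat.factorial] at h3
    rw [← hLexp]
    linarith [mul_le_mul_of_nonneg_right hBl hlp.le]
  have h4L : 4 * l ≤ L := by linarith [mul_le_mul_of_nonneg_right hB hlp.le]
  obtain ⟨hJ1, hJ2⟩ := two_pow_floor_sqrt_bounds hA hsq
  rw [hLexp] at hJ2
  obtain ⟨k, N, hk, hlk, hkl, hNk, hNT, hNs⟩ := exists_prime_range hT0 hl1 h4L
  obtain ⟨Z₁, hZ₁c, hZ₁0, hZ₁, hZ₁i⟩ := hζ T hT2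
  obtain ⟨Z₂, hZ₂c, hZ₂0, hZ₂, hZ₂i⟩ := hM T hT3 ⌊T⌋₊ (Nat.floor_le hT0.le)
  obtain ⟨Z₃, hZ₃c, hZ₃0, hZ₃, hZ₃i⟩ := hP T hT4 k N hk hNk
  have hL3 : 3 ≤ L := by linarith
  have hpow : L ^ 60 = Real.exp (60 * l) := by
    rw [← hLexp, ← Real.exp_nat_mul]
    norm_num
  refine ⟨fun t => Z₁ t + Z₂ t + Z₃ t, (hZ₁c.add hZ₂c).add hZ₃c,
    fun t => add_nonneg (add_nonneg (hZ₁0 t) (hZ₂0 t)) (hZ₃0 t), fun t h1 h2 => ?_, ?_,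
    fun t h1 h2 hZ φ hφ hφz => ?_⟩
  · have := hZ₁ t t h1 h2 (by rw [sub_self, abs_zero]; linarith)
    linarith [hZ₂0 t, hZ₃0 t]
  · have hi : ∫ t in (0:ℝ)..T, (Z₁ t + Z₂ t + Z₃ t) =
        (∫ t in (0:ℝ)..T, Z₁ t) + (∫ t in (0:ℝ)..T, Z₂ t) + ∫ t in (0:ℝ)..T, Z₃ t := by
      have h12 : IntervalIntegrable (fun t => Z₁ t + Z₂ t) volume 0 T :=
        (hZ₁c.add hZ₂c).intervalIntegrable _ _
      rw [intervalIntegral.integral_add h12 (hZ₃c.intervalIntegrable _ _),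
        intervalIntegral.integral_add (hZ₁c.intervalIntegrable _ _)
        (hZ₂c.intervalIntegrable _ _)]
    refine hi.trans_le ?_
    have hL1 : 1 ≤ L := by linarith
    have p5 : T * L ^ 5 ≤ T * L ^ 20 := by gcongr; norm_num
    have p4 : T * L ^ 4 ≤ T * L ^ 20 := by gcongr; norm_num
    have p21 : T * L ^ 21 = T * L ^ 20 * L := by ring
    linarith [mul_le_mul_of_nonneg_left hL3 (by positivity : 0 ≤ T * L ^ 20)]
  · have hz1 : Z₁ t ≤ L ^ 60 := by linarith [hZ₂0 t, hZ₃0 t]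
    have hz2 : Z₂ t ≤ L ^ 60 := by linarith [hZ₁0 t, hZ₃0 t]
    have hz3 : Z₃ t ≤ L ^ 60 := by linarith [hZ₁0 t, hZ₂0 t]
    have hA60 : 60 ≤ A := by rw [hAdef]; linarith
    have ht10 : 10 ≤ t := by
      refine le_trans ?_ h1
      rw [le_div_iff₀ (by positivity)]
      have : L ^ 3 ≤ L ^ 4 := pow_le_pow_right₀ (by linarith) (by norm_num)
      have : 0 ≤ L ^ 4 := by positivity
      linarith
    refine hgood T t l N ⌊√l⌋₊ (by linarith) hBL hT0 ht10 hJ1 hJ2 (Nat.floor_le (Real.sqrt_nonneg _))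
      hNT hNs (hcrude T t (by linarith [Real.exp_pos l₀]) h100 h1 h2) (fun u hu => ?_)
      (fun u hu => ?_) (fun u hu => ?_) φ hφ hφz
    · have h := (hZ₁ t u h1 h2 hu).trans hz1
      have e : L ^ 60 = Real.exp (15 * l) ^ 4 := by
        rw [hpow, ← Real.exp_nat_mul]; congr 1; push_cast; ring
      rw [e] at h
      refine (le_of_pow_le_pow_left₀ (by norm_num) (Real.exp_pos _).le h).trans ?_
      rw [Real.exp_le_exp]
      linarith [mul_le_mul_of_nonneg_right hA60 hlp.le]
    · have h := (hZ₂ t u (by linarith)).trans hz2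
      have e : L ^ 60 = Real.exp (30 * l) ^ 2 := by
        rw [hpow, ← Real.exp_nat_mul]; congr 1; push_cast; ring
      rw [e] at h
      refine (le_of_pow_le_pow_left₀ (by norm_num) (Real.exp_pos _).le h).trans ?_
      rw [Real.exp_le_exp]
      linarith [mul_le_mul_of_nonneg_right hA60 hlp.le]
    · have h := hZ₃ t u (by linarith)
      have hk0 : (0:ℝ) < k := by linarith
      have h' : (‖primeSum N (1 / 2 + u * I)‖ ^ 2) ^ k ≤ (6 * k * l * Real.exp 60) ^ k := by
        rw [← pow_mul, mul_pow (6 * (k:ℝ) * l)]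
        refine h.trans ?_
        gcongr
        refine hz3.trans ?_
        rw [hpow, ← Real.exp_nat_mul, Real.exp_le_exp]
        linarith
      have h2 := le_of_pow_le_pow_left₀ (by omega) (by positivity) h'
      have h3 : ‖primeSum N (1 / 2 + u * I)‖ ^ 2 ≤ (4 * Real.exp 30 * l) ^ 2 := by
        have e : Real.exp 60 = Real.exp 30 ^ 2 := by
          rw [← Real.exp_nat_mul]; norm_num
        rw [e] at h2
        refine h2.trans ?_
        have : 6 * k * l ≤ 16 * l ^ 2 := by
          linarith [mul_le_mul_of_nonneg_right hkl hlp.le, sq_nonneg l]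
        calc _ ≤ 16 * l ^ 2 * Real.exp 30 ^ 2 := by gcongr
          _ = _ := by ring
      have h4 := le_of_pow_le_pow_left₀ (by norm_num) (by positivity) h3
      have h5 := hpr T hT5 N hNT
      refine (norm_eulerLog_half_le N u).trans ?_
      rw [hAdef]
      linarith

lemma intervalIntegrable_norm_sq_zeta {a b : ℝ} (ha : 0 < a) (hab : a ≤ b) :
    IntervalIntegrable (fun t : ℝ => ‖riemannZeta (1 / 2 + t * I)‖ ^ 2) volume a b := by
  refine ContinuousOn.intervalIntegrable fun t ht => ?_
  rw [uIcc_of_le hab] at ht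
  have := continuousAt_zeta_vertical (1 / 2) (t := t) (by linarith [ht.1])
  push_cast at this
  exact (this.norm.pow 2).continuousWithinAt

lemma integral_norm_sq_zeta_le_of_subset {a b c : ℝ} (ha : 1 ≤ a) (hab : a ≤ b) (hbc : b ≤ c) :
    ∫ t in a..b, ‖riemannZeta (1 / 2 + t * I)‖ ^ 2
      ≤ ∫ t in (1:ℝ)..c, ‖riemannZeta (1 / 2 + t * I)‖ ^ 2 :=
  intervalIntegral.integral_mono_interval ha hab hbc (ae_of_all _ fun t => by positivity)
    (intervalIntegrable_norm_sq_zeta one_pos (by linarith))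

lemma integral_le_of_ae_abs_le_log {S : ℝ → ℝ} {C a b : ℝ}
    (hC : ∀ᵐ t : ℝ, 3 ≤ t → |S t| ≤ C * Real.log t) (hC0 : 0 ≤ C) (ha : 3 ≤ a) (hab : a ≤ b)
    (hi : IntervalIntegrable (fun t : ℝ => ‖riemannZeta (1 / 2 + t * I)‖ ^ 2 * S t ^ 2) volume a b) :
    ∫ t in a..b, ‖riemannZeta (1 / 2 + t * I)‖ ^ 2 * S t ^ 2
      ≤ (C * Real.log b) ^ 2 * ∫ t in (1:ℝ)..b, ‖riemannZeta (1 / 2 + t * I)‖ ^ 2 := by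
  have hζ := intervalIntegrable_norm_sq_zeta (a := a) (b := b) (by linarith) hab
  calc _ ≤ ∫ t in a..b, (C * Real.log b) ^ 2 * ‖riemannZeta (1 / 2 + t * I)‖ ^ 2 := by
        refine intervalIntegral.integral_mono_ae_restrict hab hi (hζ.const_mul _) ?_
        refine (ae_restrict_iff' measurableSet_Icc).2 ?_
        filter_upwards [hC] with t ht htab
        rw [mul_comm, ← sq_abs (S t)]
        gcongr
        refine (ht (ha.trans htab.1)).trans ?_
        gcongr
        · linarith [htab.1]
        · exact htab.2
    _ = (C * Real.log b) ^ 2 * ∫ t in a..b, ‖riemannZeta (1 / 2 + t * I)‖ ^ 2 :=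
        intervalIntegral.integral_const_mul _ _
    _ ≤ _ := by
        gcongr
        exact integral_norm_sq_zeta_le_of_subset (by linarith) hab le_rfl

lemma mul_le_of_sq_le {x y z : ℝ} (hx : 0 ≤ x) (hy : 0 ≤ y) (hxz : x ^ 2 ≤ z) (hyz : y ^ 2 < z) :
    x * y ≤ z := by
  rcases le_total x y with h | h <;> nlinarith

lemma exists_integral_high {S : ℝ → ℝ} (hS : IsS S) {C : ℝ} (hC0 : 0 ≤ C)
    (hC : ∀ᵐ t : ℝ, 3 ≤ t → |S t| ≤ C * Real.log t) :
    ∃ T₁ K : ℝ, 20 ≤ T₁ ∧ 0 ≤ K ∧ ∀ T, T₁ ≤ T →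
      IntervalIntegrable (fun t : ℝ => ‖riemannZeta (1 / 2 + t * I)‖ ^ 2 * S t ^ 2) volume
        (T / Real.log T ^ 3) T →
      ∫ t in (T / Real.log T ^ 3)..T, ‖riemannZeta (1 / 2 + t * I)‖ ^ 2 * S t ^ 2
        ≤ K * (T * Real.log T * Real.log (Real.log T) ^ 3) := by
  obtain ⟨T₁, K, -, hK, hgood⟩ := exists_good_majorant
  obtain ⟨C', hC'0, hC'⟩ := exists_integral_norm_sq_zeta_le
  obtain ⟨T₂, h20, hlarge⟩ := exists_log_large 3 4
  refine ⟨max T₁ T₂, (2 + K) ^ 2 * C' + C ^ 2, h20.trans (le_max_right _ _), by positivity,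
    fun T hT hi => ?_⟩
  obtain ⟨hL3, h100⟩ := hlarge T ((le_max_right _ _).trans hT)
  have hT20 : 20 ≤ T := h20.trans ((le_max_right _ _).trans hT)
  obtain ⟨Z, hZc, hZ0, hZ1, hZi, hZ⟩ := hgood T ((le_max_left _ _).trans hT)
  set L := Real.log T with hLdef
  set l := Real.log L with hldef
  have hL1 : 1 ≤ L := by linarith
  have hLp : 0 < L := by linarith
  have hl1 : 1 ≤ l := by
    rw [hldef, Real.le_log_iff_exp_le hLp]
    linarith [Real.exp_one_lt_d9]
  have hl0 : 0 ≤ l := by linarith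
  have hL34 : L ^ 3 ≤ L ^ 4 := pow_le_pow_right₀ hL1 (by norm_num)
  have hL30 : 1 ≤ L ^ 3 := one_le_pow₀ hL1
  have hx3 : 20 ≤ T / L ^ 3 := by
    rw [le_div_iff₀ (by positivity)]
    linarith
  have hxT : T / L ^ 3 ≤ T := div_le_self (by linarith) hL30
  set x := T / L ^ 3 with hx
  have hζ := intervalIntegrable_norm_sq_zeta (a := x) (b := T) (by linarith) hxT
  have hpt : ∀ᵐ t : ℝ, t ∈ Icc x T → ‖riemannZeta (1 / 2 + t * I)‖ ^ 2 * S t ^ 2 ≤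
      ((2 + K) ^ 2 * l ^ 3) * ‖riemannZeta (1 / 2 + t * I)‖ ^ 2 + (C ^ 2 * L ^ 2 / L ^ 30) * Z t := by
    filter_upwards [hC, ae_zeta_ne_zero] with t hCt hne ht
    have ht3 : 3 ≤ t := by linarith [ht.1]
    rcases le_or_gt (Z t) (L ^ 60) with h | h
    · have h1 := abs_S_le_of_arg hS (by linarith) hne (hZ t ht.1 ht.2 h)
      have hs1 : 1 ≤ √l := Real.one_le_sqrt.2 hl1
      have h2 : |S t| ≤ (2 + K) * (l * √l) := by
        nlinarith [one_le_mul_of_one_le_of_one_le hl1 hs1]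
      have h3 : S t ^ 2 ≤ (2 + K) ^ 2 * l ^ 3 := by
        rw [← sq_abs]
        calc _ ≤ ((2 + K) * (l * √l)) ^ 2 := by gcongr
          _ = (2 + K) ^ 2 * (l ^ 2 * √l ^ 2) := by ring
          _ = _ := by rw [Real.sq_sqrt hl0]; ring
      have h4 : 0 ≤ (C ^ 2 * L ^ 2 / L ^ 30) * Z t := mul_nonneg (by positivity) (hZ0 t)
      have := mul_le_mul_of_nonneg_left h3 (sq_nonneg ‖riemannZeta (1 / 2 + t * I)‖)
      linarith
    · have h1 : S t ^ 2 ≤ (C * L) ^ 2 := by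
        rw [← sq_abs]
        have := hCt ht3
        gcongr
        refine this.trans ?_
        gcongr
        exact Real.log_le_log (by linarith) ht.2
      have h2 : ‖riemannZeta (1 / 2 + t * I)‖ ^ 2 * L ^ 30 ≤ Z t :=
        mul_le_of_sq_le (by positivity) (by positivity)
          ((by ring : _ = ‖riemannZeta (1 / 2 + t * I)‖ ^ 4).trans_le (hZ1 t ht.1 ht.2))
          ((by ring : _ = L ^ 60).trans_lt h)
      have h3 : 0 ≤ ((2 + K) ^ 2 * l ^ 3) * ‖riemannZeta (1 / 2 + t * I)‖ ^ 2 := by positivity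
      have h4 : ‖riemannZeta (1 / 2 + t * I)‖ ^ 2 ≤ Z t / L ^ 30 := by
        rw [le_div_iff₀ (by positivity)]
        exact h2
      have h5 : ‖riemannZeta (1 / 2 + t * I)‖ ^ 2 * S t ^ 2 ≤ Z t / L ^ 30 * (C * L) ^ 2 := by
        have := hZ0 t
        gcongr
      have h6 : Z t / L ^ 30 * (C * L) ^ 2 = (C ^ 2 * L ^ 2 / L ^ 30) * Z t := by ring
      linarith
  have hint_le := intervalIntegral.integral_mono_ae_restrict hxT hi
    ((hζ.const_mul ((2 + K) ^ 2 * l ^ 3)).add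
      ((hZc.intervalIntegrable x T).const_mul (C ^ 2 * L ^ 2 / L ^ 30)))
    ((ae_restrict_iff' measurableSet_Icc).2 hpt)
  refine hint_le.trans ?_
  rw [intervalIntegral.integral_add (hζ.const_mul _) ((hZc.intervalIntegrable x T).const_mul _),
    intervalIntegral.integral_const_mul, intervalIntegral.integral_const_mul]
  have i1 : ∫ t in x..T, ‖riemannZeta (1 / 2 + t * I)‖ ^ 2 ≤ C' * T * L :=
    (integral_norm_sq_zeta_le_of_subset (by linarith) hxT le_rfl).trans (hC' T hT20)
  have i2 : ∫ t in x..T, Z t ≤ T * L ^ 21 :=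
    (intervalIntegral.integral_mono_interval (by linarith) hxT le_rfl (ae_of_all _ hZ0)
      (hZc.intervalIntegrable 0 T)).trans hZi
  have j1 : ((2 + K) ^ 2 * l ^ 3) * ∫ t in x..T, ‖riemannZeta (1 / 2 + t * I)‖ ^ 2
      ≤ (2 + K) ^ 2 * C' * (T * L * l ^ 3) := by
    calc _ ≤ ((2 + K) ^ 2 * l ^ 3) * (C' * T * L) := by gcongr
      _ = _ := by ring
  have j2 : (C ^ 2 * L ^ 2 / L ^ 30) * ∫ t in x..T, Z t ≤ C ^ 2 * (T * L * l ^ 3) := by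
    have hL23 : L ^ 2 * L ^ 21 ≤ L ^ 30 := by
      rw [← pow_add]
      exact pow_le_pow_right₀ hL1 (by norm_num)
    calc _ ≤ (C ^ 2 * L ^ 2 / L ^ 30) * (T * L ^ 21) := by gcongr
      _ = C ^ 2 * (T * (L ^ 2 * L ^ 21 / L ^ 30)) := by ring
      _ ≤ C ^ 2 * (T * 1) := by
        gcongr
        exact div_le_one_of_le₀ hL23 (by positivity)
      _ ≤ C ^ 2 * (T * (L * l ^ 3)) := by
        gcongr
        exact one_le_mul_of_one_le_of_one_le hL1 (one_le_pow₀ hl1)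
      _ = _ := by ring
  linarith

lemma exists_integral_le {S : ℝ → ℝ} (hS : IsS S) :
    ∃ T₁ K M : ℝ, 20 ≤ T₁ ∧ 0 ≤ K ∧ 0 ≤ M ∧
      (∀ T, 3 ≤ T → T ≤ T₁ →
        |∫ t in (1:ℝ)..T, ‖riemannZeta (1 / 2 + t * I)‖ ^ 2 * S t ^ 2| ≤ M) ∧
      ∀ T, T₁ ≤ T → 1 ≤ Real.log (Real.log T) ∧
        |∫ t in (1:ℝ)..T, ‖riemannZeta (1 / 2 + t * I)‖ ^ 2 * S t ^ 2|
          ≤ K * (T * Real.log T * Real.log (Real.log T) ^ 3) := by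
  obtain ⟨C, hC0, hC⟩ := exists_abs_S_le hS
  obtain ⟨T₁, K, h20, hK, hhigh⟩ := exists_integral_high hS hC0 hC
  obtain ⟨C', hC'0, hC'⟩ := exists_integral_norm_sq_zeta_le
  obtain ⟨T₂, -, hlarge⟩ := exists_log_large 3 4
  set F : ℝ → ℝ := fun t => ‖riemannZeta (1 / 2 + t * I)‖ ^ 2 * S t ^ 2 with hF
  have hF0 : ∀ t, 0 ≤ F t := fun t => by positivity
  set c₀ : ℝ := ∫ t in (1:ℝ)..3, F t with hc₀
  have hc₀0 : 0 ≤ c₀ := intervalIntegral.integral_nonneg (by norm_num) fun t _ => hF0 t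
  set T₀ := max T₁ T₂ with hT₀
  have hT₀20 : 20 ≤ T₀ := h20.trans (le_max_left _ _)
  have hI : ∀ T, 1 ≤ T → 0 ≤ ∫ t in (1:ℝ)..T, ‖riemannZeta (1 / 2 + t * I)‖ ^ 2 :=
    fun T hT => intervalIntegral.integral_nonneg hT fun t _ => by positivity
  have hsub : ∀ {a b T : ℝ}, IntervalIntegrable F volume 1 T → 1 ≤ a → a ≤ b → b ≤ T →
      IntervalIntegrable F volume a b := fun hi h1 h2 h3 => hi.mono_set (by
    rw [uIcc_of_le h2, uIcc_of_le (h1.trans (h2.trans h3))]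
    exact Icc_subset_Icc h1 h3)
  refine ⟨T₀, c₀ + C ^ 2 * C' + K,
    c₀ + (C * Real.log T₀) ^ 2 * ∫ t in (1:ℝ)..T₀, ‖riemannZeta (1 / 2 + t * I)‖ ^ 2,
    hT₀20, by positivity, add_nonneg hc₀0 (mul_nonneg (by positivity) (hI T₀ (by linarith))),
    fun T hT3 hTT => ?_, fun T hT => ?_⟩
  · by_cases hi : IntervalIntegrable F volume 1 T
    · rw [abs_of_nonneg (intervalIntegral.integral_nonneg (by linarith) fun t _ => hF0 t),
        ← intervalIntegral.integral_add_adjacent_intervals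
          (hsub hi le_rfl (by norm_num : (1:ℝ) ≤ 3) hT3) (hsub hi (by norm_num) hT3 le_rfl)]
      have h1 := integral_le_of_ae_abs_le_log hC hC0 le_rfl hT3
        (hsub hi (by norm_num) hT3 le_rfl)
      have h2 : Real.log T ≤ Real.log T₀ := Real.log_le_log (by linarith) hTT
      have h3 : 0 ≤ Real.log T := Real.log_nonneg (by linarith)
      have h4 := integral_norm_sq_zeta_le_of_subset le_rfl (by linarith : (1:ℝ) ≤ T) hTT
      have h5 := hI T (by linarith)
      refine add_le_add le_rfl (h1.trans ?_)
      gcongr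
    · rw [intervalIntegral.integral_undef hi, abs_zero]
      exact add_nonneg hc₀0 (mul_nonneg (by positivity) (hI T₀ (by linarith)))
  · obtain ⟨hL3, h100⟩ := hlarge T ((le_max_right _ _).trans hT)
    have hT20 : 20 ≤ T := hT₀20.trans hT
    have hh := hhigh T ((le_max_left _ _).trans hT)
    set L := Real.log T with hLdef
    set l := Real.log L with hldef
    have hL1 : 1 ≤ L := by linarith
    have hLp : 0 < L := by linarith
    have hl1 : 1 ≤ l := by
      rw [hldef, Real.le_log_iff_exp_le hLp]
      linarith [Real.exp_one_lt_d9]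
    have hl0 : 0 ≤ l := by linarith
    refine ⟨hl1, ?_⟩
    have hL34 : L ^ 3 ≤ L ^ 4 := pow_le_pow_right₀ hL1 (by norm_num)
    have hL30 : 1 ≤ L ^ 3 := one_le_pow₀ hL1
    have hx3 : 20 ≤ T / L ^ 3 := by
      rw [le_div_iff₀ (by positivity)]
      linarith
    have hxT : T / L ^ 3 ≤ T := div_le_self (by linarith) hL30
    have hW : T ≤ T * L * l ^ 3 := by
      rw [mul_assoc]
      exact le_mul_of_one_le_right (by linarith)
        (one_le_mul_of_one_le_of_one_le hL1 (one_le_pow₀ hl1))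
    by_cases hi : IntervalIntegrable F volume 1 T
    · have i1 := hsub hi le_rfl (by norm_num : (1:ℝ) ≤ 3) (by linarith)
      have i2 := hsub hi (by norm_num) (by linarith : 3 ≤ T / L ^ 3) hxT
      have i3 := hsub hi (by linarith) hxT le_rfl
      rw [abs_of_nonneg (intervalIntegral.integral_nonneg (by linarith) fun t _ => hF0 t),
        ← intervalIntegral.integral_add_adjacent_intervals (i1.trans i2) i3,
        ← intervalIntegral.integral_add_adjacent_intervals i1 i2]
      have h1 := integral_le_of_ae_abs_le_log hC hC0 le_rfl (by linarith) i2
      have h2 : Real.log (T / L ^ 3) ≤ L := Real.log_le_log (by linarith) hxT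
      have h3 : 0 ≤ Real.log (T / L ^ 3) := Real.log_nonneg (by linarith)
      have h4 : ∫ t in (3:ℝ)..(T / L ^ 3), F t ≤ C ^ 2 * C' * T := by
        refine h1.trans ?_
        calc _ ≤ (C * L) ^ 2 * (C' * (T / L ^ 3) * L) := by
              have h9 := (hC' _ hx3).trans (mul_le_mul_of_nonneg_left h2 (by positivity))
              have := hI (T / L ^ 3) (by linarith)
              gcongr
          _ = C ^ 2 * C' * T := by
              field_simp
      have h5 := hh i3
      have h6 : c₀ ≤ c₀ * (T * L * l ^ 3) := le_mul_of_one_le_right hc₀0 (by linarith)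
      have h7 : C ^ 2 * C' * T ≤ C ^ 2 * C' * (T * L * l ^ 3) := by gcongr
      have h8 := add_le_add (add_le_add (le_refl c₀) h4) h5
      refine h8.trans ?_
      linarith
    · rw [intervalIntegral.integral_undef hi, abs_zero]
      positivity

theorem statement17 (S : ℝ → ℝ) (hS : IsS S) :
    ∀ ε : ℝ, 0 < ε → ∃ K : ℝ, ∀ T : ℝ, 3 ≤ T →
      |∫ t in (1:ℝ)..T, ‖riemannZeta (1/2 + t * I)‖ ^ 2 * (S t) ^ 2|
        ≤ K * T * Real.log T * (Real.log (Real.log T)) ^ (3 + ε : ℝ) := by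
  intro ε hε
  obtain ⟨T₁, K, M, h20, hK, hM, hsmall, hbig⟩ := exists_integral_le hS
  have hlog3 : 1 < Real.log 3 := by
    rw [Real.lt_log_iff_exp_lt (by norm_num)]
    linarith [Real.exp_one_lt_d9]
  have hq : 0 < Real.log (Real.log 3) ^ (3 + ε) := Real.rpow_pos_of_pos (Real.log_pos hlog3) _
  set q := Real.log (Real.log 3) ^ (3 + ε) with hqdef
  refine ⟨K + M / q, fun T hT => ?_⟩
  have hlogT : 1 < Real.log T := hlog3.trans_le (Real.log_le_log (by norm_num) hT)
  have hll : 0 < Real.log (Real.log T) := Real.log_pos hlogT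
  have hlq : q ≤ Real.log (Real.log T) ^ (3 + ε) :=
    Real.rpow_le_rpow (Real.log_pos hlog3).le
      (Real.log_le_log (by linarith) (Real.log_le_log (by norm_num) hT)) (by linarith)
  have hMq : 0 ≤ M / q := by positivity
  have hTL : 1 ≤ T * Real.log T := one_le_mul_of_one_le_of_one_le (by linarith) hlogT.le
  rcases le_total T T₁ with h | h
  · refine (hsmall T hT h).trans ?_
    calc M = M / q * 1 * q := by field_simp
      _ ≤ (K + M / q) * (T * Real.log T) * Real.log (Real.log T) ^ (3 + ε) := by
        gcongr
        linarith
      _ = _ := by ring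
  · obtain ⟨hl1, hb⟩ := hbig T h
    refine hb.trans ?_
    have e : Real.log (Real.log T) ^ 3 ≤ Real.log (Real.log T) ^ (3 + ε) := by
      rw [← Real.rpow_natCast]
      exact Real.rpow_le_rpow_of_exponent_le hl1 (by push_cast; linarith)
    calc _ ≤ (K + M / q) * (T * Real.log T * Real.log (Real.log T) ^ (3 + ε)) := by
          gcongr
          linarith
      _ = _ := by ring
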